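/- arXiv:2601.05471 — 3 statements merged into one kernel-verified Lean document; each statement's English description precedes it below -/
import Mathlib

section
/- Let k and n be positive integers with n ≥ k. Then the numbers of semistandard Young tableaux of adjacent staircase shapes satisfy the integer identity (2k)! · |SST(δ_{k+1}, n)| = 2^k · k! · (∏_{j=0}^{k−1} (n − k + 1 + 2j)) · |SST(δ_k, n)|. -/
/-- `(i,j)` (1-indexed) is a box of the Young diagram of the staircase `δ_k`. -/
def StairBox (k : ℕ) (p : ℕ × ℕ) : Prop := 1 ≤ p.1 ∧ 1 ≤ p.2 ∧ p.1 + p.2 ≤ k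

/-- `T` is a semistandard Young tableau of staircase shape `δ_k` with entries in `{1,…,n}`. -/
def IsSSTStair (k n : ℕ) (T : ℕ × ℕ → ℕ) : Prop :=
  (∀ p, StairBox k p → 1 ≤ T p ∧ T p ≤ n) ∧
  (∀ p, ¬ StairBox k p → T p = 0) ∧
  (∀ p q, StairBox k p → StairBox k q → q.1 = p.1 → q.2 = p.2 + 1 → T p ≤ T q) ∧
  (∀ p q, StairBox k p → StairBox k q → q.1 = p.1 + 1 → q.2 = p.2 → T p < T q)

/-- The number of semistandard Young tableaux of shape `δ_k` with entries in `{1,…,n}`. -/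
noncomputable def SSTcard (k n : ℕ) : ℕ := Nat.card {T : ℕ × ℕ → ℕ // IsSSTStair k n T}

/-- The product of all differences `l j - l i` with `i < j < n`. -/
def diffProd (n : ℕ) (l : ℕ → ℤ) : ℤ :=
  ∏ j ∈ Finset.range n, ∏ i ∈ Finset.range j, (l j - l i)

lemma det_vandermonde_eq_diffProd (n : ℕ) (l : ℕ → ℤ) :
    (Matrix.vandermonde fun i : Fin n => l i).det = diffProd n l := by
  rw [Matrix.det_vandermonde, diffProd,
    ← Fin.prod_univ_eq_prod_range (fun j => ∏ i ∈ Finset.range j, (l j - l i)) n,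
    Finset.prod_comm' (t' := Finset.univ) (s' := fun j : Fin n => Finset.Iio j) (by simp)]
  refine Finset.prod_congr rfl fun j _ => ?_
  rw [← Nat.Iio_eq_range, ← Fin.map_valEmbedding_Iio, Finset.prod_map]
  rfl

lemma prod_factorial_mul_det_choose (n : ℕ) (v : ℕ → ℕ) :
    (∏ j ∈ Finset.range n, (j.factorial : ℤ)) *
      (Matrix.of fun i j : Fin n => ((v i).choose j : ℤ)).det =
        diffProd n fun i => (v i : ℤ) := by
  rw [← det_vandermonde_eq_diffProd,
    Matrix.det_eval_matrixOfPolynomials_eq_det_vandermonde (fun i : Fin n => (v i : ℤ))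
      (fun i => descPochhammer ℤ i) (fun i => descPochhammer_natDegree ℤ i)
      (fun i => monic_descPochhammer ℤ i),
    ← Fin.prod_univ_eq_prod_range (fun j => (j.factorial : ℤ)) n, ← Matrix.det_mul_row]
  congr 1
  ext i j
  simp only [Matrix.of_apply]
  rw [descPochhammer_eval_eq_descFactorial ℤ, Nat.descFactorial_eq_factorial_mul_choose]
  push_cast
  rfl

lemma det_choose_succ (n : ℕ) (x : ℕ → ℕ) :
    (Matrix.of fun i j : Fin (n + 1) => ((x i).choose j : ℤ)).det =
      (Matrix.of fun i j : Fin n =>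
        ((x (i + 1)).choose (j + 1) : ℤ) - ((x i).choose (j + 1) : ℤ)).det := by
  rw [Matrix.det_eq_of_forall_row_eq_smul_add_pred
    (B := Matrix.of fun i j : Fin (n + 1) => Fin.cases (motive := fun _ => ℤ)
      ((x 0).choose j : ℤ)
      (fun i : Fin n => ((x (i + 1)).choose j : ℤ) - ((x i).choose j : ℤ)) i)
    (fun _ => 1) (by simp) (by simp), Matrix.det_succ_column_zero, Fin.sum_univ_succ]
  simp
  rfl

lemma sum_Icc_choose_add (p q i j : ℕ) (h : p ≤ q) :
    ∑ a ∈ Finset.Icc p q, ((a + i).choose j : ℤ) =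
      ((q + (i + 1)).choose (j + 1) : ℤ) - ((p + i).choose (j + 1) : ℤ) := by
  induction q, h using Nat.le_induction with
  | base =>
    rw [Finset.Icc_self, Finset.sum_singleton, ← add_assoc, Nat.choose_succ_succ]
    push_cast
    ring
  | succ q h ih =>
    rw [Finset.sum_Icc_succ_top (by omega), ih, ← add_assoc (q + 1), Nat.choose_succ_succ,
      show q + (i + 1) = q + 1 + i by ring]
    push_cast
    ring

lemma sum_det_choose (n : ℕ) (f : ℕ → ℕ) (hf : Antitone f) :
    ∑ m ∈ Fintype.piFinset fun i : Fin n => Finset.Icc (f (n - i)) (f (n - 1 - i)),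
        (Matrix.of fun i j : Fin n => ((m i + i).choose j : ℤ)).det =
      (Matrix.of fun i j : Fin (n + 1) => ((f (n - i) + i).choose j : ℤ)).det := by
  rw [det_choose_succ n fun i => f (n - i) + i]
  have h := (Matrix.detRowAlternating (n := Fin n) (R := ℤ)).toMultilinearMap.map_sum_finset
    (fun (i : Fin n) (a : ℕ) (j : Fin n) => ((a + i).choose j : ℤ))
    (fun i : Fin n => Finset.Icc (f (n - i)) (f (n - 1 - i)))
  refine h.symm.trans (congrArg Matrix.det ?_)
  ext i j
  rw [Finset.sum_apply, sum_Icc_choose_add _ _ _ _ (hf (by omega))]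
  simp [Nat.sub_sub, Nat.add_comm 1]

/-- `p` (1-indexed) is a box of the Young diagram whose `i`-th row has length `f (i - 1)`. -/
def RowBox (f : ℕ → ℕ) (p : ℕ × ℕ) : Prop := 1 ≤ p.1 ∧ 1 ≤ p.2 ∧ p.2 ≤ f (p.1 - 1)

/-- `T` is a semistandard Young tableau with row lengths `f 0, f 1, …` and entries in
`{1,…,n}`. -/
def IsSST (f : ℕ → ℕ) (n : ℕ) (T : ℕ × ℕ → ℕ) : Prop :=
  (∀ p, RowBox f p → 1 ≤ T p ∧ T p ≤ n) ∧
  (∀ p, ¬ RowBox f p → T p = 0) ∧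
  (∀ p q, RowBox f p → RowBox f q → q.1 = p.1 → q.2 = p.2 + 1 → T p ≤ T q) ∧
  (∀ p q, RowBox f p → RowBox f q → q.1 = p.1 + 1 → q.2 = p.2 → T p < T q)

lemma IsSST.row_le {f : ℕ → ℕ} {n : ℕ} {T : ℕ × ℕ → ℕ} (hT : IsSST f n T) {i j j' : ℕ}
    (hj : 1 ≤ j) (h : j ≤ j') (hj' : j' ≤ f i) : T (i + 1, j) ≤ T (i + 1, j') := by
  induction j', h using Nat.le_induction with
  | base => exact le_rfl
  | succ k hk ih =>
    exact (ih (by omega)).trans (hT.2.2.1 (i + 1, k) (i + 1, k + 1)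
      ⟨by simp, by simp; omega, by simp; omega⟩ ⟨by simp, by simp, by simpa using hj'⟩ rfl rfl)

lemma IsSST.row_lt_entry {f : ℕ → ℕ} {n : ℕ} {T : ℕ × ℕ → ℕ} (hT : IsSST f n T)
    (hf : Antitone f) {i j : ℕ} (hj : 1 ≤ j) (hj' : j ≤ f i) : i < T (i + 1, j) := by
  induction i with
  | zero => exact (hT.1 (0 + 1, j) ⟨by simp, hj, by simpa using hj'⟩).1
  | succ i ih =>
    have hi : j ≤ f i := hj'.trans (hf (by omega))
    have := hT.2.2.2 (i + 1, j) (i + 1 + 1, j) ⟨by simp, hj, by simpa using hi⟩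
      ⟨by simp, hj, by simpa using hj'⟩ rfl rfl
    have := ih hi
    omega

open Classical in
/-- The filling which agrees with `T` on the shape `g` and is constantly `n + 1` on the rest of
the shape `f`. -/
noncomputable def extendTableau (f g : ℕ → ℕ) (n : ℕ) (T : ℕ × ℕ → ℕ) (p : ℕ × ℕ) : ℕ :=
  if RowBox g p then T p else if RowBox f p then n + 1 else 0

lemma IsSST.extend {f g : ℕ → ℕ} {n : ℕ} {T : ℕ × ℕ → ℕ} (hT : IsSST g n T)
    (hgf : ∀ i, g i ≤ f i) (hfg : ∀ i, f (i + 1) ≤ g i) :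
    IsSST f (n + 1) (extendTableau f g n T) := by
  have hbox : ∀ p, RowBox g p → RowBox f p := fun p h => ⟨h.1, h.2.1, h.2.2.trans (hgf _)⟩
  refine ⟨fun p hp => ?_, fun p hp => ?_, fun p q hp hq h1 h2 => ?_, fun p q hp hq h1 h2 => ?_⟩
  · unfold extendTableau
    split_ifs with h
    · have := hT.1 p h
      omega
    · omega
  · simp [extendTableau, hp, mt (hbox p) hp]
  · by_cases hgq : RowBox g q
    · have hgp : RowBox g p := ⟨hp.1, hp.2.1, by have := hgq.2.2; rw [h1] at this; omega⟩
      simpa [extendTableau, hgq, hgp] using hT.2.2.1 p q hgp hgq h1 h2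
    · by_cases hgp : RowBox g p
      · simpa [extendTableau, hgq, hgp, hq] using (hT.1 p hgp).2.trans (Nat.le_succ n)
      · simp [extendTableau, hgq, hgp, hp, hq]
  · have hgp : RowBox g p := by
      refine ⟨hp.1, hp.2.1, ?_⟩
      have h3 := hq.2.2
      have h4 := hfg (p.1 - 1)
      have h5 := hp.1
      rw [h1, h2, show p.1 + 1 - 1 = p.1 - 1 + 1 by omega] at h3
      omega
    by_cases hgq : RowBox g q
    · simpa [extendTableau, hgq, hgp] using hT.2.2.2 p q hgp hgq h1 h2
    · simpa [extendTableau, hgq, hgp, hq] using Nat.lt_succ_of_le (hT.1 p hgp).2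

lemma extendTableau_le_iff {f g : ℕ → ℕ} {n : ℕ} {T : ℕ × ℕ → ℕ} (hT : IsSST g n T)
    {p : ℕ × ℕ} (hp : RowBox f p) : extendTableau f g n T p ≤ n ↔ RowBox g p := by
  by_cases hg : RowBox g p
  · simp [extendTableau, hg, (hT.1 p hg).2]
  · simp [extendTableau, hg, hp]

lemma IsSST.exists_extend {f : ℕ → ℕ} {n : ℕ} {T : ℕ × ℕ → ℕ} (hT : IsSST f (n + 1) T)
    (hf : Antitone f) :
    ∃ g T', (∀ i, g i ≤ f i) ∧ (∀ i, f (i + 1) ≤ g i) ∧ (∀ i, n ≤ i → g i = 0) ∧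
      IsSST g n T' ∧ extendTableau f g n T' = T := by
  classical
  have hcut : ∀ i, ∃ c ≤ f i, ∀ j, 1 ≤ j → j ≤ f i → (j ≤ c ↔ T (i + 1, j) ≤ n) := by
    intro i
    refine ⟨Nat.findGreatest (fun j => j = 0 ∨ T (i + 1, j) ≤ n) (f i),
      Nat.findGreatest_le _, fun j hj hj' => ⟨fun h => ?_, fun h => ?_⟩⟩
    · have hle := Nat.findGreatest_le (P := fun j => j = 0 ∨ T (i + 1, j) ≤ n) (f i)
      rcases Nat.findGreatest_spec (P := fun j => j = 0 ∨ T (i + 1, j) ≤ n) (Nat.zero_le (f i))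
        (Or.inl rfl) with h0 | h0
      · omega
      · exact (hT.row_le hj h hle).trans h0
    · exact Nat.le_findGreatest hj' (Or.inr h)
  choose g hgf hg using hcut
  have hbox : ∀ p, RowBox g p → RowBox f p := fun p h => ⟨h.1, h.2.1, h.2.2.trans (hgf _)⟩
  have hle : ∀ p, RowBox f p → (RowBox g p ↔ T p ≤ n) := by
    rintro ⟨_ | i, j⟩ hp
    · exact absurd hp.1 (by simp)
    · have := hg i j hp.2.1 (by simpa using hp.2.2)
      rw [← this]
      exact ⟨fun h => by simpa using h.2.2, fun h => ⟨hp.1, hp.2.1, by simpa using h⟩⟩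
  refine ⟨g, fun p => if RowBox g p then T p else 0, hgf, fun i => ?_, fun i hi => ?_,
    ⟨fun p hp => ?_, fun p hp => if_neg hp, fun p q hp hq h1 h2 => ?_,
      fun p q hp hq h1 h2 => ?_⟩, ?_⟩
  · rcases Nat.eq_zero_or_pos (f (i + 1)) with h0 | h0
    · omega
    · have hfi : f (i + 1) ≤ f i := hf (by omega)
      rw [hg i _ h0 hfi]
      have hq : RowBox f (i + 1 + 1, f (i + 1)) := ⟨by simp, h0, by simp⟩
      have h1 := hT.2.2.2 (i + 1, f (i + 1)) _ ⟨by simp, h0, by simpa using hfi⟩ hq rfl rfl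
      have h2 := (hT.1 _ hq).2
      omega
  · by_contra h0
    have h1 := (hg i 1 le_rfl (by have := hgf i; omega)).1 (by omega)
    have h2 := hT.row_lt_entry hf (i := i) le_rfl (by have := hgf i; omega)
    omega
  · simp only [hp, if_true]
    exact ⟨(hT.1 p (hbox p hp)).1, (hle p (hbox p hp)).1 hp⟩
  · simpa [hp, hq] using hT.2.2.1 p q (hbox p hp) (hbox q hq) h1 h2
  · simpa [hp, hq] using hT.2.2.2 p q (hbox p hp) (hbox q hq) h1 h2
  · funext p
    unfold extendTableau
    split_ifs with h1 h2
    · exact if_pos h1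
    · have h3 := (hT.1 p h2).2
      have h4 := mt (hle p h2).2 h1
      omega
    · exact (hT.2.1 p h2).symm

/-- The row lengths encoded by `m : Fin n → ℕ`, which lists them from the last row to the
first. -/
def rowsOfFin (n : ℕ) (m : Fin n → ℕ) (r : ℕ) : ℕ :=
  if h : r < n then m ⟨n - 1 - r, by omega⟩ else 0

lemma rowsOfFin_apply (n : ℕ) (m : Fin n → ℕ) (i : Fin n) :
    rowsOfFin n m (n - 1 - i) = m i := by
  have := i.2
  rw [rowsOfFin, dif_pos (by omega)]
  congr 1
  ext
  simp only
  omega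

lemma rowsOfFin_interlace {n : ℕ} {f : ℕ → ℕ} (hf0 : ∀ i, n + 1 ≤ i → f i = 0) {m : Fin n → ℕ}
    (hm : m ∈ Fintype.piFinset fun i : Fin n => Finset.Icc (f (n - i)) (f (n - 1 - i))) (r : ℕ) :
    rowsOfFin n m r ≤ f r ∧ f (r + 1) ≤ rowsOfFin n m r := by
  unfold rowsOfFin
  split_ifs with h
  · have := Finset.mem_Icc.1 (Fintype.mem_piFinset.1 hm ⟨n - 1 - r, by omega⟩)
    simp only [show n - (n - 1 - r) = r + 1 by omega, show n - 1 - (n - 1 - r) = r by omega] at this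
    exact this.symm
  · exact ⟨Nat.zero_le _, (hf0 _ (by omega)).le⟩

/-- Removing the entries `n + 1` from a tableau is a bijection onto the tableaux with entries at
most `n` of all shapes interlacing with the given one. -/
lemma bijective_extendTableau {n : ℕ} {f : ℕ → ℕ} (hf : Antitone f)
    (hf0 : ∀ i, n + 1 ≤ i → f i = 0) :
    Function.Bijective (fun x : Σ m : {m : Fin n → ℕ // m ∈ Fintype.piFinset fun i : Fin n =>
        Finset.Icc (f (n - i)) (f (n - 1 - i))}, {T // IsSST (rowsOfFin n m.1) n T} =>
      (⟨extendTableau f (rowsOfFin n x.1.1) n x.2.1, x.2.2.extend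
        (fun i => (rowsOfFin_interlace hf0 x.1.2 i).1)
        (fun i => (rowsOfFin_interlace hf0 x.1.2 i).2)⟩ : {T // IsSST f (n + 1) T})) := by
  constructor
  · rintro ⟨⟨m, hm⟩, T, hT⟩ ⟨⟨m', hm'⟩, T', hT'⟩ h
    have hext : extendTableau f (rowsOfFin n m) n T = extendTableau f (rowsOfFin n m') n T' :=
      congrArg Subtype.val h
    have hbox : ∀ p, RowBox (rowsOfFin n m) p ↔ RowBox (rowsOfFin n m') p := by
      intro p
      by_cases hp : RowBox f p
      · rw [← extendTableau_le_iff hT hp, ← extendTableau_le_iff hT' hp, hext]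
      · exact ⟨fun h => absurd ⟨h.1, h.2.1, h.2.2.trans (rowsOfFin_interlace hf0 hm _).1⟩ hp,
          fun h => absurd ⟨h.1, h.2.1, h.2.2.trans (rowsOfFin_interlace hf0 hm' _).1⟩ hp⟩
    have hmm : m = m' := by
      funext i
      rw [← rowsOfFin_apply n m i, ← rowsOfFin_apply n m' i]
      generalize n - 1 - (i : ℕ) = r
      have hr : ∀ j, 1 ≤ j → (j ≤ rowsOfFin n m r ↔ j ≤ rowsOfFin n m' r) := by
        intro j hj
        simpa [RowBox, hj] using hbox (r + 1, j)
      apply le_antisymm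
      · by_contra hlt
        exact hlt ((hr _ (by omega)).1 le_rfl)
      · by_contra hlt
        exact hlt ((hr _ (by omega)).2 le_rfl)
    subst hmm
    have hTT : T = T' := by
      funext p
      by_cases hp : RowBox (rowsOfFin n m) p
      · simpa [extendTableau, hp] using congrFun hext p
      · rw [hT.2.1 p hp, hT'.2.1 p hp]
    subst hTT
    rfl
  · rintro ⟨T, hT⟩
    obtain ⟨g, T', hgf, hfg, hg0, hT', rfl⟩ := hT.exists_extend hf
    have hrows : rowsOfFin n (fun i => g (n - 1 - i)) = g := by
      funext r
      unfold rowsOfFin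
      split_ifs with h
      · simp only [show n - 1 - (n - 1 - r) = r by omega]
      · exact (hg0 r (by omega)).symm
    refine ⟨⟨⟨fun i => g (n - 1 - i), Fintype.mem_piFinset.2 fun i => Finset.mem_Icc.2
      ⟨?_, hgf _⟩⟩, T', hrows.symm ▸ hT'⟩, Subtype.ext ?_⟩
    · have := hfg (n - 1 - i)
      rwa [show n - 1 - (i : ℕ) + 1 = n - i by omega] at this
    · simp only [hrows]

/-- The Weyl dimension formula for semistandard Young tableaux, in determinantal form. -/
theorem card_isSST_eq_det (n : ℕ) (f : ℕ → ℕ) (hf : Antitone f) (hf0 : ∀ i, n ≤ i → f i = 0) :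
    Finite {T // IsSST f n T} ∧ (Nat.card {T // IsSST f n T} : ℤ) =
      (Matrix.of fun i j : Fin n => ((f (n - 1 - i) + i).choose j : ℤ)).det := by
  induction n generalizing f with
  | zero =>
    have hbox : ∀ p, ¬ RowBox f p := fun p hp => by
      have := hp.2.1.trans hp.2.2
      rw [hf0 _ (Nat.zero_le _)] at this
      omega
    have : Unique {T // IsSST f 0 T} :=
      { default := ⟨fun _ => 0, fun p hp => (hbox p hp).elim, fun _ _ => rfl,
          fun p _ hp => (hbox p hp).elim, fun p _ hp => (hbox p hp).elim⟩
        uniq := fun T => Subtype.ext (funext fun p => T.2.2.1 p (hbox p)) }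
    exact ⟨inferInstance, by simp⟩
  | succ n ih =>
    have hbij := bijective_extendTableau hf hf0
    have key : ∀ m : {m : Fin n → ℕ // m ∈ Fintype.piFinset fun i : Fin n =>
        Finset.Icc (f (n - i)) (f (n - 1 - i))},
        Finite {T // IsSST (rowsOfFin n m.1) n T} ∧
          (Nat.card {T // IsSST (rowsOfFin n m.1) n T} : ℤ) =
            (Matrix.of fun i j : Fin n => ((m.1 i + i).choose j : ℤ)).det := by
      intro m
      have := ih (rowsOfFin n m.1)
        (antitone_nat_of_succ_le fun i => (rowsOfFin_interlace hf0 m.2 (i + 1)).1.trans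
          (rowsOfFin_interlace hf0 m.2 i).2) (fun i hi => dif_neg (by omega))
      simpa only [rowsOfFin_apply] using this
    have hfin := fun m => (key m).1
    refine ⟨Finite.of_surjective _ hbij.2, ?_⟩
    rw [← Nat.card_congr (Equiv.ofBijective _ hbij), Nat.card_sigma, Nat.cast_sum,
      Finset.sum_congr rfl fun m _ => (key m).2, Nat.add_sub_cancel, ← sum_det_choose n f hf]
    exact Finset.sum_coe_sort (Fintype.piFinset fun i : Fin n =>
      Finset.Icc (f (n - i)) (f (n - 1 - i)))
      fun m => (Matrix.of fun i j : Fin n => ((m i + i).choose j : ℤ)).det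

lemma stairBox_iff_rowBox (k : ℕ) (p : ℕ × ℕ) :
    StairBox k p ↔ RowBox (fun i => k - 1 - i) p := by
  simp only [StairBox, RowBox]
  omega

lemma prod_factorial_mul_SSTcard (k n : ℕ) (hkn : k ≤ n + 1) :
    (∏ j ∈ Finset.range n, (j.factorial : ℤ)) * SSTcard k n =
      diffProd n fun i => ((k - 1 - (n - 1 - i) + i : ℕ) : ℤ) := by
  have h := (card_isSST_eq_det n (fun i => k - 1 - i) (fun a b h => by simp only; omega)
    (fun i hi => by omega)).2
  rw [← prod_factorial_mul_det_choose, ← h]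
  simp only [SSTcard, IsSSTStair, IsSST, stairBox_iff_rowBox]

lemma diffProd_congr {n : ℕ} {l l' : ℕ → ℤ} (h : ∀ i < n, l i = l' i) :
    diffProd n l = diffProd n l' :=
  Finset.prod_congr rfl fun j hj => Finset.prod_congr rfl fun i hi => by
    rw [Finset.mem_range] at hi hj
    rw [h i (by omega), h j hj]

lemma diffProd_add (b k : ℕ) (l : ℕ → ℤ) :
    diffProd (b + k) l = diffProd b l *
      (∏ t ∈ Finset.range k, ∏ i ∈ Finset.range b, (l (b + t) - l i)) *
        diffProd k fun t => l (b + t) := by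
  simp only [diffProd, Finset.prod_range_add, Finset.prod_mul_distrib, mul_assoc]

lemma mul_prod_range_succ_sub (c : ℤ) (b : ℕ) :
    (c + 1 - b) * ∏ i ∈ Finset.range b, (c + 1 - i) =
      (c + 1) * ∏ i ∈ Finset.range b, (c - i) := by
  induction b with
  | zero => simp
  | succ b ih =>
    rw [Finset.prod_range_succ, Finset.prod_range_succ]
    push_cast
    linear_combination (c - b) * ih

lemma two_pow_mul_factorial_mul_prod_odd (k : ℕ) :
    2 ^ k * k.factorial * ∏ t ∈ Finset.range k, (2 * t + 1) = (2 * k).factorial := by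
  induction k with
  | zero => simp
  | succ k ih =>
    rw [Finset.prod_range_succ, show 2 * (k + 1) = 2 * k + 1 + 1 by ring,
      Nat.factorial_succ (2 * k + 1), Nat.factorial_succ (2 * k), Nat.factorial_succ k, ← ih]
    ring

lemma prod_odd_mul_SSTcard_succ (b k : ℕ) :
    (∏ t ∈ Finset.range k, (2 * t + 1)) * SSTcard (k + 1) (b + k) =
      (∏ t ∈ Finset.range k, (b + 1 + 2 * t)) * SSTcard k (b + k) := by
  have h1 := prod_factorial_mul_SSTcard (k + 1) (b + k) (by omega)
  have h2 := prod_factorial_mul_SSTcard k (b + k) (by omega)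
  have hpos : (∏ j ∈ Finset.range (b + k), (j.factorial : ℤ)) ≠ 0 :=
    Finset.prod_ne_zero_iff.2 fun j _ => by exact_mod_cast j.factorial_ne_zero
  have low1 : ∀ i < b, ((k + 1 - 1 - (b + k - 1 - i) + i : ℕ) : ℤ) = i := fun i hi => by
    congr 1; omega
  have low2 : ∀ i < b, ((k - 1 - (b + k - 1 - i) + i : ℕ) : ℤ) = i := fun i hi => by
    congr 1; omega
  have high1 : ∀ t < k, ((k + 1 - 1 - (b + k - 1 - (b + t)) + (b + t) : ℕ) : ℤ) =
      (b + 2 * t : ℤ) + 1 := fun t ht => by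
    rw [show k + 1 - 1 - (b + k - 1 - (b + t)) + (b + t) = b + 2 * t + 1 by omega]
    push_cast; ring
  have high2 : ∀ t < k, ((k - 1 - (b + k - 1 - (b + t)) + (b + t) : ℕ) : ℤ) =
      (b + 2 * t : ℤ) := fun t ht => by
    rw [show k - 1 - (b + k - 1 - (b + t)) + (b + t) = b + 2 * t by omega]
    push_cast; ring
  have mixed {l : ℕ → ℤ} {u : ℕ → ℤ} (hl : ∀ i < b, l i = i) (hu : ∀ t < k, l (b + t) = u t) :
      ∏ t ∈ Finset.range k, ∏ i ∈ Finset.range b, (l (b + t) - l i) =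
        ∏ t ∈ Finset.range k, ∏ i ∈ Finset.range b, (u t - i) :=
    Finset.prod_congr rfl fun t ht => Finset.prod_congr rfl fun i hi => by
      rw [hl i (Finset.mem_range.1 hi), hu t (Finset.mem_range.1 ht)]
  rw [diffProd_add, diffProd_congr low1, diffProd_congr high1, mixed low1 high1] at h1
  rw [diffProd_add, diffProd_congr low2, diffProd_congr high2, mixed low2 high2] at h2
  have hshift : diffProd k (fun t => (b + 2 * t : ℤ) + 1) = diffProd k fun t => (b + 2 * t : ℤ) := by
    simp only [diffProd, add_sub_add_right_eq_sub]
  have hcross : (∏ t ∈ Finset.range k, (2 * t + 1 : ℤ)) *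
      (∏ t ∈ Finset.range k, ∏ i ∈ Finset.range b, ((b + 2 * t : ℤ) + 1 - i)) =
      (∏ t ∈ Finset.range k, (b + 1 + 2 * t : ℤ)) *
        ∏ t ∈ Finset.range k, ∏ i ∈ Finset.range b, ((b + 2 * t : ℤ) - i) := by
    rw [← Finset.prod_mul_distrib, ← Finset.prod_mul_distrib]
    refine Finset.prod_congr rfl fun t _ => ?_
    linear_combination mul_prod_range_succ_sub (b + 2 * t : ℤ) b
  rw [hshift] at h1
  zify
  apply mul_left_cancel₀ hpos
  linear_combination (∏ t ∈ Finset.range k, (2 * t + 1 : ℤ)) * h1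
    - (∏ t ∈ Finset.range k, (b + 1 + 2 * t : ℤ)) * h2
    + (diffProd b fun i => (i : ℤ)) * (diffProd k fun t => (b + 2 * t : ℤ)) * hcross

/-- For `1 ≤ k ≤ n`:
`(2k)! · |SST(δ_{k+1}, n)| = 2^k · k! · (∏_{j=0}^{k-1} (n - k + 1 + 2j)) · |SST(δ_k, n)|`. -/
theorem sst_staircase_integer_recurrence (k n : ℕ) (hk : 1 ≤ k) (hkn : k ≤ n) :
    Nat.factorial (2 * k) * SSTcard (k + 1) n
      = 2 ^ k * Nat.factorial k * (∏ j ∈ Finset.range k, (n - k + 1 + 2 * j)) *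
          SSTcard k n := by
  obtain ⟨b, rfl⟩ := Nat.exists_eq_add_of_le' hkn
  rw [Nat.add_sub_cancel, ← two_pow_mul_factorial_mul_prod_odd, mul_assoc,
    prod_odd_mul_SSTcard_succ]
  ring
end

section
/- Let k and n be positive integers with n ≥ k. Then for every β ∈ ℚ (equivalently, as an identity of polynomials in β), the specialized K-theoretic Schur P-functions of adjacent shifted staircase shapes satisfy the recurrence (2k)! · GP_{δ̃_{k+1}}(1,…,1 | β) · F^{(n)}_{δ_k}(−β) = 2^k · k! · (∏_{j=0}^{k−1} (n − k + 1 + 2j)) · GP_{δ̃_k}(1,…,1 | β) · F^{(n)}_{δ_{k+1}}(−β); here the scalar ratio 2^k k! (∏_{j=0}^{k−1} (n−k+1+2j)) / (2k)! equals (2^{2k}(k!)²/(2k)!) · P_k^{(α,β′)}(−1) with Jacobi parameters α = (n−k−1)/2 and β′ = (−n−k−1)/2. -/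
/-- `(i,j)` (0-indexed) is a box of the shifted Young diagram of the shifted staircase
`δ̃_k = (k-1, k-2, …, 1)`: the 1-indexed boxes are `{(i,j) : 1 ≤ i ≤ j ≤ k-1}`. -/
def ShiftedStairBox (k : ℕ) (p : Fin k × Fin k) : Prop :=
  p.1.val ≤ p.2.val ∧ p.2.val + 2 ≤ k

/-- `T` is a shifted set-valued semistandard tableau of shifted staircase shape `δ̃_k` with
entries in the ordered alphabet `1' < 1 < 2' < 2 < ⋯ < n' < n`, encoded as `Fin (2*n)`
where the value `2s` encodes `(s+1)'` (primed) and `2s+1` encodes `s+1` (unprimed):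
each box carries a nonempty set, non-boxes carry `∅`, rows and columns are weakly
increasing (`max ≤ min`), each unprimed letter appears at most once in each column,
each primed letter appears at most once in each row, and diagonal boxes contain only
unprimed letters. -/
def IsSSVTPStair (k n : ℕ) (T : Fin k × Fin k → Finset (Fin (2 * n))) : Prop :=
  (∀ p, ShiftedStairBox k p → (T p).Nonempty) ∧
  (∀ p, ¬ ShiftedStairBox k p → T p = ∅) ∧
  (∀ p q : Fin k × Fin k, q.1 = p.1 → (q.2 : ℕ) = (p.2 : ℕ) + 1 →
    ∀ a ∈ T p, ∀ b ∈ T q, a ≤ b) ∧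
  (∀ p q : Fin k × Fin k, (q.1 : ℕ) = (p.1 : ℕ) + 1 → q.2 = p.2 →
    ∀ a ∈ T p, ∀ b ∈ T q, a ≤ b) ∧
  (∀ p q : Fin k × Fin k, p.2 = q.2 → p.1 ≠ q.1 →
    ∀ a ∈ T p, a.val % 2 = 1 → a ∉ T q) ∧
  (∀ p q : Fin k × Fin k, p.1 = q.1 → p.2 ≠ q.2 →
    ∀ a ∈ T p, a.val % 2 = 0 → a ∉ T q) ∧
  (∀ p : Fin k × Fin k, p.1 = p.2 → ∀ a ∈ T p, a.val % 2 = 1)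

/-- The specialization `GP_{δ̃_k}(1,…,1 | β) = Σ_{T ∈ SSVT_P(δ̃_k, n)} β^{|T| - |δ̃_k|}` of
the K-theoretic Schur P-function, where `|δ̃_k| = k(k-1)/2`. -/
noncomputable def GPspecStair (k n : ℕ) (b : ℚ) : ℚ :=
  ∑ᶠ T : {T : Fin k × Fin k → Finset (Fin (2 * n)) // IsSSVTPStair k n T},
    b ^ ((∑ p : Fin k × Fin k, (T.1 p).card) - k * (k - 1) / 2)

/-- The terminating Holman hypergeometric value `F^{(n)}_λ(z)`. -/
noncomputable def holmanF (n : ℕ) (lam : ℕ → ℕ) (z : ℚ) : ℚ :=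
  ∑ κ : (i : Fin n) → Fin (i.val + 1),
    (∏ p ∈ Finset.univ.filter (fun p : Fin n × Fin n => p.1 < p.2),
        (((lam (p.1.val + 1) : ℚ) - (lam (p.2.val + 1) : ℚ) + (p.2.val : ℚ) - (p.1.val : ℚ)
            + ((κ p.1).val : ℚ) - ((κ p.2).val : ℚ)) /
          ((lam (p.1.val + 1) : ℚ) - (lam (p.2.val + 1) : ℚ) + (p.2.val : ℚ) - (p.1.val : ℚ)))) *
      (∏ i : Fin n, (Nat.choose i.val (κ i).val : ℚ)) *
      (-z) ^ (∑ i : Fin n, (κ i).val)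

/-- Generalized binomial coefficient `binom(x, m) = x(x-1)⋯(x-m+1)/m!`. -/
def genBinom (x : ℚ) (m : ℕ) : ℚ := (∏ i ∈ Finset.range m, (x - i)) / (Nat.factorial m)

/-- The Jacobi polynomial. -/
def jacobiP (k : ℕ) (a b z : ℚ) : ℚ :=
  ∑ r ∈ Finset.range (k + 1),
    genBinom ((k : ℚ) + a) (k - r) * genBinom ((k : ℚ) + b) r *
      ((z - 1) / 2) ^ r * ((z + 1) / 2) ^ (k - r)

namespace ShiftedStair

/-- States are strict partitions `μ`, encoded by the set of all `μ_i - 1`. The shape of `S` has a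
removable box of content `c` iff `Corner c S`. -/
def Corner : ℕ → Finset ℕ → Prop
  | 0, S => 0 ∈ S
  | c + 1, S => c + 1 ∈ S ∧ c ∉ S

instance (c : ℕ) (S : Finset ℕ) : Decidable (Corner c S) := by
  cases c <;> unfold Corner <;> infer_instance

/-- Remove the removable box of content `c`. -/
def rem : ℕ → Finset ℕ → Finset ℕ
  | 0, S => S.erase 0
  | c + 1, S => insert c (S.erase (c + 1))

/-- The K-theoretic Schur operator of content `c`, acting on functions on strict partitions. -/
def u (b : ℚ) (c : ℕ) : Module.End ℚ (Finset ℕ → ℚ) where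
  toFun φ S := if Corner c S then b * φ S + φ (rem c S) else 0
  map_add' φ ψ := by
    ext S
    simp only [Pi.add_apply]
    split_ifs <;> ring
  map_smul' r φ := by
    ext S
    simp only [Pi.smul_apply, smul_eq_mul, RingHom.id_apply]
    split_ifs <;> ring

theorem u_apply (b : ℚ) (c : ℕ) (φ : Finset ℕ → ℚ) (S : Finset ℕ) :
    u b c φ S = if Corner c S then b * φ S + φ (rem c S) else 0 := rfl

theorem u_of_not_corner {b : ℚ} {c : ℕ} {S : Finset ℕ} (h : ¬ Corner c S) (φ : Finset ℕ → ℚ) :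
    u b c φ S = 0 := if_neg h

theorem u_of_corner {b : ℚ} {c : ℕ} {S : Finset ℕ} (h : Corner c S) (φ : Finset ℕ → ℚ) :
    u b c φ S = b * φ S + φ (rem c S) := if_pos h

theorem not_corner_rem (c : ℕ) (S : Finset ℕ) : ¬ Corner c (rem c S) := by
  cases c <;> simp [Corner, rem]

theorem u_mul_self (b : ℚ) (c : ℕ) : u b c * u b c = b • u b c := by
  ext φ S
  simp only [Module.End.mul_apply, LinearMap.smul_apply, Pi.smul_apply, smul_eq_mul]
  by_cases h : Corner c S
  · rw [u_of_corner h (u b c φ), u_of_not_corner (not_corner_rem c S), add_zero]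
  · rw [u_of_not_corner h, u_of_not_corner h, mul_zero]

theorem corner_rem_iff {c d : ℕ} (h : c + 2 ≤ d) (S : Finset ℕ) :
    (Corner d (rem c S) ↔ Corner d S) ∧ (Corner c (rem d S) ↔ Corner c S) := by
  obtain ⟨d, rfl⟩ : ∃ e, d = e + 1 := ⟨d - 1, by omega⟩
  cases c <;> simp [Corner, rem] <;> grind

theorem rem_comm {c d : ℕ} (h : c + 2 ≤ d) (S : Finset ℕ) :
    rem c (rem d S) = rem d (rem c S) := by
  obtain ⟨d, rfl⟩ : ∃ e, d = e + 1 := ⟨d - 1, by omega⟩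
  cases c <;> ext p <;> simp [rem] <;> grind

theorem u_comm (b : ℚ) {c d : ℕ} (h : c + 2 ≤ d) : u b c * u b d = u b d * u b c := by
  ext φ S
  simp only [Module.End.mul_apply, u_apply, corner_rem_iff h, rem_comm h]
  split_ifs <;> ring

theorem u_mul_mul_eq_zero (b : ℚ) (c : ℕ) :
    u b (c + 1) * u b (c + 2) * u b (c + 1) = 0 := by
  ext φ S
  simp only [Module.End.mul_apply, u_apply, LinearMap.zero_apply, Pi.zero_apply]
  simp only [Corner, rem]; split_ifs <;> grind

theorem u_succ_mul_mul_eq_zero (b : ℚ) (c : ℕ) :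
    u b (c + 2) * u b (c + 1) * u b (c + 2) = 0 := by
  ext φ S
  simp only [Module.End.mul_apply, u_apply, LinearMap.zero_apply, Pi.zero_apply]
  simp only [Corner, rem]; split_ifs <;> grind

theorem u_zero_one (b : ℚ) : u b 0 * u b 1 * u b 0 * u b 1 = 0 := by
  ext φ S
  simp only [Module.End.mul_apply, u_apply, LinearMap.zero_apply, Pi.zero_apply]
  simp only [Corner, rem]; split_ifs <;> grind

theorem u_one_zero (b : ℚ) : u b 1 * u b 0 * u b 1 * u b 0 = 0 := by
  ext φ S
  simp only [Module.End.mul_apply, u_apply, LinearMap.zero_apply, Pi.zero_apply]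
  simp only [Corner, rem]; split_ifs <;> grind

/-- The operator `1 + x u_c`. -/
def h (b : ℚ) (c : ℕ) (x : ℚ) : Module.End ℚ (Finset ℕ → ℚ) := 1 + x • u b c

theorem h_apply (b : ℚ) (c : ℕ) (x : ℚ) (φ : Finset ℕ → ℚ) (S : Finset ℕ) :
    h b c x φ S = φ S + x * u b c φ S := rfl

theorem h_of_not_corner {b : ℚ} {c : ℕ} {S : Finset ℕ} (hS : ¬ Corner c S) (x : ℚ)
    (φ : Finset ℕ → ℚ) : h b c x φ S = φ S := by
  rw [h_apply, u_of_not_corner hS, mul_zero, add_zero]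

theorem h_of_corner {b : ℚ} {c : ℕ} {S : Finset ℕ} (hS : Corner c S) (x : ℚ)
    (φ : Finset ℕ → ℚ) : h b c x φ S = (1 + x * b) * φ S + x * φ (rem c S) := by
  rw [h_apply, u_of_corner hS]; ring

theorem h_mul_h {b : ℚ} (c : ℕ) {x y z : ℚ} (hz : z = x + y + b * x * y) :
    h b c x * h b c y = h b c z := by
  simp only [h, mul_add, add_mul, one_mul, mul_one, smul_mul_assoc, mul_smul_comm, u_mul_self, hz]
  module

theorem h_comm_self (b : ℚ) (c : ℕ) (x y : ℚ) : h b c x * h b c y = h b c y * h b c x := by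
  rw [h_mul_h c rfl, h_mul_h c rfl]
  congr 1; ring

theorem h_zero (b : ℚ) (c : ℕ) : h b c 0 = 1 := by simp [h]

theorem h_comm (b : ℚ) {c d : ℕ} (hcd : c + 2 ≤ d) (x y : ℚ) :
    h b c x * h b d y = h b d y * h b c x := by
  simp only [h, mul_add, add_mul, one_mul, mul_one, smul_mul_assoc, mul_smul_comm, u_comm b hcd]
  module

theorem yang_baxter {b : ℚ} (c : ℕ) {x y z : ℚ} (hz : z = x + y + b * x * y) :
    h b (c + 1) x * h b (c + 2) z * h b (c + 1) y
      = h b (c + 2) y * h b (c + 1) z * h b (c + 2) x := by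
  simp only [h, mul_add, add_mul, one_mul, mul_one, smul_mul_assoc, mul_smul_comm, u_mul_self,
    u_mul_mul_eq_zero, u_succ_mul_mul_eq_zero, hz]
  module

theorem yang_baxter_boundary {b : ℚ} {x y z d : ℚ} (hz : z = x + y + b * x * y)
    (hd : x = d + y + b * d * y) :
    h b 1 d * h b 0 x * h b 1 z * h b 0 y = h b 0 y * h b 1 z * h b 0 x * h b 1 d := by
  have h00 : ∀ v, v * u b 0 * u b 0 = b • (v * u b 0) := fun v => by
    rw [mul_assoc, u_mul_self, mul_smul_comm]
  have h11 : ∀ v, v * u b 1 * u b 1 = b • (v * u b 1) := fun v => by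
    rw [mul_assoc, u_mul_self, mul_smul_comm]
  simp only [h, mul_add, add_mul, one_mul, mul_one, smul_mul_assoc, mul_smul_comm, u_mul_self,
    h00, h11, u_zero_one, u_one_zero, smul_zero, hz, hd]
  module

/-- The transfer operator adding a pair of letters `i', i`, restricted to contents below `m`. -/
def B (b x : ℚ) : ℕ → Module.End ℚ (Finset ℕ → ℚ)
  | 0 => 1
  | 1 => h b 0 x
  | m + 2 => h b (m + 1) x * B b x (m + 1) * h b (m + 1) x

theorem h_comm_B (b x y : ℚ) {m d : ℕ} (hd : m + 1 ≤ d) :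
    h b d y * B b x m = B b x m * h b d y := by
  induction m using Nat.twoStepInduction with
  | zero => simp [B]
  | one => exact (h_comm b (by omega) x y).symm
  | more m _ ih =>
    have e := h_comm b (c := m + 1) (d := d) (by omega) x y
    rw [B, ← mul_assoc, ← mul_assoc, ← e, mul_assoc _ (h b d y), ih (by omega), mul_assoc,
      mul_assoc,
      mul_assoc, mul_assoc, e]

theorem reflection {b : ℚ} (m : ℕ) {x y z d : ℚ} (hz : z = x + y + b * x * y)
    (hd : x = d + y + b * d * y) :
    h b (m + 1) d * B b x (m + 1) * h b (m + 1) z * B b y (m + 1)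
      = B b y (m + 1) * h b (m + 1) z * B b x (m + 1) * h b (m + 1) d := by
  induction m with
  | zero => exact yang_baxter_boundary hz hd
  | succ m ih =>
    have hz' : z = y + x + b * y * x := by rw [hz]; ring
    have hd' : x = y + d + b * y * d := by rw [hd]; ring
    have e1 := yang_baxter m hz
    have e2 := yang_baxter m hd
    have e3 := yang_baxter m hz'
    have e4 := yang_baxter m hd'
    have cx : ∀ w, h b (m + 2) w * B b x (m + 1) = B b x (m + 1) * h b (m + 2) w :=
      fun w => h_comm_B b x w (by omega)
    have cy : ∀ w, h b (m + 2) w * B b y (m + 1) = B b y (m + 1) * h b (m + 2) w :=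
      fun w => h_comm_B b y w (by omega)
    simp only [B]
    generalize B b x (m + 1) = X at *
    generalize B b y (m + 1) = Y at *
    calc h b (m + 2) d * (h b (m + 1) x * X * h b (m + 1) x) * h b (m + 2) z
          * (h b (m + 1) y * Y * h b (m + 1) y)
        = h b (m + 2) d * h b (m + 1) x * X * (h b (m + 1) x * h b (m + 2) z * h b (m + 1) y)
          * Y * h b (m + 1) y := by simp only [mul_assoc]
      _ = h b (m + 2) d * h b (m + 1) x * (X * h b (m + 2) y) * h b (m + 1) z
          * (h b (m + 2) x * Y) * h b (m + 1) y := by rw [e1]; simp only [mul_assoc]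
      _ = (h b (m + 2) d * h b (m + 1) x * h b (m + 2) y) * X * h b (m + 1) z
          * Y * h b (m + 2) x * h b (m + 1) y := by rw [← cx, cy]; simp only [mul_assoc]
      _ = h b (m + 1) y * h b (m + 2) x * (h b (m + 1) d * X * h b (m + 1) z
          * Y) * h b (m + 2) x * h b (m + 1) y := by rw [← e4]; simp only [mul_assoc]
      _ = h b (m + 1) y * (h b (m + 2) x * Y) * h b (m + 1) z * X *
          (h b (m + 1) d * h b (m + 2) x * h b (m + 1) y) := by rw [ih]; simp only [mul_assoc]
      _ = h b (m + 1) y * Y * h b (m + 2) x * h b (m + 1) z * (X *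
          h b (m + 2) y) * h b (m + 1) x * h b (m + 2) d := by
          rw [e2, cy]; simp only [mul_assoc]
      _ = h b (m + 1) y * Y * (h b (m + 2) x * h b (m + 1) z * h b (m + 2) y) * X
          * h b (m + 1) x * h b (m + 2) d := by rw [← cx]; simp only [mul_assoc]
      _ = _ := by rw [← e3]; simp only [mul_assoc]

theorem B_comm {b x y : ℚ} (hy : 1 + b * y ≠ 0) (m : ℕ) :
    B b x m * B b y m = B b y m * B b x m := by
  match m with
  | 0 => rfl
  | 1 => exact h_comm_self b 0 x y
  | m + 2 =>
    obtain ⟨d, hd⟩ : ∃ d, x = d + y + b * d * y := ⟨(x - y) / (1 + b * y), by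
      linear_combination -div_mul_cancel₀ (x - y) hy⟩
    have hd' : x = y + d + b * y * d := by rw [hd]; ring
    have r := reflection m (b := b) rfl hd
    have c := h_mul_h (m + 1) hd'
    have c' := h_mul_h (m + 1) hd
    have c2 := h_mul_h (b := b) (m + 1) (x := x) (y := y) rfl
    simp only [B]
    generalize B b x (m + 1) = X at *
    generalize B b y (m + 1) = Y at *
    calc h b (m + 1) x * X * h b (m + 1) x * (h b (m + 1) y * Y * h b (m + 1) y)
        = h b (m + 1) x * X * (h b (m + 1) x * h b (m + 1) y) * Y * h b (m + 1) y := by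
          simp only [mul_assoc]
      _ = h b (m + 1) y * (h b (m + 1) d * X * h b (m + 1) (x + y + b * x * y) * Y)
          * h b (m + 1) y := by rw [c2, ← c]; simp only [mul_assoc]
      _ = h b (m + 1) y * Y * h b (m + 1) (x + y + b * x * y) * X
          * (h b (m + 1) d * h b (m + 1) y) := by rw [r]; simp only [mul_assoc]
      _ = _ := by rw [c', ← c2, h_comm_self]; simp only [mul_assoc]

theorem B_mul_B {b x y : ℚ} (hxy : x + y + b * x * y = 0) (m : ℕ) : B b x m * B b y m = 1 := by
  induction m using Nat.twoStepInduction with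
  | zero => rfl
  | one => rw [B, B, h_mul_h 0 hxy.symm, h_zero]
  | more m _ ih =>
    have c := h_mul_h (m + 1) hxy.symm
    rw [h_zero] at c
    simp only [B]
    calc _ = h b (m + 1) x * B b x (m + 1) * (h b (m + 1) x * h b (m + 1) y) * B b y (m + 1)
          * h b (m + 1) y := by simp only [mul_assoc]
      _ = h b (m + 1) x * (B b x (m + 1) * B b y (m + 1)) * h b (m + 1) y := by
          rw [c]; simp only [mul_assoc, one_mul]
      _ = 1 := by rw [ih, mul_one, c]

theorem B_zero (b : ℚ) (m : ℕ) : B b 0 m = 1 := by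
  induction m using Nat.twoStepInduction with
  | zero => rfl
  | one => exact h_zero b 0
  | more m _ ih => rw [B, h_zero, ih, mul_one, mul_one]

theorem rem_subset {c N : ℕ} {S : Finset ℕ} (hS : S ⊆ Finset.range N) (hc : Corner c S) :
    rem c S ⊆ Finset.range N := by
  intro p hp
  cases c <;> simp only [rem, Corner, Finset.subset_iff, Finset.mem_range, Finset.mem_insert,
    Finset.mem_erase] at * <;> grind

theorem h_congr {b x : ℚ} {c N : ℕ} {φ ψ : Finset ℕ → ℚ}
    (hφ : ∀ S ⊆ Finset.range N, φ S = ψ S) :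
    ∀ S ⊆ Finset.range N, h b c x φ S = h b c x ψ S := by
  intro S hS
  by_cases hc : Corner c S
  · rw [h_of_corner hc, h_of_corner hc, hφ S hS, hφ _ (rem_subset hS hc)]
  · rw [h_of_not_corner hc, h_of_not_corner hc, hφ S hS]

theorem B_congr {b x : ℚ} {N : ℕ} (m : ℕ) {φ ψ : Finset ℕ → ℚ}
    (hφ : ∀ S ⊆ Finset.range N, φ S = ψ S) :
    ∀ S ⊆ Finset.range N, B b x m φ S = B b x m ψ S := by
  induction m using Nat.twoStepInduction generalizing φ ψ with
  | zero => exact hφ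
  | one => exact h_congr hφ
  | more m _ ih => exact h_congr (ih (h_congr hφ))

theorem not_corner_of_subset {m : ℕ} {S : Finset ℕ} (hS : S ⊆ Finset.range m) : ¬ Corner m S := by
  have : m ∉ S := fun hm => by simpa using hS hm
  cases m <;> simp [Corner, this]

theorem B_succ_apply {b x : ℚ} {m : ℕ} (φ : Finset ℕ → ℚ) {S : Finset ℕ}
    (hS : S ⊆ Finset.range m) : B b x (m + 1) φ S = B b x m φ S := by
  cases m with
  | zero => exact h_of_not_corner (not_corner_of_subset hS) x φ
  | succ m =>
    rw [B, Module.End.mul_apply, Module.End.mul_apply, h_of_not_corner (not_corner_of_subset hS)]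
    exact B_congr (m + 1)
      (fun T hT => h_of_not_corner (not_corner_of_subset hT) x φ) S hS

/-- The product `h_0 h_1 ⋯ h_{m-1}`. -/
def asc (b x : ℚ) : ℕ → Module.End ℚ (Finset ℕ → ℚ)
  | 0 => 1
  | m + 1 => asc b x m * h b m x

theorem B_apply_eq_asc {b x : ℚ} (m : ℕ) (φ : Finset ℕ → ℚ) {S : Finset ℕ}
    (hS : Finset.range m ⊆ S) : B b x m φ S = asc b x m φ S := by
  induction m using Nat.twoStepInduction generalizing φ with
  | zero => rfl
  | one => rfl
  | more m _ ih =>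
    have hc : ¬ Corner (m + 1) S := fun hc => hc.2 (hS (by simp))
    rw [B, Module.End.mul_apply, Module.End.mul_apply, h_of_not_corner hc,
      ih _ ((Finset.range_mono (by omega)).trans hS)]
    rfl

theorem asc_apply_of_eq {b x : ℚ} (hx : 1 + x * b = 0) (m : ℕ) (φ : Finset ℕ → ℚ)
    {S : Finset ℕ} (hS : Finset.range (m + 1) ⊆ S) :
    asc b x (m + 1) φ S = x ^ (m + 1) * φ (S.erase m) := by
  induction m generalizing φ with
  | zero =>
    have hc : Corner 0 S := hS (by simp)
    change h b 0 x φ S = _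
    rw [h_of_corner hc, hx]
    simp [rem]
  | succ m ih =>
    have hm : m ∈ S := hS (by simp)
    have hm' : m + 1 ∈ S := hS (by simp)
    have hc : Corner (m + 1) (S.erase m) := by simp [Corner, hm']
    have hr : rem (m + 1) (S.erase m) = S.erase (m + 1) := by
      ext p; simp only [rem, Finset.mem_insert, Finset.mem_erase]; grind
    rw [asc, Module.End.mul_apply, ih _ ((Finset.range_mono (by omega)).trans hS),
      h_of_corner hc, hx, hr]
    ring

/-- The generating function of the empty tableau. -/
def vac (S : Finset ℕ) : ℚ := if S = ∅ then 1 else 0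

/-- The generating functions of all shapes in the variables `xs`. -/
def vec (b : ℚ) (m : ℕ) (xs : List ℚ) : Finset ℕ → ℚ := (xs.map fun x => B b x m).prod vac

theorem vec_cons (b : ℚ) (m : ℕ) (x : ℚ) (xs : List ℚ) :
    vec b m (x :: xs) = B b x m (vec b m xs) := by
  simp [vec]

/-- The K-theoretic Schur P-function of the shifted staircase `(m, m-1, …, 1)`. -/
def stair (b : ℚ) (m : ℕ) (xs : List ℚ) : ℚ := vec b m xs (Finset.range m)

theorem vec_succ_apply (b : ℚ) (m : ℕ) (xs : List ℚ) :
    ∀ S ⊆ Finset.range m, vec b (m + 1) xs S = vec b m xs S := by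
  induction xs with
  | nil => intro S _; rfl
  | cons x xs ih =>
    intro S hS
    rw [vec_cons, vec_cons, B_succ_apply _ hS]
    exact B_congr m ih S hS

theorem stair_zero_cons (b : ℚ) (m : ℕ) (xs : List ℚ) : stair b m (0 :: xs) = stair b m xs := by
  rw [stair, vec_cons, B_zero]; rfl

theorem stair_cons_of_eq {b x : ℚ} (hx : 1 + x * b = 0) (m : ℕ) (xs : List ℚ) :
    stair b m (x :: xs) = x ^ m * stair b (m - 1) xs := by
  cases m with
  | zero => rw [stair, vec_cons]; simp [B, stair]
  | succ m =>
    rw [stair, vec_cons, B_apply_eq_asc _ _ subset_rfl, asc_apply_of_eq hx _ _ subset_rfl,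
      Finset.range_add_one, Finset.erase_insert (by simp), vec_succ_apply _ _ _ _ subset_rfl]
    rfl

theorem stair_cons_cons {b x y : ℚ} (hxy : x + y + b * x * y = 0) (m : ℕ) (xs : List ℚ) :
    stair b m (x :: y :: xs) = stair b m xs := by
  rw [stair, vec_cons, vec_cons, ← Module.End.mul_apply, B_mul_B hxy]; rfl

theorem stair_perm {b : ℚ} (m : ℕ) {xs ys : List ℚ} (hp : xs.Perm ys)
    (hxs : ∀ x ∈ xs, 1 + b * x ≠ 0) : stair b m xs = stair b m ys := by
  rw [stair, stair, vec, vec, (hp.map _).prod_eq']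
  rw [List.pairwise_map]
  exact List.pairwise_of_forall_mem_list fun x _ y hy => B_comm (hxs y hy) m

theorem card_rem {c : ℕ} {S : Finset ℕ} (hc : Corner c S) :
    (rem c S).card = if c = 0 then S.card - 1 else S.card := by
  cases c with
  | zero => simp [rem, Finset.card_erase_of_mem (show 0 ∈ S from hc)]
  | succ c =>
    have := Finset.card_pos.2 ⟨_, hc.1⟩
    simp only [rem, Nat.add_eq_zero_iff, one_ne_zero, and_false, if_false]
    rw [Finset.card_insert_of_notMem (by simp [hc.2]), Finset.card_erase_of_mem hc.1]
    omega

theorem h_vanish {b x : ℚ} {c r : ℕ} {φ : Finset ℕ → ℚ} (hφ : ∀ S, r < S.card → φ S = 0) :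
    ∀ S, (if c = 0 then r + 1 else r) < S.card → h b c x φ S = 0 := by
  intro S hS
  have hr : r < S.card := by split_ifs at hS <;> omega
  by_cases hc : Corner c S
  · rw [h_of_corner hc, hφ S hr, hφ _ (by rw [card_rem hc]; split_ifs at * <;> omega)]
    ring
  · rw [h_of_not_corner hc, hφ S hr]

theorem B_vanish {b x : ℚ} {r : ℕ} (m : ℕ) {φ : Finset ℕ → ℚ} (hφ : ∀ S, r < S.card → φ S = 0) :
    ∀ S, r + 1 < S.card → B b x m φ S = 0 := by
  induction m using Nat.twoStepInduction generalizing φ with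
  | zero => exact fun S hS => hφ S (by omega)
  | one => exact h_vanish (c := 0) hφ
  | more m _ ih =>
    exact h_vanish (c := m + 1) (ih (h_vanish (c := m + 1) hφ))

theorem stair_eq_zero (b : ℚ) {m : ℕ} {xs : List ℚ} (hm : xs.length < m) : stair b m xs = 0 := by
  have key : ∀ xs : List ℚ, ∀ S : Finset ℕ, xs.length < S.card → vec b m xs S = 0 := by
    intro xs
    induction xs with
    | nil =>
      intro S hS
      exact if_neg (Finset.card_pos.1 hS).ne_empty
    | cons x xs ih =>
      intro S hS
      rw [vec_cons]
      exact B_vanish m ih S hS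
  exact key xs _ (by simpa using hm)

/-- `F` is a polynomial function of degree at most `d`. -/
def PolyDeg (d : ℕ) (F : ℚ → ℚ) : Prop := ∃ P : Polynomial ℚ, P.natDegree ≤ d ∧ ∀ t, P.eval t = F t

theorem PolyDeg.mono {d e : ℕ} {F : ℚ → ℚ} (hF : PolyDeg d F) (hde : d ≤ e) : PolyDeg e F :=
  let ⟨P, hP, hPF⟩ := hF
  ⟨P, hP.trans hde, hPF⟩

theorem polyDeg_const (d : ℕ) (a : ℚ) : PolyDeg d fun _ => a := ⟨Polynomial.C a, by simp, by simp⟩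

theorem polyDeg_id : PolyDeg 1 fun t => t := ⟨Polynomial.X, by simp, by simp⟩

theorem PolyDeg.add {d : ℕ} {F G : ℚ → ℚ} (hF : PolyDeg d F) (hG : PolyDeg d G) :
    PolyDeg d fun t => F t + G t :=
  let ⟨P, hP, hPF⟩ := hF
  let ⟨Q, hQ, hQG⟩ := hG
  ⟨P + Q, (Polynomial.natDegree_add_le _ _).trans (max_le hP hQ), by simp [hPF, hQG]⟩

theorem PolyDeg.mul {d e : ℕ} {F G : ℚ → ℚ} (hF : PolyDeg d F) (hG : PolyDeg e G) :
    PolyDeg (d + e) fun t => F t * G t :=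
  let ⟨P, hP, hPF⟩ := hF
  let ⟨Q, hQ, hQG⟩ := hG
  ⟨P * Q, Polynomial.natDegree_mul_le.trans (add_le_add hP hQ), by simp [hPF, hQG]⟩

theorem PolyDeg.sum {ι : Type*} (s : Finset ι) {d : ℕ} {F : ι → ℚ → ℚ}
    (hF : ∀ i ∈ s, PolyDeg d (F i)) : PolyDeg d fun t => ∑ i ∈ s, F i t := by
  classical
  induction s using Finset.induction_on with
  | empty => simpa using polyDeg_const d 0
  | insert i s hi ih =>
    simp only [Finset.sum_insert hi]
    exact (hF i (by simp)).add (ih fun j hj => hF j (by simp [hj]))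

theorem PolyDeg.pow {d : ℕ} {F : ℚ → ℚ} (hF : PolyDeg d F) (r : ℕ) :
    PolyDeg (d * r) fun t => F t ^ r :=
  let ⟨P, hP, hPF⟩ := hF
  ⟨P ^ r, Polynomial.natDegree_pow_le.trans (by rw [mul_comm]; gcongr), by simp [hPF]⟩

theorem PolyDeg.prod {ι : Type*} (s : Finset ι) {F : ι → ℚ → ℚ}
    (hF : ∀ i ∈ s, PolyDeg 1 (F i)) : PolyDeg s.card fun t => ∏ i ∈ s, F i t := by
  classical
  induction s using Finset.induction_on with
  | empty => simpa using polyDeg_const 0 1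
  | insert i s hi ih =>
    simp only [Finset.prod_insert hi, Finset.card_insert_of_notMem hi]
    rw [add_comm]
    exact (hF i (by simp)).mul (ih fun j hj => hF j (by simp [hj]))

theorem PolyDeg.h {b : ℚ} {d : ℕ} (c : ℕ) {φ : ℚ → Finset ℕ → ℚ}
    (hφ : ∀ S, PolyDeg d fun t => φ t S) (S : Finset ℕ) :
    PolyDeg (1 + d) fun t => h b c t (φ t) S := by
  simp only [h_apply, u_apply]
  refine ((hφ S).mono (by omega)).add (polyDeg_id.mul ?_)
  split_ifs
  · have := (polyDeg_const 0 b).mul (hφ S)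
    rw [zero_add] at this
    exact this.add (hφ _)
  · exact polyDeg_const _ _

theorem polyDeg_asc {b : ℚ} (m : ℕ) {d : ℕ} {φ : ℚ → Finset ℕ → ℚ}
    (hφ : ∀ S, PolyDeg d fun t => φ t S) (S : Finset ℕ) :
    PolyDeg (m + d) fun t => asc b t m (φ t) S := by
  induction m generalizing φ d with
  | zero => simpa [asc] using hφ S
  | succ m ih => exact (ih (PolyDeg.h m hφ)).mono (by omega)

theorem polyDeg_stair_cons (b : ℚ) (m : ℕ) (xs : List ℚ) :
    PolyDeg m fun t => stair b m (t :: xs) := by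
  simp only [stair, vec_cons, B_apply_eq_asc _ _ subset_rfl]
  exact polyDeg_asc m (d := 0) (φ := fun _ => vec b m xs) (fun S => polyDeg_const 0 _) _

theorem continuous_h {b : ℚ} (c : ℕ) {x : ℚ → ℚ} (hx : Continuous x) {φ : ℚ → Finset ℕ → ℚ}
    (hφ : ∀ S, Continuous fun q => φ q S) (S : Finset ℕ) :
    Continuous fun q => h b c (x q) (φ q) S := by
  have h1 := hφ S
  have h2 := hφ (rem c S)
  simp only [h_apply, u_apply]
  split_ifs <;> fun_prop

theorem continuous_B {b : ℚ} (m : ℕ) {x : ℚ → ℚ} (hx : Continuous x) {φ : ℚ → Finset ℕ → ℚ}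
    (hφ : ∀ S, Continuous fun q => φ q S) (S : Finset ℕ) :
    Continuous fun q => B b (x q) m (φ q) S := by
  induction m using Nat.twoStepInduction generalizing φ S with
  | zero => exact hφ S
  | one => exact continuous_h 0 hx hφ S
  | more m _ ih =>
    exact continuous_h (m + 1) hx (ih (continuous_h (m + 1) hx hφ)) S

theorem continuous_stair {ι : Type*} (b : ℚ) (m : ℕ) (l : List ι) {x : ι → ℚ → ℚ}
    (hx : ∀ i, Continuous (x i)) : Continuous fun q => stair b m (l.map fun i => x i q) := by
  have key : ∀ S, Continuous fun q => vec b m (l.map fun i => x i q) S := by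
    induction l with
    | nil => exact fun S => continuous_const
    | cons i l ih =>
      simp only [List.map_cons, vec_cons]
      exact continuous_B m (hx i) ih
  exact key _

/-- The entries of the bialternant of the staircase `(m, m-1, …, 1)` in `n` variables, columns
listed from the smallest part to the largest. -/
def bialtEntry (b : ℚ) (m n j : ℕ) (x : ℚ) : ℚ :=
  x ^ (m - (n - 1 - j) + j) * (1 + b * x) ^ (n - 1 - j)

/-- The bialternant of the staircase `(m, m-1, …, 1)`. -/
def bialt (b : ℚ) (m n : ℕ) (x : Fin n → ℚ) : ℚ :=
  (Matrix.of fun i j : Fin n => bialtEntry b m n j (x i)).det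

theorem bialt_comp (b : ℚ) (m n : ℕ) (x : Fin n → ℚ) (σ : Equiv.Perm (Fin n)) :
    bialt b m n (x ∘ σ) = (Equiv.Perm.sign σ : ℤ) * bialt b m n x :=
  Matrix.det_permute σ (Matrix.of fun i j : Fin n => bialtEntry b m n j (x i))

theorem det_vandermonde_comp (n : ℕ) (x : Fin n → ℚ) (σ : Equiv.Perm (Fin n)) :
    (Matrix.vandermonde (x ∘ σ)).det = (Equiv.Perm.sign σ : ℤ) * (Matrix.vandermonde x).det :=
  Matrix.det_permute σ (Matrix.vandermonde x)

theorem det_vandermonde_cons (n : ℕ) (t : ℚ) (x : Fin n → ℚ) :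
    (Matrix.vandermonde (Fin.cons t x : Fin (n + 1) → ℚ)).det
      = (∏ i, (x i - t)) * (Matrix.vandermonde x).det := by
  rw [Matrix.det_vandermonde, Matrix.det_vandermonde, Fin.prod_univ_succ]
  simp [Fin.prod_Ioi_succ]

theorem bialtEntry_succ (b : ℚ) (m n j : ℕ) (x : ℚ) :
    bialtEntry b m (n + 1) (j + 1) x = x * bialtEntry b m n j x := by
  rw [bialtEntry, bialtEntry, show n + 1 - 1 - (j + 1) = n - 1 - j by omega]
  ring

theorem bialt_cons_zero (b : ℚ) {m n : ℕ} (hmn : m ≤ n) (x : Fin n → ℚ) :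
    bialt b m (n + 1) (Fin.cons 0 x) = (∏ i, x i) * bialt b m n x := by
  have e : bialtEntry b m (n + 1) 0 0 = 1 := by simp [bialtEntry, Nat.sub_eq_zero_of_le hmn]
  rw [bialt, Matrix.det_succ_row_zero, Fin.sum_univ_succ]
  simp only [Matrix.of_apply, Fin.cons_zero, Fin.val_zero, Fin.val_succ, bialtEntry_succ, e]
  simp only [zero_mul, mul_zero, Finset.sum_const_zero, add_zero, pow_zero, one_mul]
  rw [bialt, ← Matrix.det_mul_column]
  congr 1
  ext i j
  simp [bialtEntry_succ]

theorem bialt_cons_zero_eq_zero (b : ℚ) {m n : ℕ} (hmn : n < m) (x : Fin n → ℚ) :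
    bialt b m (n + 1) (Fin.cons 0 x) = 0 := by
  refine Matrix.det_eq_zero_of_row_eq_zero 0 fun j => ?_
  have : m - (n + 1 - 1 - (j : ℕ)) + j ≠ 0 := by omega
  rw [Matrix.of_apply, Fin.cons_zero, bialtEntry, zero_pow this, zero_mul]

theorem bialt_cons_of_eq {b t : ℚ} (ht : 1 + b * t = 0) (m n : ℕ) (x : Fin n → ℚ) :
    bialt b m (n + 1) (Fin.cons t x)
      = (-1) ^ n * t ^ (m + n) * (∏ i, (1 + b * x i)) * bialt b (m - 1) n x := by
  have e : ∀ j : Fin n, bialtEntry b m (n + 1) j t = 0 := fun j => by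
    have : n - (j : ℕ) ≠ 0 := by omega
    simp [bialtEntry, ht, this]
  have e' : bialtEntry b m (n + 1) n t = t ^ (m + n) := by simp [bialtEntry]
  rw [bialt, Matrix.det_succ_row_zero, Fin.sum_univ_castSucc]
  simp only [Matrix.of_apply, Fin.cons_zero, Fin.val_castSucc, e, Fin.val_last, e', mul_zero,
    zero_mul, Finset.sum_const_zero, zero_add, Fin.succAbove_last]
  rw [mul_assoc _ (∏ i, _), bialt, ← Matrix.det_mul_column]
  congr 2
  ext i j
  simp only [Matrix.submatrix_apply, Matrix.of_apply, Fin.cons_succ, Fin.val_castSucc, bialtEntry]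
  rw [show n + 1 - 1 - (j : ℕ) = n - 1 - j + 1 by omega,
    show m - (n - 1 - (j : ℕ) + 1) = m - 1 - (n - 1 - j) by omega]
  ring

theorem polyDeg_bialtEntry (b : ℚ) (m n : ℕ) (j : Fin (n + 1)) :
    PolyDeg (m + n) fun t => bialtEntry b m (n + 1) j t := by
  have h1 : PolyDeg 1 fun t => 1 + b * t :=
    (polyDeg_const 1 1).add (by simpa using (polyDeg_const 0 b).mul polyDeg_id)
  exact ((polyDeg_id.pow _).mul (h1.pow _)).mono (by omega)

theorem polyDeg_bialt_cons (b : ℚ) (m n : ℕ) (x : Fin n → ℚ) :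
    PolyDeg (m + n) fun t => bialt b m (n + 1) (Fin.cons t x) := by
  simp only [bialt, Matrix.det_succ_row_zero, Matrix.of_apply, Fin.cons_zero]
  refine PolyDeg.sum _ fun j _ => ?_
  have hsub : ∀ t : ℚ, (Matrix.of fun i j : Fin (n + 1) =>
      bialtEntry b m (n + 1) j ((Fin.cons t x : Fin (n + 1) → ℚ) i)).submatrix Fin.succ j.succAbove
      = Matrix.of fun i k : Fin n => bialtEntry b m (n + 1) (j.succAbove k) (x i) := by
    intro t; ext i k; simp
  simp only [hsub]
  have := ((polyDeg_const 0 ((-1) ^ (j : ℕ))).mul (polyDeg_bialtEntry b m n j)).mul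
    (polyDeg_const 0
      (Matrix.of fun i k : Fin n => bialtEntry b m (n + 1) (j.succAbove k) (x i)).det)
  simpa using this

theorem polyDeg_det_vandermonde_cons (n : ℕ) (x : Fin n → ℚ) :
    PolyDeg n fun t => (Matrix.vandermonde (Fin.cons t x : Fin (n + 1) → ℚ)).det := by
  simp only [det_vandermonde_cons]
  have h1 : ∀ i ∈ Finset.univ, PolyDeg 1 fun t => x i - t := fun i _ => by
    have := (polyDeg_const 1 (x i)).add
      (by simpa using (polyDeg_const 0 (-1)).mul polyDeg_id : PolyDeg 1 fun t => -t)
    simpa [sub_eq_add_neg] using this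
  simpa using (PolyDeg.prod Finset.univ h1).mul (polyDeg_const 0 (Matrix.vandermonde x).det)

theorem det_eq_of_two_rows {n : ℕ} (M : Matrix (Fin (n + 2)) (Fin (n + 2)) ℚ)
    (h0 : ∀ j : Fin n, M 0 j.succ.succ = 0) (h1 : ∀ j : Fin n, M 1 j.succ.succ = 0) :
    M.det = (M 0 0 * M 1 1 - M 0 1 * M 1 0)
      * (Matrix.of fun i j : Fin n => M i.succ.succ j.succ.succ).det := by
  have e : ∀ c : Fin (n + 1) → Fin (n + 2), (∀ j : Fin n, c j.succ = j.succ.succ) →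
      (M.submatrix Fin.succ c).det
        = M 1 (c 0) * (Matrix.of fun i j : Fin n => M i.succ.succ j.succ.succ).det := by
    intro c hc
    rw [Matrix.det_succ_row_zero, Fin.sum_univ_succ]
    simp only [Matrix.submatrix_apply, hc, Fin.succ_zero_eq_one, h1, mul_zero, zero_mul,
      Finset.sum_const_zero, add_zero, Fin.val_zero, pow_zero, one_mul]
    congr 2
    ext i j
    simp [hc]
  rw [Matrix.det_succ_row_zero, Fin.sum_univ_succ, Fin.sum_univ_succ]
  simp only [h0, mul_zero, zero_mul, Finset.sum_const_zero, add_zero, Fin.val_zero, pow_zero,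
    one_mul, Fin.succ_zero_eq_one]
  rw [e _ (fun j => by simp), e (Fin.succAbove 1) (fun j => by
    rw [Fin.succAbove_of_le_castSucc _ _ (by simp [Fin.le_def])])]
  simp
  ring

/-- The coefficients expressing `(x ^ 2 - E * (1 + b * x)) * bialtEntry b m n j x` through
the entries of the larger bialternant. -/
theorem bialtEntry_mul (b E : ℚ) (m n j : ℕ) (hj : j < n) (x : ℚ) :
    (x ^ 2 - E * (1 + b * x)) * bialtEntry b m n j x
      = bialtEntry b m (n + 2) (j + 2) x
        - (if n - j ≤ m then E else -(b * E)) * bialtEntry b m (n + 2) (j + 1) x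
        - (if n - j ≤ m then 0 else E) * bialtEntry b m (n + 2) j x := by
  obtain ⟨r, hr⟩ : ∃ r, n = j + 1 + r := ⟨n - j - 1, by omega⟩
  simp only [bialtEntry, show n - 1 - j = r by omega, show n + 2 - 1 - (j + 2) = r by omega,
    show n + 2 - 1 - (j + 1) = r + 1 by omega, show n + 2 - 1 - j = r + 2 by omega,
    show n - j = r + 1 by omega]
  split_ifs with h
  · rw [show m - r = m - (r + 1) + 1 by omega]
    ring
  · rw [show m - r = 0 by omega, show m - (r + 1) = 0 by omega, show m - (r + 2) = 0 by omega]
    ring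

theorem bialt_cons_cons {b u v : ℚ} (huv : u + v + b * u * v = 0) (m n : ℕ)
    (x : Fin n → ℚ) :
    bialt b m (n + 2) (Fin.cons v (Fin.cons u x))
      = if m ≤ n then (u - v) * (∏ i, ((x i - v) * (x i - u))) * bialt b m n x else 0 := by
  set E : ℚ := -(u * v) with hE
  set M : Matrix (Fin (n + 2)) (Fin (n + 2)) ℚ := Matrix.of fun i j =>
    bialtEntry b m (n + 2) j ((Fin.cons v (Fin.cons u x) : Fin (n + 2) → ℚ) i) with hM
  let C : Matrix (Fin (n + 2)) (Fin (n + 2)) ℚ := Matrix.of fun i j =>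
    (if (i : ℕ) = j then 1 else 0)
    + (if (i : ℕ) + 1 = j ∧ 2 ≤ (j : ℕ) then
        -(if n - (j - 2) ≤ m then E else -(b * E)) else 0)
    + (if (i : ℕ) + 2 = j then -(if n - (j - 2) ≤ m then 0 else E) else 0)
  have hC : C.det = 1 := by
    rw [Matrix.det_of_isUpperTriangular]
    · refine Finset.prod_eq_one fun i _ => ?_
      simp [C]
    · intro i j hij
      have : (j : ℕ) < i := hij
      simp only [C, Matrix.of_apply]
      rw [if_neg (by omega), if_neg (by omega), if_neg (by omega)]
      simp
  have hC01 : ∀ i j : Fin (n + 2), (j : ℕ) < 2 → C i j = if i = j then 1 else 0 := by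
    intro i j hj
    simp only [C, Matrix.of_apply, Fin.ext_iff]
    rw [if_neg (by omega : ¬ ((i : ℕ) + 1 = j ∧ 2 ≤ (j : ℕ)))]
    rw [if_neg (by omega : ¬ ((i : ℕ) + 2 = j))]
    simp
  have hC2 : ∀ (i : Fin (n + 2)) (j : Fin n), C i j.succ.succ
      = (if i = j.succ.succ then 1 else 0)
        + (if i = j.castSucc.succ then -(if n - j ≤ m then E else -(b * E)) else 0)
        + (if i = j.castSucc.castSucc then -(if n - j ≤ m then 0 else E) else 0) := by
    intro i j
    simp [C, Fin.ext_iff]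
  have hMC01 : ∀ i j : Fin (n + 2), (j : ℕ) < 2 → (M * C) i j = M i j := by
    intro i j hj
    simp [Matrix.mul_apply, hC01 _ j hj]
  have hMC2 : ∀ (i : Fin (n + 2)) (j : Fin n), (M * C) i j.succ.succ
      = ((Fin.cons v (Fin.cons u x) : Fin (n + 2) → ℚ) i ^ 2
          - E * (1 + b * (Fin.cons v (Fin.cons u x) : Fin (n + 2) → ℚ) i))
        * bialtEntry b m n j ((Fin.cons v (Fin.cons u x) : Fin (n + 2) → ℚ) i) := by
    intro i j
    rw [bialtEntry_mul b E m n j j.2, Matrix.mul_apply]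
    simp only [hC2, mul_add, Finset.sum_add_distrib, mul_ite, mul_one, mul_zero,
      Finset.sum_ite_eq', Finset.mem_univ, if_true]
    simp only [hM, Matrix.of_apply, Fin.val_succ, Fin.val_castSucc]
    split_ifs <;> ring
  have hquad : ∀ y, y ^ 2 - E * (1 + b * y) = (y - v) * (y - u) := fun y => by
    rw [hE]; linear_combination y * huv
  have hdet : bialt b m (n + 2) (Fin.cons v (Fin.cons u x)) = (M * C).det := by
    rw [Matrix.det_mul, hC, mul_one]; rfl
  rw [hdet, det_eq_of_two_rows]
  · rw [hMC01 0 0 (by simp), hMC01 1 1 (by simp), hMC01 0 1 (by simp), hMC01 1 0 (by simp)]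
    have hrest : (Matrix.of fun i j : Fin n => (M * C) i.succ.succ j.succ.succ).det
        = (∏ i, ((x i - v) * (x i - u))) * bialt b m n x := by
      rw [bialt, ← Matrix.det_mul_column]
      congr 1
      ext i j
      simp [hMC2, hquad]
    rw [hrest]
    have hv : (1 + b * u) * (1 + b * v) = 1 := by linear_combination b * huv
    have hv' : v * (1 + b * u) = -u := by linear_combination huv
    have hu' : u * (1 + b * v) = -v := by linear_combination huv
    have h00 : M 0 0 = v ^ (m - (n + 1)) * (1 + b * v) ^ (n + 1) := by simp [hM, bialtEntry]
    have h10 : M 1 0 = u ^ (m - (n + 1)) * (1 + b * u) ^ (n + 1) := by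
      rw [← Fin.succ_zero_eq_one]; simp [hM, bialtEntry]
    have h01 : M 0 1 = v ^ (m - n + 1) * (1 + b * v) ^ n := by simp [hM, bialtEntry]
    have h11 : M 1 1 = u ^ (m - n + 1) * (1 + b * u) ^ n := by
      rw [← Fin.succ_zero_eq_one]; simp [hM, bialtEntry]
    rw [h00, h10, h01, h11]
    generalize 1 + b * u = s at *
    generalize 1 + b * v = r at *
    split_ifs with hmn
    · rw [show m - (n + 1) = 0 by omega, show m - n = 0 by omega]
      have : v ^ 0 * r ^ (n + 1) * (u ^ (0 + 1) * s ^ n)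
          - v ^ (0 + 1) * r ^ n * (u ^ 0 * s ^ (n + 1))
          = (s * r) ^ n * (u * r - v * s) := by ring
      rw [this, hv, hu', hv', one_pow]
      ring
    · obtain ⟨d, rfl⟩ : ∃ d, m = n + 1 + d := ⟨m - n - 1, by omega⟩
      rw [show n + 1 + d - (n + 1) = d by omega, show n + 1 + d - n = d + 1 by omega]
      have : v ^ d * r ^ (n + 1) * (u ^ (d + 1 + 1) * s ^ n)
          - v ^ (d + 1 + 1) * r ^ n * (u ^ d * s ^ (n + 1))
          = (u * v) ^ d * (s * r) ^ n * (u * (u * r) - v * (v * s)) := by ring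
      rw [this, hu', hv']
      ring
  · intro j
    rw [hMC2, hquad]; simp
  · intro j
    rw [hMC2, hquad]
    simp

theorem stair_mul_vandermonde_of_comp {b : ℚ} {m n : ℕ} {x : Fin n → ℚ}
    (hx : ∀ i, 1 + b * x i ≠ 0) (σ : Equiv.Perm (Fin n))
    (h : stair b m (List.ofFn (x ∘ σ)) * (Matrix.vandermonde (x ∘ σ)).det = bialt b m n (x ∘ σ)) :
    stair b m (List.ofFn x) * (Matrix.vandermonde x).det = bialt b m n x := by
  have hp : stair b m (List.ofFn x) = stair b m (List.ofFn (x ∘ σ)) :=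
    stair_perm m (Equiv.Perm.ofFn_comp_perm σ x).symm (by simpa [List.forall_mem_ofFn_iff] using hx)
  rw [bialt_comp, det_vandermonde_comp, ← hp] at h
  have hs : ((Equiv.Perm.sign σ : ℤ) : ℚ) ≠ 0 := by simp
  apply mul_left_cancel₀ hs
  linear_combination h

/-- The bialternant formula for the K-theoretic Schur P-function of a shifted staircase. -/
theorem stair_mul_vandermonde {b : ℚ} (hb : 0 < b) (n : ℕ) : ∀ {m : ℕ}, m ≤ n →
    ∀ {x : Fin n → ℚ}, Function.Injective x → (∀ i, 0 < x i) →
    stair b m (List.ofFn x) * (Matrix.vandermonde x).det = bialt b m n x := by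
  induction n using Nat.strong_induction_on with
  | _ n ih =>
  intro m hmn x hx hpos
  cases n with
  | zero =>
    obtain rfl : m = 0 := by omega
    simp [bialt, stair, vec, vac]
  | succ n =>
    obtain ⟨t₀, x, rfl⟩ : ∃ t₀, ∃ y : Fin n → ℚ, x = Fin.cons t₀ y :=
      ⟨x 0, Fin.tail x, (Fin.cons_self_tail x).symm⟩
    have hx' : Function.Injective x := (Fin.cons_injective_iff.1 hx).2
    have hpos' : ∀ i, 0 < x i := fun i => hpos i.succ
    have h1pos : ∀ i, 0 < 1 + b * x i := fun i => by have := hpos' i; positivity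
    let F : ℚ → ℚ := fun t => stair b m (t :: List.ofFn x)
      * (Matrix.vandermonde (Fin.cons t x : Fin (n + 1) → ℚ)).det
      + (-1) * bialt b m (n + 1) (Fin.cons t x)
    have hF : PolyDeg (m + n) F :=
      ((polyDeg_stair_cons b m _).mul (polyDeg_det_vandermonde_cons n x)).add
        (by simpa using (polyDeg_const 0 (-1)).mul (polyDeg_bialt_cons b m n x))
    have hF1 : ∀ i, F (x i) = 0 := fun i => by
      have h1 : bialt b m (n + 1) (Fin.cons (x i) x) = 0 :=
        Matrix.det_zero_of_row_eq (Fin.succ_ne_zero i).symm (by ext j; simp)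
      simp only [F]
      rw [h1, det_vandermonde_cons, Finset.prod_eq_zero (Finset.mem_univ i) (sub_self _)]
      ring
    have hF2 : ∀ i, F (-x i / (1 + b * x i)) = 0 := fun i => by
      obtain ⟨n, rfl⟩ : ∃ l, n = l + 1 := ⟨n - 1, by have := i.2; omega⟩
      have h0 := (h1pos i).ne'
      set v := -x i / (1 + b * x i) with hv
      have huv : x i + v + b * x i * v = 0 := by
        have : v * (1 + b * x i) = -x i := div_mul_cancel₀ _ h0
        linear_combination this
      have huv' : v + x i + b * v * x i = 0 := by rw [← huv]; ring
      have hv1 : 1 + b * v ≠ 0 := fun h => by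
        have : (1 + b * x i) * (1 + b * v) = 1 := by linear_combination b * huv
        rw [h, mul_zero] at this
        exact zero_ne_one this
      let σ : Equiv.Perm (Fin (n + 1)) := Equiv.swap 0 i
      let τ : Equiv.Perm (Fin (n + 2)) := Equiv.swap (Fin.succ 0) i.succ
      let y : Fin n → ℚ := fun j => x (σ j.succ)
      have hτ : (Fin.cons v x : Fin (n + 2) → ℚ) ∘ τ = Fin.cons v (Fin.cons (x i) y) := by
        ext j
        refine Fin.cases ?_ (fun j => ?_) j
        · rw [Function.comp_apply, Equiv.swap_apply_of_ne_of_ne (Fin.succ_ne_zero _).symm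
            (Fin.succ_ne_zero _).symm]
          rfl
        · have : τ j.succ = (σ j).succ := by
            simp only [τ, σ, Equiv.swap_apply_def, Fin.succ_inj]
            split_ifs <;> rfl
          rw [Function.comp_apply, this]
          refine Fin.cases ?_ (fun j => ?_) j
          · simp [σ]
          · simp [y]
      have hy : Function.Injective y := fun j k hjk =>
        Fin.succ_injective _ (σ.injective (hx' hjk))
      have key := stair_mul_vandermonde_of_comp (b := b) (m := m) (x := Fin.cons v x)
        (fun j => by refine Fin.cases ?_ (fun j => ?_) j <;> simp [hv1, (h1pos _).ne']) τ (by
          rw [hτ, bialt_cons_cons huv, List.ofFn_cons, List.ofFn_cons, stair_cons_cons huv',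
            det_vandermonde_cons, det_vandermonde_cons, Fin.prod_univ_succ, Finset.prod_mul_distrib]
          simp only [Fin.cons_zero, Fin.cons_succ]
          split_ifs with hm
          · rw [← ih n (by omega) hm hy fun j => hpos' _]
            ring
          · rw [stair_eq_zero b (by simpa using hm), zero_mul])
      rw [List.ofFn_cons] at key
      simp only [F]
      rw [key]
      ring
    have hF3 : F 0 = 0 := by
      simp only [F]
      rw [stair_zero_cons, det_vandermonde_cons]
      by_cases hm : m ≤ n
      · rw [bialt_cons_zero b hm, ← ih n (by omega) hm hx' hpos']
        simp only [sub_zero]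
        ring
      · rw [bialt_cons_zero_eq_zero b (by omega), stair_eq_zero b (by simpa using hm)]
        ring
    have hF4 : F (-1 / b) = 0 := by
      have ht : 1 + b * (-1 / b) = 0 := by field_simp; ring
      have ht' : 1 + (-1 / b) * b = 0 := by rw [← ht]; ring
      have hprod : ∏ i, (x i - -1 / b) = (-1) ^ n * (-1 / b) ^ n * ∏ i, (1 + b * x i) := by
        have : ∀ i ∈ Finset.univ, x i - -1 / b = ((-1) * (-1 / b)) * (1 + b * x i) := fun i _ => by
          field_simp; ring
        rw [Finset.prod_congr rfl this, Finset.prod_mul_distrib, Finset.prod_const, mul_pow]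
        simp
      simp only [F]
      rw [bialt_cons_of_eq ht, stair_cons_of_eq ht', det_vandermonde_cons, hprod,
        ← ih n (by omega) (by omega : m - 1 ≤ n) hx' hpos']
      ring
    obtain ⟨P, hP, hPF⟩ := hF
    let s₁ := Finset.univ.image x
    let s₂ := Finset.univ.image fun i => -x i / (1 + b * x i)
    let s₃ : Finset ℚ := {0, -1 / b}
    have hbneg : -1 / b < 0 := div_neg_of_neg_of_pos (by norm_num) hb
    have h2neg : ∀ i, -x i / (1 + b * x i) < 0 := fun i =>
      div_neg_of_neg_of_pos (by linarith [hpos' i]) (h1pos i)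
    have h2inj : Function.Injective fun i => -x i / (1 + b * x i) := fun i j hij => by
      have := (div_eq_div_iff (h1pos i).ne' (h1pos j).ne').1 hij
      exact hx' (by linarith)
    have h2ne : ∀ i, -x i / (1 + b * x i) ≠ -1 / b := fun i hi => by
      have := (div_eq_div_iff (h1pos i).ne' hb.ne').1 hi
      linarith
    have hcard : ((s₁ ∪ s₂) ∪ s₃).card = n + n + 2 := by
      rw [Finset.card_union_of_disjoint, Finset.card_union_of_disjoint,
        Finset.card_image_of_injective _ hx', Finset.card_image_of_injective _ h2inj,
        Finset.card_pair hbneg.ne']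
      · simp
      · rw [Finset.disjoint_left]
        intro t ht ht'
        simp only [s₁, s₂, Finset.mem_image, Finset.mem_univ, true_and] at ht ht'
        obtain ⟨i, rfl⟩ := ht
        obtain ⟨j, hj⟩ := ht'
        linarith [hpos' i, h2neg j]
      · rw [Finset.disjoint_left]
        intro t ht ht'
        simp only [s₁, s₂, s₃, Finset.mem_union, Finset.mem_image, Finset.mem_univ, true_and,
          Finset.mem_insert, Finset.mem_singleton] at ht ht'
        rcases ht with ⟨i, rfl⟩ | ⟨i, rfl⟩
        · rcases ht' with h | h <;> linarith [hpos' i]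
        · rcases ht' with h | h
          · linarith [h2neg i]
          · exact h2ne i h
    have hP0 : P = 0 := by
      refine Polynomial.eq_zero_of_degree_lt_of_eval_finset_eq_zero ((s₁ ∪ s₂) ∪ s₃) ?_ ?_
      · rw [hcard]
        exact (Polynomial.degree_le_of_natDegree_le hP).trans_lt (by exact_mod_cast by omega)
      · intro t ht
        rw [hPF]
        simp only [s₁, s₂, s₃, Finset.mem_union, Finset.mem_image, Finset.mem_univ, true_and,
          Finset.mem_insert, Finset.mem_singleton] at ht
        rcases ht with (⟨i, rfl⟩ | ⟨i, rfl⟩) | rfl | rfl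
        · exact hF1 i
        · exact hF2 i
        · exact hF3
        · exact hF4
    have hF0 : F t₀ = 0 := by rw [← hPF, hP0, Polynomial.eval_zero]
    rw [List.ofFn_cons]
    simp only [F] at hF0
    linear_combination hF0

/-- The pairs `i < j` of indices. -/
def pairs (n : ℕ) : Finset (Fin n × Fin n) := Finset.univ.filter fun p => p.1 < p.2

theorem prod_pairs (n : ℕ) (f : Fin n × Fin n → ℚ) :
    ∏ p ∈ pairs n, f p = ∏ i : Fin n, ∏ j ∈ Finset.Ioi i, f (i, j) := by
  rw [pairs, Finset.prod_filter, Fintype.prod_prod_type]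
  refine Finset.prod_congr rfl fun i _ => ?_
  rw [← Finset.prod_filter, Finset.filter_lt_eq_Ioi]

/-- The quotient `(q ^ a - q ^ c) / (q - 1)`. -/
def qdiff (a c : ℕ) (q : ℚ) : ℚ := ∑ i ∈ Finset.range a, q ^ i - ∑ i ∈ Finset.range c, q ^ i

theorem sub_mul_qdiff (a c : ℕ) (q : ℚ) : (1 - q) * qdiff a c q = q ^ c - q ^ a := by
  have h1 := geom_sum_mul q a
  have h2 := geom_sum_mul q c
  rw [qdiff]
  linear_combination -h1 + h2

theorem qdiff_one (a c : ℕ) : qdiff a c 1 = a - c := by simp [qdiff]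

theorem continuous_qdiff (a c : ℕ) : Continuous (qdiff a c) := by
  unfold qdiff; fun_prop

theorem det_vandermonde_pow (n : ℕ) (e : Fin n → ℕ) (q : ℚ) :
    (Matrix.vandermonde fun j => q ^ e j).det
      = (1 - q) ^ (pairs n).card * ∏ p ∈ pairs n, qdiff (e p.1) (e p.2) q := by
  rw [Matrix.det_vandermonde, ← Finset.prod_const, ← Finset.prod_mul_distrib, prod_pairs]
  simp only [sub_mul_qdiff]

theorem bialt_pow (b : ℚ) (m n : ℕ) (q : ℚ) :
    bialt b m n (fun i => q ^ (i : ℕ))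
      = (Equiv.Perm.sign (Fin.revPerm (n := n)) : ℤ) * ∑ κ : (j : Fin n) → Fin (j.val + 1),
        (∏ j : Fin n, ((Nat.choose j.val (κ j).val : ℚ) * b ^ (κ j).val))
          * (Matrix.vandermonde fun j : Fin n => q ^ (m - j + (n - 1 - j) + κ j)).det := by
  have hM : (Matrix.of fun i j : Fin n => bialtEntry b m n j (q ^ (i : ℕ)))
      = (Matrix.of fun i j : Fin n => ∑ κ : Fin (j.val + 1),
          ((Nat.choose j.val κ.val : ℚ) * b ^ κ.val) * (q ^ (m - j + (n - 1 - j) + κ : ℕ)) ^ (i : ℕ)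
        ).submatrix id (Fin.revPerm (n := n)) := by
    ext i j
    simp only [Matrix.of_apply, Matrix.submatrix_apply, id, Fin.revPerm_apply, Fin.val_rev]
    rw [Fin.sum_univ_eq_sum_range (fun κ : ℕ => ((Nat.choose (n - (j + 1)) κ : ℚ) * b ^ κ)
      * (q ^ (m - (n - (j + 1)) + (n - 1 - (n - (j + 1))) + κ : ℕ)) ^ (i : ℕ)), bialtEntry,
      add_comm 1 (b * _), add_pow, Finset.mul_sum]
    refine Finset.sum_congr (by congr 1; omega) fun κ _ => ?_
    rw [show n - 1 - (j : ℕ) = n - (j + 1) by omega, show n - 1 - (n - ((j : ℕ) + 1)) = j by omega]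
    simp only [one_pow, mul_pow, mul_one]
    ring
  rw [bialt, hM, Matrix.det_permute', ← Matrix.det_transpose]
  congr 1
  have hT : (Matrix.of fun i j : Fin n => ∑ κ : Fin (j.val + 1),
      ((Nat.choose j.val κ.val : ℚ) * b ^ κ.val) *
        (q ^ (m - j + (n - 1 - j) + κ : ℕ)) ^ (i : ℕ)).transpose
      = fun j : Fin n => ∑ κ : Fin (j.val + 1), ((Nat.choose j.val κ.val : ℚ) * b ^ κ.val) •
        fun i : Fin n => (q ^ (m - j + (n - 1 - j) + κ : ℕ)) ^ (i : ℕ) := by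
    ext j i
    simp [Finset.sum_apply]
  rw [hT]
  change (Matrix.detRowAlternating (n := Fin n) (R := ℚ)).toMultilinearMap _ = _
  rw [MultilinearMap.map_sum]
  refine Finset.sum_congr rfl fun κ _ => ?_
  rw [MultilinearMap.map_smul_univ]
  rfl

theorem eq_at_one {f g : ℚ → ℚ} (hf : Continuous f) (hg : Continuous g)
    (h : ∀ q, 1 < q → f q = g q) : f 1 = g 1 := by
  have hc : closure (Set.Ioi (1 : ℚ)) = Set.Ici 1 := closure_Ioi 1
  have : Set.EqOn f g (closure (Set.Ioi 1)) := Set.EqOn.closure h hf hg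
  exact this (by rw [hc]; exact Set.self_mem_Ici)

/-- The numbers `A_{ij}` of the staircase `(m, m-1, …, 1)`. -/
def gap (m n : ℕ) (p : Fin n × Fin n) : ℚ :=
  ((m - p.1 : ℕ) : ℚ) - ((m - p.2 : ℕ) : ℚ) + p.2 - p.1

theorem gap_pos {m n : ℕ} {p : Fin n × Fin n} (hp : p ∈ pairs n) : 0 < gap m n p := by
  have hp' : (p.1 : ℕ) < p.2 := by simpa [pairs] using hp
  have h1 : ((m - p.2 : ℕ) : ℚ) ≤ ((m - p.1 : ℕ) : ℚ) := by exact_mod_cast (by omega)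
  have h2 : ((p.1 : ℕ) : ℚ) < p.2 := by exact_mod_cast hp'
  rw [gap]; linarith

theorem stair_replicate_mul {b : ℚ} (hb : 0 < b) {m n : ℕ} (hmn : m ≤ n) :
    stair b m (List.replicate n 1) * ∏ p ∈ pairs n, ((p.2 : ℚ) - p.1)
      = (∏ p ∈ pairs n, gap m n p) * holmanF n (fun i => m + 1 - i) (-b) := by
  have hq : ∀ q : ℚ, 1 < q →
      stair b m (List.ofFn fun i : Fin n => q ^ (i : ℕ))
          * ∏ p ∈ pairs n, qdiff (n - 1 - p.1) (n - 1 - p.2) q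
        = ∑ κ : (j : Fin n) → Fin (j.val + 1),
          (∏ j : Fin n, ((Nat.choose j.val (κ j).val : ℚ) * b ^ (κ j).val))
          * ∏ p ∈ pairs n, qdiff (m - p.1 + (n - 1 - p.1) + κ p.1)
              (m - p.2 + (n - 1 - p.2) + κ p.2) q := by
    intro q hq
    have hs : ((Equiv.Perm.sign (Fin.revPerm (n := n)) : ℤ) : ℚ) ≠ 0 := by simp
    have h1 : (1 - q) ^ (pairs n).card ≠ 0 := pow_ne_zero _ (by linarith)
    have hV : (Matrix.vandermonde fun i : Fin n => q ^ (i : ℕ)).det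
        = (Equiv.Perm.sign (Fin.revPerm (n := n)) : ℤ)
          * (Matrix.vandermonde fun j : Fin n => q ^ (n - 1 - j : ℕ)).det := by
      rw [← det_vandermonde_comp]
      congr 2
      ext j
      simp only [Function.comp_apply, Fin.revPerm_apply, Fin.val_rev]
      congr 1; omega
    have key := stair_mul_vandermonde hb n hmn (x := fun i => q ^ (i : ℕ))
      (fun i j hij => Fin.ext (pow_right_injective₀ (by linarith) hq.ne' hij))
      (fun i => by positivity)
    rw [bialt_pow, hV, det_vandermonde_pow] at key
    simp only [det_vandermonde_pow] at key
    apply mul_left_cancel₀ hs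
    apply mul_left_cancel₀ h1
    rw [Finset.mul_sum] at key ⊢
    rw [Finset.mul_sum]
    calc _ = _ := by ring
      _ = _ := key
      _ = _ := Finset.sum_congr rfl fun κ _ => by ring
  have h1 := eq_at_one (f := fun q => _) (g := fun q => _) ?_ ?_ hq
  · simp only [one_pow, qdiff_one] at h1
    have hl : (List.ofFn fun _ : Fin n => (1 : ℚ)) = List.replicate n 1 := by simp
    rw [hl] at h1
    have h2 : ∏ p ∈ pairs n, ((p.2 : ℚ) - p.1)
        = ∏ p ∈ pairs n, (((n - 1 - p.1 : ℕ) : ℚ) - ((n - 1 - p.2 : ℕ) : ℚ)) := by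
      refine Finset.prod_congr rfl fun p _ => ?_
      rw [Nat.cast_sub (by omega : p.1.val ≤ n - 1), Nat.cast_sub (by omega : p.2.val ≤ n - 1)]
      ring
    rw [h2, h1, holmanF, Finset.mul_sum]
    refine Finset.sum_congr rfl fun κ _ => ?_
    rw [neg_neg, Finset.prod_mul_distrib, Finset.prod_pow_eq_pow_sum, ← mul_assoc, ← mul_assoc]
    rw [show (Finset.univ.filter fun p : Fin n × Fin n => p.1 < p.2) = pairs n from rfl,
      ← Finset.prod_mul_distrib]
    have h3 : ∏ p ∈ pairs n, (((m - p.1 + (n - 1 - p.1) + κ p.1 : ℕ) : ℚ)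
          - ((m - p.2 + (n - 1 - p.2) + κ p.2 : ℕ) : ℚ))
        = ∏ p ∈ pairs n, gap m n p *
          ((((m + 1 - (p.1.val + 1) : ℕ) : ℚ) - ((m + 1 - (p.2.val + 1) : ℕ) : ℚ) + (p.2.val : ℚ)
            - (p.1.val : ℚ) + ((κ p.1).val : ℚ) - ((κ p.2).val : ℚ)) /
          (((m + 1 - (p.1.val + 1) : ℕ) : ℚ) - ((m + 1 - (p.2.val + 1) : ℕ) : ℚ) + (p.2.val : ℚ)
            - (p.1.val : ℚ))) := by
      refine Finset.prod_congr rfl fun p hp => ?_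
      simp only [Nat.add_sub_add_right]
      rw [show ((m - p.1.val : ℕ) : ℚ) - ((m - p.2.val : ℕ) : ℚ) + (p.2.val : ℚ)
        - (p.1.val : ℚ) = gap m n p from rfl, mul_div_cancel₀ _ (gap_pos hp).ne', gap]
      push_cast
      rw [Nat.cast_sub (by omega : p.1.val ≤ n - 1), Nat.cast_sub (by omega : p.2.val ≤ n - 1)]
      ring
    rw [h3]
    ring
  · simp only [List.ofFn_eq_map]
    exact (continuous_stair b m _ fun i => continuous_pow _).mul
      (continuous_finsetProd _ fun p _ => continuous_qdiff _ _)
  · exact continuous_finsetSum _ fun κ _ => continuous_const.mul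
      (continuous_finsetProd _ fun p _ => continuous_qdiff _ _)

theorem exists_polynomial_h (c : ℕ) {φ : ℚ → Finset ℕ → ℚ}
    (hφ : ∀ S, ∃ P : Polynomial ℚ, ∀ b, P.eval b = φ b S) (S : Finset ℕ) :
    ∃ P : Polynomial ℚ, ∀ b, P.eval b = h b c 1 (φ b) S := by
  obtain ⟨P, hP⟩ := hφ S
  obtain ⟨Q, hQ⟩ := hφ (rem c S)
  by_cases hc : Corner c S
  · exact ⟨P + (Polynomial.X * P + Q), fun b => by simp [h_of_corner hc, hP, hQ]; ring⟩
  · exact ⟨P, fun b => by rw [h_of_not_corner hc, hP]⟩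

theorem exists_polynomial_B (m : ℕ) {φ : ℚ → Finset ℕ → ℚ}
    (hφ : ∀ S, ∃ P : Polynomial ℚ, ∀ b, P.eval b = φ b S) (S : Finset ℕ) :
    ∃ P : Polynomial ℚ, ∀ b, P.eval b = B b 1 m (φ b) S := by
  induction m using Nat.twoStepInduction generalizing φ S with
  | zero => exact hφ S
  | one => exact exists_polynomial_h 0 hφ S
  | more m _ ih => exact exists_polynomial_h (m + 1) (ih (exists_polynomial_h (m + 1) hφ)) S

theorem exists_polynomial_stair (m n : ℕ) :
    ∃ P : Polynomial ℚ, ∀ b, P.eval b = stair b m (List.replicate n 1) := by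
  have key : ∀ S, ∃ P : Polynomial ℚ, ∀ b, P.eval b = vec b m (List.replicate n 1) S := by
    induction n with
    | zero => exact fun S => ⟨Polynomial.C (vac S), fun b => by simp [vec]⟩
    | succ n ih =>
      simp only [List.replicate_succ, vec_cons]
      exact exists_polynomial_B m ih
  exact key _

theorem exists_polynomial_holmanF (n : ℕ) (lam : ℕ → ℕ) :
    ∃ P : Polynomial ℚ, ∀ b, P.eval b = holmanF n lam (-b) := by
  have key : ∀ (c : ((i : Fin n) → Fin (i.val + 1)) → ℚ) (e : ((i : Fin n) → Fin (i.val + 1)) → ℕ),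
      ∃ P : Polynomial ℚ, ∀ b, P.eval b = ∑ κ, c κ * (- -b) ^ e κ := fun c e =>
    ⟨∑ κ, Polynomial.C (c κ) * Polynomial.X ^ e κ, fun b => by simp [Polynomial.eval_finsetSum]⟩
  exact key _ _

theorem stair_replicate_mul' (b : ℚ) {m n : ℕ} (hmn : m ≤ n) :
    stair b m (List.replicate n 1) * ∏ p ∈ pairs n, ((p.2 : ℚ) - p.1)
      = (∏ p ∈ pairs n, gap m n p) * holmanF n (fun i => m + 1 - i) (-b) := by
  obtain ⟨P, hP⟩ := exists_polynomial_stair m n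
  obtain ⟨Q, hQ⟩ := exists_polynomial_holmanF n (fun i => m + 1 - i)
  have : P * Polynomial.C (∏ p ∈ pairs n, ((p.2 : ℚ) - p.1))
      = Polynomial.C (∏ p ∈ pairs n, gap m n p) * Q := by
    refine Polynomial.eq_of_infinite_eval_eq _ _ ((Set.Ioi_infinite (0 : ℚ)).mono fun c hc => ?_)
    simp only [Set.mem_ofPred_eq, Polynomial.eval_mul, Polynomial.eval_C, hP, hQ]
    exact stair_replicate_mul hc hmn
  have := congrArg (Polynomial.eval b) this
  rwa [Polynomial.eval_mul, Polynomial.eval_mul, Polynomial.eval_C, Polynomial.eval_C, hP,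
    hQ] at this

theorem prod_pairs_eq_prod_range (n : ℕ) (f : ℕ → ℕ → ℚ) :
    ∏ p ∈ pairs n, f p.1 p.2 = ∏ j ∈ Finset.range n, ∏ i ∈ Finset.range j, f i j := by
  rw [pairs, Finset.prod_filter, Fintype.prod_prod_type_right,
    ← Fin.prod_univ_eq_prod_range (fun j => ∏ i ∈ Finset.range j, f i j)]
  refine Finset.prod_congr rfl fun j _ => ?_
  simp only [Fin.lt_def]
  rw [Fin.prod_univ_eq_prod_range (fun i => if i < (j : ℕ) then f i j else 1), ← Finset.prod_filter]
  refine Finset.prod_congr ?_ fun _ _ => rfl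
  ext i
  simp only [Finset.mem_filter, Finset.mem_range]
  omega

theorem factorial_two_mul (k : ℕ) : ((2 * k).factorial : ℚ)
    = 2 ^ k * k.factorial * ∏ j ∈ Finset.range k, (1 + 2 * (j : ℚ)) := by
  induction k with
  | zero => simp
  | succ k ih =>
    rw [show 2 * (k + 1) = 2 * k + 1 + 1 by ring, Nat.factorial_succ, Nat.factorial_succ,
      Finset.prod_range_succ, Nat.factorial_succ]
    push_cast
    rw [ih]
    ring

theorem prod_gap_succ (m n : ℕ) (hn : m < n) :
    (2 * (m + 1)).factorial * ∏ p ∈ pairs n, gap (m + 1) n p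
      = 2 ^ (m + 1) * ((m + 1).factorial : ℚ)
        * (∏ j ∈ Finset.range (m + 1), ((n : ℚ) - (m + 1) + 1 + 2 * j))
        * ∏ p ∈ pairs n, gap m n p := by
  have e : ∀ l, ∏ p ∈ pairs n, gap l n p = ∏ j ∈ Finset.range n, ∏ i ∈ Finset.range j,
      (((l - i : ℕ) : ℚ) - ((l - j : ℕ) : ℚ) + j - i) := fun l =>
    prod_pairs_eq_prod_range n fun i j => ((l - i : ℕ) : ℚ) - ((l - j : ℕ) : ℚ) + j - i
  rw [e, e]
  clear e
  induction n, (hn : m + 1 ≤ n) using Nat.le_induction with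
  | base =>
    rw [factorial_two_mul]
    have h1 : ∏ j ∈ Finset.range (m + 1), ∏ i ∈ Finset.range j,
        (((m + 1 - i : ℕ) : ℚ) - ((m + 1 - j : ℕ) : ℚ) + j - i)
        = ∏ j ∈ Finset.range (m + 1), ∏ i ∈ Finset.range j,
        (((m - i : ℕ) : ℚ) - ((m - j : ℕ) : ℚ) + j - i) := by
      refine Finset.prod_congr rfl fun j hj => Finset.prod_congr rfl fun i hi => ?_
      simp only [Finset.mem_range] at hi hj
      rw [Nat.cast_sub (by omega), Nat.cast_sub (by omega), Nat.cast_sub (by omega),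
        Nat.cast_sub (by omega)]
      push_cast
      ring
    rw [h1]
    push_cast
    congr 2
    refine Finset.prod_congr rfl fun j _ => ?_
    ring
  | succ n hn ih =>
    rw [Finset.prod_range_succ _ n, Finset.prod_range_succ _ n, ← mul_assoc, ih]
    have hs : ∀ l, l ≤ m + 1 → m ≤ l → ∏ i ∈ Finset.range n,
          (((l - i : ℕ) : ℚ) - ((l - n : ℕ) : ℚ) + n - i)
        = (∏ i ∈ Finset.range (m + 1), ((n : ℚ) + l - 2 * m + 2 * i))
          * ∏ i ∈ Finset.Ico (m + 1) n, ((n : ℚ) - i) := by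
      intro l hl hl'
      rw [← Finset.prod_range_mul_prod_Ico _ hn, ← Finset.prod_range_reflect]
      congr 1
      · refine Finset.prod_congr rfl fun i hi => ?_
        have hi := Finset.mem_range.1 hi
        rw [show m + 1 - 1 - i = m - i by omega, show l - n = 0 by omega,
          Nat.cast_sub (by omega : m - i ≤ l), Nat.cast_sub (by omega : i ≤ m)]
        push_cast
        ring
      · refine Finset.prod_congr rfl fun i hi => ?_
        have hi := Finset.mem_Ico.1 hi
        rw [show l - n = 0 by omega, show l - i = 0 by omega]
        simp
    rw [hs (m + 1) le_rfl (by omega), hs m (by omega) le_rfl]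
    have e1 : ∏ j ∈ Finset.range (m + 1), ((n : ℚ) - (m + 1) + 1 + 2 * j)
        = ∏ i ∈ Finset.range (m + 1), ((n : ℚ) + m - 2 * m + 2 * i) :=
      Finset.prod_congr rfl fun i _ => by ring
    have e2 : ∏ j ∈ Finset.range (m + 1), (((n + 1 : ℕ) : ℚ) - (m + 1) + 1 + 2 * j)
        = ∏ i ∈ Finset.range (m + 1), ((n : ℚ) + (m + 1 : ℕ) - 2 * m + 2 * i) :=
      Finset.prod_congr rfl fun i _ => by push_cast; ring
    rw [e1, e2]
    ring

theorem stair_recurrence (b : ℚ) {m n : ℕ} (hn : m < n) :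
    ((2 * (m + 1)).factorial : ℚ) * stair b (m + 1) (List.replicate n 1)
        * holmanF n (fun i => m + 1 - i) (-b)
      = 2 ^ (m + 1) * ((m + 1).factorial : ℚ)
        * (∏ j ∈ Finset.range (m + 1), ((n : ℚ) - (m + 1) + 1 + 2 * j))
        * stair b m (List.replicate n 1) * holmanF n (fun i => m + 1 + 1 - i) (-b) := by
  have h0 : ∏ p ∈ pairs n, ((p.2 : ℚ) - p.1) ≠ 0 := by
    refine Finset.prod_ne_zero_iff.2 fun p hp => ?_
    have hp' : p.1 < p.2 := by simpa [pairs] using hp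
    exact sub_ne_zero.2 (by exact_mod_cast (Fin.lt_def.1 hp').ne')
  have h1 := stair_replicate_mul' b (m := m) (n := n) hn.le
  have h2 := stair_replicate_mul' b (m := m + 1) (n := n) hn
  have h3 := prod_gap_succ m n hn
  apply mul_right_cancel₀ h0
  linear_combination ((2 * (m + 1)).factorial : ℚ) * holmanF n (fun i => m + 1 - i) (-b) * h2
    + holmanF n (fun i => m + 1 - i) (-b) * holmanF n (fun i => m + 1 + 1 - i) (-b) * h3
    - 2 ^ (m + 1) * ((m + 1).factorial : ℚ)
        * (∏ j ∈ Finset.range (m + 1), ((n : ℚ) - (m + 1) + 1 + 2 * j))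
        * holmanF n (fun i => m + 1 + 1 - i) (-b) * h1

theorem jacobiP_neg_one (k n : ℕ) :
    jacobiP k (((n : ℚ) - k - 1) / 2) ((-(n : ℚ) - k - 1) / 2) (-1) * (2 ^ k * k.factorial)
      = ∏ j ∈ Finset.range k, ((n : ℚ) - k + 1 + 2 * j) := by
  rw [jacobiP, Finset.sum_range_succ, Finset.sum_eq_zero, zero_add]
  · have h1 : ∏ j ∈ Finset.range k, ((n : ℚ) - k + 1 + 2 * j)
        = (∏ j ∈ Finset.range k, ((k : ℚ) + (-(n : ℚ) - k - 1) / 2 - j)) * (-2) ^ k := by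
      rw [← Finset.card_range k, ← Finset.prod_const, Finset.card_range,
        ← Finset.prod_mul_distrib]
      exact Finset.prod_congr rfl fun j _ => by ring
    have h2 : ((-2 : ℚ)) ^ k = (-1) ^ k * 2 ^ k := by rw [← mul_pow]; norm_num
    have h3 : ((-1 : ℚ) - 1) / 2 = -1 := by norm_num
    have h4 : (k.factorial : ℚ) ≠ 0 := by positivity
    rw [h1, h2, genBinom, genBinom, Nat.sub_self, h3]
    simp only [Finset.range_zero, Finset.prod_empty, Nat.factorial_zero, pow_zero]
    field_simp
    simp
  · intro r hr
    have : k - r ≠ 0 := by have := Finset.mem_range.1 hr; omega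
    simp [this]

/-- The number of boxes of content `c` of the shape `S`. -/
def cnt (S : Finset ℕ) (c : ℕ) : ℕ := (S.filter fun p => c ≤ p).card

theorem cnt_eq (S : Finset ℕ) (c : ℕ) : cnt S c = cnt S (c + 1) + if c ∈ S then 1 else 0 := by
  have hd : Disjoint (S.filter fun p => c + 1 ≤ p) (S.filter fun p => p = c) := by
    rw [Finset.disjoint_filter]; intros; omega
  have hc : (if c ∈ S then 1 else 0) = (S.filter fun p => p = c).card := by
    rw [Finset.filter_eq']
    split_ifs <;> simp
  rw [hc, cnt, cnt, ← Finset.card_union_of_disjoint hd, ← Finset.filter_or]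
  congr 1
  ext p
  simp only [Finset.mem_filter]
  constructor <;> rintro ⟨h, h'⟩ <;> exact ⟨h, by omega⟩

theorem Corner.mem {c : ℕ} {S : Finset ℕ} (h : Corner c S) : c ∈ S := by
  cases c
  · exact h
  · exact h.1

theorem cnt_rem {c : ℕ} {S : Finset ℕ} (h : Corner c S) (d : ℕ) :
    cnt S d = cnt (rem c S) d + if d = c then 1 else 0 := by
  have hc := h.mem
  by_cases hd : d = c
  · subst hd
    have : ((rem d S).filter fun p => d ≤ p) = (S.filter fun p => d ≤ p).erase d := by
      ext p
      cases d <;> simp only [rem, Finset.mem_filter, Finset.mem_erase, Finset.mem_insert] <;> grind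
    rw [cnt, cnt, this, Finset.card_erase_of_mem (by simp [hc]), if_pos rfl]
    have := Finset.card_pos.2 ⟨d, (by simp [hc] : d ∈ S.filter fun p => d ≤ p)⟩
    omega
  · rw [if_neg hd, add_zero]
    cases c with
    | zero =>
      rw [cnt, cnt]
      congr 1
      ext p
      simp only [rem, Finset.mem_filter, Finset.mem_erase]
      constructor
      · rintro ⟨hp, hp'⟩; exact ⟨⟨by omega, hp⟩, hp'⟩
      · rintro ⟨⟨-, hp⟩, hp'⟩; exact ⟨hp, hp'⟩
    | succ c =>
      rcases lt_or_gt_of_ne hd with hd | hd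
      · have e : ((rem (c + 1) S).filter fun p => d ≤ p)
            = insert c ((S.filter fun p => d ≤ p).erase (c + 1)) := by
          ext p
          simp only [rem, Finset.mem_filter, Finset.mem_erase, Finset.mem_insert]
          grind
        have := Finset.card_pos.2 ⟨c + 1, (by simp [hc]; omega : c + 1 ∈ S.filter fun p => d ≤ p)⟩
        rw [cnt, cnt, e, Finset.card_insert_of_notMem (by simp [h.2]),
          Finset.card_erase_of_mem (by simp [hc]; omega)]
        omega
      · rw [cnt, cnt]
        congr 1
        ext p
        simp only [rem, Finset.mem_filter, Finset.mem_erase, Finset.mem_insert]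
        grind

/-- A set-valued filling of the shape `S` by the first `N` positions of the word `w`, where
`T c i` is the entry of the box of content `c` in row `i`. -/
structure IsFilling (w : ℕ → ℕ) (N : ℕ) (S : Finset ℕ) (T : ℕ → ℕ → Finset ℕ) : Prop where
  nonempty_iff : ∀ c i, (T c i).Nonempty ↔ i < cnt S c
  lt : ∀ {c i p}, p ∈ T c i → p < N
  content : ∀ {c i p}, p ∈ T c i → w p = c
  row : ∀ {c i p q}, p ∈ T c i → q ∈ T (c + 1) i → p < q
  col : ∀ {c i p q}, p ∈ T (c + 1) i → q ∈ T c (i + 1) → p < q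

/-- Insert `N` in the box of content `c` in row `i`. -/
def ins (N c i : ℕ) (T : ℕ → ℕ → Finset ℕ) : ℕ → ℕ → Finset ℕ := fun c' i' =>
  if c' = c ∧ i' = i then insert N (T c' i') else T c' i'

/-- Delete `N` from the box of content `c` in row `i`. -/
def del (N c i : ℕ) (T : ℕ → ℕ → Finset ℕ) : ℕ → ℕ → Finset ℕ := fun c' i' =>
  if c' = c ∧ i' = i then (T c' i').erase N else T c' i'

theorem mem_ins {N c i c' i' p : ℕ} {T : ℕ → ℕ → Finset ℕ} :
    p ∈ ins N c i T c' i' ↔ (p = N ∧ c' = c ∧ i' = i) ∨ p ∈ T c' i' := by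
  unfold ins; split_ifs <;> grind

theorem mem_del {N c i c' i' p : ℕ} {T : ℕ → ℕ → Finset ℕ} :
    p ∈ del N c i T c' i' ↔ p ∈ T c' i' ∧ ¬ (p = N ∧ c' = c ∧ i' = i) := by
  unfold del; split_ifs <;> grind

theorem ins_del {N c i : ℕ} {T : ℕ → ℕ → Finset ℕ} (h : N ∈ T c i) :
    ins N c i (del N c i T) = T := by
  ext c' i' p
  rw [mem_ins, mem_del]
  grind

theorem del_ins {N c i : ℕ} {T : ℕ → ℕ → Finset ℕ} (h : N ∉ T c i) :
    del N c i (ins N c i T) = T := by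
  ext c' i' p
  rw [mem_del, mem_ins]
  grind

theorem IsFilling.notMem {w : ℕ → ℕ} {N : ℕ} {S : Finset ℕ} {T : ℕ → ℕ → Finset ℕ}
    (hT : IsFilling w N S T) (c i : ℕ) : N ∉ T c i := fun h => (hT.lt h).false

theorem IsFilling.eq_of_mem {w : ℕ → ℕ} {N : ℕ} {S : Finset ℕ} {T : ℕ → ℕ → Finset ℕ}
    (hT : IsFilling w (N + 1) S T) {c i : ℕ} (h : N ∈ T c i) :
    c = w N ∧ i = cnt S (w N + 1) ∧ Corner (w N) S := by
  obtain rfl := hT.content h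
  refine ⟨rfl, ?_⟩
  have h1 := (hT.nonempty_iff _ _).1 ⟨N, h⟩
  have h2 : cnt S (w N + 1) ≤ i := by
    by_contra hlt
    obtain ⟨q, hq⟩ := (hT.nonempty_iff (w N + 1) i).2 (by omega)
    have := hT.row h hq
    have := hT.lt hq
    omega
  have h3 := cnt_eq S (w N)
  have hmem : w N ∈ S := by by_contra hn; rw [if_neg hn] at h3; omega
  rw [if_pos hmem] at h3
  refine ⟨by omega, ?_⟩
  rcases hw : w N with _ | d
  · rw [hw] at hmem; exact hmem
  · rw [hw] at hmem h h1 h2 h3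
    refine ⟨hmem, fun hd => ?_⟩
    have h4 := cnt_eq S d
    rw [if_pos hd] at h4
    obtain ⟨q, hq⟩ := (hT.nonempty_iff d (i + 1)).2 (by omega)
    have := hT.col h hq
    have := hT.lt hq
    omega

theorem IsFilling.succ {w : ℕ → ℕ} {N : ℕ} {S : Finset ℕ} {T : ℕ → ℕ → Finset ℕ}
    (hT : IsFilling w N S T) : IsFilling w (N + 1) S T :=
  ⟨hT.nonempty_iff, fun h => (hT.lt h).trans (Nat.lt_succ_self N), hT.content, hT.row, hT.col⟩

theorem IsFilling.of_succ {w : ℕ → ℕ} {N : ℕ} {S : Finset ℕ} {T : ℕ → ℕ → Finset ℕ}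
    (hT : IsFilling w (N + 1) S T) (h : ∀ c i, N ∉ T c i) : IsFilling w N S T := by
  refine ⟨hT.nonempty_iff, fun {c i p} hp => ?_, hT.content, hT.row, hT.col⟩
  have h1 := hT.lt hp
  have h2 : p ≠ N := fun e => h c i (e ▸ hp)
  omega

theorem IsFilling.ins {w : ℕ → ℕ} {N : ℕ} {S S' : Finset ℕ} {T : ℕ → ℕ → Finset ℕ}
    (hT : IsFilling w N S' T) (hc : Corner (w N) S)
    (hS : S' = S ∨ S' = rem (w N) S) :
    IsFilling w (N + 1) S (ins N (w N) (cnt S (w N + 1)) T) := by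
  have hcS := cnt_eq S (w N)
  rw [if_pos hc.mem] at hcS
  have hle : ∀ d, cnt S' d ≤ cnt S d := fun d => by
    rcases hS with rfl | rfl
    · exact le_rfl
    · rw [cnt_rem hc]; omega
  have hge : ∀ d, cnt S d ≤ cnt S' d + if d = w N then 1 else 0 := fun d => by
    rcases hS with rfl | rfl
    · omega
    · rw [cnt_rem hc]
  refine ⟨fun d i => ?_, fun {d i p} h => ?_, fun {d i p} h => ?_, fun {d i p q} h h' => ?_,
    fun {d i p q} h h' => ?_⟩
  · have h1 : (ShiftedStair.ins N (w N) (cnt S (w N + 1)) T d i).Nonempty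
        ↔ (d = w N ∧ i = cnt S (w N + 1)) ∨ (T d i).Nonempty := by
      simp only [Finset.Nonempty, mem_ins]
      grind
    rw [h1, hT.nonempty_iff]
    have := hle d
    have := hge d
    by_cases hd : d = w N
    · subst hd
      rw [if_pos rfl] at this
      omega
    · rw [if_neg hd] at this
      omega
  · rcases mem_ins.1 h with ⟨rfl, -⟩ | h
    · omega
    · have := hT.lt h; omega
  · rcases mem_ins.1 h with ⟨rfl, rfl, -⟩ | h
    · rfl
    · exact hT.content h
  · rcases mem_ins.1 h with ⟨rfl, rfl, rfl⟩ | hp <;> rcases mem_ins.1 h' with ⟨rfl, e, -⟩ | hq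
    · omega
    · have := (hT.nonempty_iff _ _).1 ⟨q, hq⟩
      have := hle (w p + 1)
      omega
    · exact hT.lt hp
    · exact hT.row hp hq
  · rcases mem_ins.1 h with ⟨rfl, e, rfl⟩ | hp <;> rcases mem_ins.1 h' with ⟨rfl, e', -⟩ | hq
    · omega
    · have h1 := (hT.nonempty_iff _ _).1 ⟨q, hq⟩
      have h2 := hle d
      have h3 := cnt_eq S d
      rw [← e] at hc hcS
      rw [if_neg hc.2] at h3
      rw [← e] at h1
      omega
    · exact hT.lt hp
    · exact hT.col hp hq

theorem IsFilling.del {w : ℕ → ℕ} {N : ℕ} {S : Finset ℕ} {T : ℕ → ℕ → Finset ℕ}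
    (hT : IsFilling w (N + 1) S T) {c i : ℕ} (h : N ∈ T c i) :
    IsFilling w N S (del N c i T) ∨ IsFilling w N (rem (w N) S) (del N c i T) := by
  obtain ⟨hc, hi, hcor⟩ := hT.eq_of_mem h
  have hcS := cnt_eq S (w N)
  rw [if_pos hcor.mem] at hcS
  have lt : ∀ {c' i' p}, p ∈ ShiftedStair.del N c i T c' i' → p < N := fun {c' i' p} hp => by
    obtain ⟨h1, h2⟩ := mem_del.1 hp
    have h3 := hT.lt h1
    have : p ≠ N := by
      rintro rfl
      obtain ⟨hc', hi', -⟩ := hT.eq_of_mem h1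
      exact h2 ⟨rfl, by omega, by omega⟩
    omega
  have hne : ∀ c' i', ¬ (c' = c ∧ i' = i) → ShiftedStair.del N c i T c' i' = T c' i' :=
    fun c' i' hn => if_neg hn
  by_cases hn : (ShiftedStair.del N c i T c i).Nonempty
  · left
    refine ⟨fun c' i' => ?_, lt, fun hp => hT.content (mem_del.1 hp).1,
      fun hp hq => hT.row (mem_del.1 hp).1 (mem_del.1 hq).1,
      fun hp hq => hT.col (mem_del.1 hp).1 (mem_del.1 hq).1⟩
    by_cases he : c' = c ∧ i' = i
    · obtain ⟨rfl, rfl⟩ := he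
      exact iff_of_true hn ((hT.nonempty_iff _ _).1 ⟨N, h⟩)
    · rw [hne _ _ he, hT.nonempty_iff]
  · right
    refine ⟨fun c' i' => ?_, lt, fun hp => hT.content (mem_del.1 hp).1,
      fun hp hq => hT.row (mem_del.1 hp).1 (mem_del.1 hq).1,
      fun hp hq => hT.col (mem_del.1 hp).1 (mem_del.1 hq).1⟩
    have hr := cnt_rem hcor c'
    by_cases he : c' = c ∧ i' = i
    · obtain ⟨rfl, rfl⟩ := he
      refine iff_of_false hn ?_
      rw [if_pos hc] at hr
      subst hc
      omega
    · rw [hne _ _ he, hT.nonempty_iff]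
      by_cases hc' : c' = w N
      · rw [if_pos hc'] at hr
        subst hc'
        have : i' ≠ i := fun e => he ⟨hc.symm, e⟩
        omega
      · rw [if_neg hc'] at hr
        omega

open Classical in
/-- The set of all fillings of the shape `S` by the first `N` positions of `w`. -/
noncomputable def fillings (w : ℕ → ℕ) : ℕ → Finset ℕ → Finset (ℕ → ℕ → Finset ℕ)
  | 0, S => if S = ∅ then {fun _ _ => ∅} else ∅
  | N + 1, S =>
    if Corner (w N) S then
      fillings w N S ∪ (fillings w N S ∪ fillings w N (rem (w N) S)).image
        (ins N (w N) (cnt S (w N + 1)))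
    else fillings w N S

theorem mem_fillings {w : ℕ → ℕ} {N : ℕ} {S : Finset ℕ} {T : ℕ → ℕ → Finset ℕ} :
    T ∈ fillings w N S ↔ IsFilling w N S T := by
  induction N generalizing S T with
  | zero =>
    rw [fillings]
    split_ifs with hS
    · subst hS
      rw [Finset.mem_singleton]
      constructor
      · rintro rfl
        exact ⟨by simp [cnt], by simp, by simp, by simp, by simp⟩
      · intro h
        ext c i p
        exact iff_of_false (fun hp => (h.lt hp).not_ge (Nat.zero_le _)) (by simp)
    · refine iff_of_false (by simp) fun h => hS ?_
      obtain ⟨p, hp⟩ | hS := S.eq_empty_or_nonempty.symm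
      · obtain ⟨q, hq⟩ := (h.nonempty_iff p 0).2 (Finset.card_pos.2 ⟨p, by simp [hp]⟩)
        exact absurd (h.lt hq) (Nat.not_lt_zero _)
      · exact hS
  | succ N ih =>
    rw [fillings]
    split_ifs with hc
    · simp only [Finset.mem_union, Finset.mem_image, ih]
      constructor
      · rintro (h | ⟨T, h | h, rfl⟩)
        · exact h.succ
        · exact h.ins hc (Or.inl rfl)
        · exact h.ins hc (Or.inr rfl)
      · intro h
        by_cases hN : ∃ c i, N ∈ T c i
        · obtain ⟨c, i, hN⟩ := hN
          obtain ⟨rfl, rfl, -⟩ := h.eq_of_mem hN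
          exact Or.inr ⟨_, h.del hN, ins_del hN⟩
        · push Not at hN
          exact Or.inl (h.of_succ hN)
    · rw [ih]
      exact ⟨fun h => h.succ, fun h => h.of_succ fun c i hN => hc (h.eq_of_mem hN).2.2⟩

/-- The excess of a filling: the number of entries minus the number of boxes. -/
def excess (K : ℕ) (T : ℕ → ℕ → Finset ℕ) : ℕ :=
  ∑ p ∈ Finset.range K ×ˢ Finset.range K, ((T p.1 p.2).card - 1)

theorem excess_ins {K N c i : ℕ} {T : ℕ → ℕ → Finset ℕ} (hc : c < K) (hi : i < K)
    (hN : N ∉ T c i) :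
    excess K (ins N c i T) = excess K T + if (T c i).Nonempty then 1 else 0 := by
  have hm : (c, i) ∈ Finset.range K ×ˢ Finset.range K := by simp [hc, hi]
  rw [excess, excess, ← Finset.add_sum_erase _ _ hm, ← Finset.add_sum_erase _ _ hm]
  have h1 : ∑ p ∈ (Finset.range K ×ˢ Finset.range K).erase (c, i), ((ins N c i T p.1 p.2).card - 1)
      = ∑ p ∈ (Finset.range K ×ˢ Finset.range K).erase (c, i), ((T p.1 p.2).card - 1) := by
    refine Finset.sum_congr rfl fun p hp => ?_
    have : ¬ (p.1 = c ∧ p.2 = i) := fun h => (Finset.mem_erase.1 hp).1 (Prod.ext h.1 h.2)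
    rw [ins, if_neg this]
  have h2 : (ins N c i T c i).card = (T c i).card + 1 := by
    rw [ins, if_pos ⟨rfl, rfl⟩, Finset.card_insert_of_notMem hN]
  rw [h1, h2]
  split_ifs with h
  · have : 0 < (T c i).card := Finset.card_pos.2 h
    change (T c i).card + 1 - 1 + _ = (T c i).card - 1 + _ + 1
    omega
  · rw [Finset.not_nonempty_iff_eq_empty.1 h]
    simp

/-- The generating functions of fillings by the first `N` positions of the word `w`. -/
def wordVec (b : ℚ) (w : ℕ → ℕ) : ℕ → Finset ℕ → ℚ
  | 0 => vac
  | N + 1 => h b (w N) 1 (wordVec b w N)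

theorem sum_fillings (b : ℚ) (w : ℕ → ℕ) {K : ℕ} (N : ℕ) {S : Finset ℕ}
    (hS : S ⊆ Finset.range K) :
    ∑ T ∈ fillings w N S, b ^ excess K T = wordVec b w N S := by
  classical
  induction N generalizing S with
  | zero =>
    rw [fillings, wordVec, vac]
    split_ifs
    · simp [excess]
    · rfl
  | succ N ih =>
    by_cases hc : Corner (w N) S
    · have hcK : w N < K := Finset.mem_range.1 (hS hc.mem)
      have hcS := cnt_eq S (w N)
      rw [if_pos hc.mem] at hcS
      have hcr := cnt_rem hc (w N)
      rw [if_pos rfl] at hcr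
      have hiK : cnt S (w N + 1) < K := by
        have : cnt S (w N) ≤ K := (Finset.card_filter_le _ _).trans
          ((Finset.card_le_card hS).trans_eq (Finset.card_range K))
        omega
      have hnot : ∀ S', ∀ T ∈ fillings w N S', ∀ c i, N ∉ T c i := fun S' T hT =>
        (mem_fillings.1 hT).notMem
      have hinj : Set.InjOn (ins N (w N) (cnt S (w N + 1)))
          (fillings w N S ∪ fillings w N (rem (w N) S) : Finset _) := by
        intro T hT T' hT' e
        have hn : ∀ T ∈ fillings w N S ∪ fillings w N (rem (w N) S),
            N ∉ T (w N) (cnt S (w N + 1)) := fun T hT =>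
          (Finset.mem_union.1 hT).elim (fun h => hnot _ _ h _ _) (fun h => hnot _ _ h _ _)
        rw [← del_ins (hn T hT), e, del_ins (hn T' hT')]
      have hdisj : Disjoint (fillings w N S) (fillings w N (rem (w N) S)) := by
        rw [Finset.disjoint_left]
        intro T hT hT'
        have h1 := (mem_fillings.1 hT).nonempty_iff (w N) (cnt S (w N + 1))
        have h2 := (mem_fillings.1 hT').nonempty_iff (w N) (cnt S (w N + 1))
        rw [h1] at h2
        omega
      rw [fillings, if_pos hc, Finset.sum_union, Finset.sum_image hinj, Finset.sum_union hdisj,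
        wordVec, h_of_corner hc, ← ih hS, ← ih (rem_subset hS hc)]
      · have e1 : ∑ T ∈ fillings w N S, b ^ excess K (ins N (w N) (cnt S (w N + 1)) T)
            = b * ∑ T ∈ fillings w N S, b ^ excess K T := by
          rw [Finset.mul_sum]
          refine Finset.sum_congr rfl fun T hT => ?_
          rw [excess_ins hcK hiK (hnot _ _ hT _ _), if_pos, pow_succ, mul_comm]
          rw [(mem_fillings.1 hT).nonempty_iff]
          omega
        have e2 : ∑ T ∈ fillings w N (rem (w N) S),
              b ^ excess K (ins N (w N) (cnt S (w N + 1)) T)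
            = ∑ T ∈ fillings w N (rem (w N) S), b ^ excess K T := by
          refine Finset.sum_congr rfl fun T hT => ?_
          rw [excess_ins hcK hiK (hnot _ _ hT _ _), if_neg, add_zero]
          rw [(mem_fillings.1 hT).nonempty_iff]
          omega
        rw [e1, e2]
        ring
      · rw [Finset.disjoint_left]
        intro T hT hT'
        obtain ⟨T', -, rfl⟩ := Finset.mem_image.1 hT'
        exact hnot _ _ hT (w N) (cnt S (w N + 1)) (mem_ins.2 (Or.inl ⟨rfl, rfl, rfl⟩))
    · rw [fillings, if_neg hc, wordVec, h_of_not_corner hc, ih hS]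

/-- The periodic word of contents `m-1, …, 1, 0, 1, …, m-1` read when adding the letters
`1', 1, 2', 2, …`. -/
def word (m p : ℕ) : ℕ := (m - 1 - p % (2 * m - 1)) + (p % (2 * m - 1) - (m - 1))

theorem wordVec_add (b : ℚ) (w : ℕ → ℕ) (m N : ℕ)
    (hw : ∀ j < 2 * m + 1, w (N + j) = (m - j) + (j - m)) :
    wordVec b w (N + (2 * m + 1)) = B b 1 (m + 1) (wordVec b w N) := by
  induction m generalizing N with
  | zero =>
    have := hw 0 (by omega)
    simp only [add_zero, Nat.sub_zero] at this
    change h b (w N) 1 (wordVec b w N) = h b 0 1 (wordVec b w N)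
    rw [this]
  | succ m ih =>
    have h1 := hw 0 (by omega)
    have h2 := hw (2 * m + 2) (by omega)
    rw [add_zero] at h1
    rw [show m + 1 - 0 + (0 - (m + 1)) = m + 1 by omega] at h1
    rw [show m + 1 - (2 * m + 2) + (2 * m + 2 - (m + 1)) = m + 1 by omega] at h2
    have h3 := ih (N + 1) fun j hj => by rw [add_assoc, hw _ (by omega)]; omega
    rw [show N + (2 * (m + 1) + 1) = N + (2 * m + 2) + 1 by ring, wordVec, h2,
      show N + (2 * m + 2) = N + 1 + (2 * m + 1) by ring, h3, wordVec, h1]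
    rfl

theorem wordVec_word (b : ℚ) (m n : ℕ) :
    wordVec b (word m) (n * (2 * m - 1)) = vec b m (List.replicate n 1) := by
  induction n with
  | zero => simp [wordVec, vec]
  | succ n ih =>
    rw [List.replicate_succ, vec_cons, ← ih]
    cases m with
    | zero => rfl
    | succ m =>
      rw [show 2 * (m + 1) - 1 = 2 * m + 1 by omega, show (n + 1) * (2 * m + 1)
        = n * (2 * m + 1) + (2 * m + 1) by ring]
      refine wordVec_add b _ m _ fun j hj => ?_
      rw [word, show 2 * (m + 1) - 1 = 2 * m + 1 by omega, mul_comm n, Nat.mul_add_mod,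
        Nat.mod_eq_of_lt hj]
      omega

/-- The letter added at position `p` of the word. -/
def letter (m p : ℕ) : ℕ := 2 * (p / (2 * m - 1)) + if m - 1 ≤ p % (2 * m - 1) then 1 else 0

theorem exists_div_mod {m n p : ℕ} (hp : p < n * (2 * m - 1)) :
    ∃ s r, p = (2 * m - 1) * s + r ∧ s < n ∧ r < 2 * m - 1 ∧
      word m p = (m - 1 - r) + (r - (m - 1)) ∧ letter m p = 2 * s + if m - 1 ≤ r then 1 else 0 := by
  have hL : 0 < 2 * m - 1 := Nat.pos_of_ne_zero fun h => by simp [h] at hp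
  exact ⟨p / (2 * m - 1), p % (2 * m - 1), (Nat.div_add_mod _ _).symm,
    Nat.div_lt_of_lt_mul (by rwa [mul_comm]), Nat.mod_lt _ hL, rfl, rfl⟩

theorem mul_add_lt {L s s' r r' : ℕ} (hs : s < s') (hr : r < L) : L * s + r < L * s' + r' := by
  have : L * (s + 1) ≤ L * s' := Nat.mul_le_mul_left L hs
  rw [mul_add, mul_one] at this
  omega

theorem letter_lt {m n p : ℕ} (hp : p < n * (2 * m - 1)) : letter m p < 2 * n := by
  obtain ⟨s, r, -, hs, -, -, hl⟩ := exists_div_mod hp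
  split_ifs at hl <;> omega

theorem letter_odd {m n p : ℕ} (hp : p < n * (2 * m - 1)) (hw : word m p = 0) :
    letter m p % 2 = 1 := by
  obtain ⟨s, r, -, -, hr, hw', hl⟩ := exists_div_mod hp
  rw [if_pos (by omega)] at hl
  omega

theorem letter_injOn {m n p q : ℕ} (hp : p < n * (2 * m - 1)) (hq : q < n * (2 * m - 1))
    (hw : word m p = word m q) (hl : letter m p = letter m q) : p = q := by
  obtain ⟨s, r, hp', -, hr, h1, h2⟩ := exists_div_mod hp
  obtain ⟨s', r', hq', -, hr', h3, h4⟩ := exists_div_mod hq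
  obtain rfl : s = s' := by split_ifs at h2 h4 <;> omega
  split_ifs at h2 h4 <;> omega

theorem lt_iff_letter {m n p q : ℕ} (hp : p < n * (2 * m - 1)) (hq : q < n * (2 * m - 1))
    (hw : word m q = word m p + 1) :
    p < q ↔ letter m p < letter m q ∨ (letter m p = letter m q ∧ letter m p % 2 = 1) := by
  obtain ⟨s, r, hp', -, hr, h1, h2⟩ := exists_div_mod hp
  obtain ⟨s', r', hq', -, hr', h3, h4⟩ := exists_div_mod hq
  rcases lt_trichotomy s s' with h | rfl | h
  · have := mul_add_lt (r' := r') h hr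
    split_ifs at h2 h4 <;> omega
  · split_ifs at h2 h4 <;> omega
  · have := mul_add_lt (r' := r) h hr'
    split_ifs at h2 h4 <;> omega

theorem lt_iff_letter' {m n p q : ℕ} (hp : p < n * (2 * m - 1)) (hq : q < n * (2 * m - 1))
    (hw : word m q = word m p + 1) :
    q < p ↔ letter m q < letter m p ∨ (letter m q = letter m p ∧ letter m q % 2 = 0) := by
  have h1 := lt_iff_letter hp hq hw
  have h2 : p ≠ q := by rintro rfl; omega
  omega

theorem exists_letter {m n a c : ℕ} (ha : a < 2 * n) (hc : c < m) (h : a % 2 = 1 ∨ 1 ≤ c) :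
    ∃ p < n * (2 * m - 1), letter m p = a ∧ word m p = c := by
  obtain ⟨r, hr, h1, h2⟩ : ∃ r < 2 * m - 1, c = (m - 1 - r) + (r - (m - 1)) ∧
      a = 2 * (a / 2) + if m - 1 ≤ r then 1 else 0 := by
    by_cases ha' : a % 2 = 1
    · exact ⟨m - 1 + c, by omega, by omega, by rw [if_pos (by omega)]; omega⟩
    · exact ⟨m - 1 - c, by omega, by omega, by rw [if_neg (by omega)]; omega⟩
  have hd : ((2 * m - 1) * (a / 2) + r) / (2 * m - 1) = a / 2 := by
    rw [Nat.mul_add_div (by omega), Nat.div_eq_of_lt hr, add_zero]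
  have hm : ((2 * m - 1) * (a / 2) + r) % (2 * m - 1) = r := by
    rw [Nat.mul_add_mod, Nat.mod_eq_of_lt hr]
  refine ⟨(2 * m - 1) * (a / 2) + r, ?_, ?_, ?_⟩
  · have := mul_add_lt (L := 2 * m - 1) (s := a / 2) (s' := n) (r' := 0) (by omega) hr
    rw [mul_comm n]
    omega
  · rw [letter, hd, hm, ← h2]
  · rw [word, hm, ← h1]

theorem cnt_range (m c : ℕ) : cnt (Finset.range m) c = m - c := by
  have : ((Finset.range m).filter fun p => c ≤ p) = Finset.Ico c m := by
    ext x
    simp [and_comm]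
  rw [cnt, this, Nat.card_Ico]

/-- The letter `a` is an entry of `T` in row `i` and column `j`. -/
def HasEntry {k n : ℕ} (T : Fin k × Fin k → Finset (Fin (2 * n))) (i j a : ℕ) : Prop :=
  ∃ (hi : i < k) (hj : j < k) (ha : a < 2 * n), (⟨a, ha⟩ : Fin (2 * n)) ∈ T (⟨i, hi⟩, ⟨j, hj⟩)

theorem hasEntry_val {k n : ℕ} {T : Fin k × Fin k → Finset (Fin (2 * n))} {i j : Fin k}
    {a : Fin (2 * n)} : HasEntry T i j a ↔ a ∈ T (i, j) :=
  ⟨fun ⟨_, _, _, h⟩ => h, fun h => ⟨i.2, j.2, a.2, h⟩⟩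

open Classical in
/-- The filling by positions of the word attached to a tableau. -/
noncomputable def toFilling {k n : ℕ} (m : ℕ) (T : Fin k × Fin k → Finset (Fin (2 * n)))
    (c i : ℕ) : Finset ℕ :=
  (Finset.range (n * (2 * m - 1))).filter fun p =>
    word m p = c ∧ HasEntry T i (i + c) (letter m p)

theorem mem_toFilling {k n m c i p : ℕ} {T : Fin k × Fin k → Finset (Fin (2 * n))} :
    p ∈ toFilling m T c i ↔
      p < n * (2 * m - 1) ∧ word m p = c ∧ HasEntry T i (i + c) (letter m p) := by
  simp [toFilling]

open Classical in
/-- The tableau attached to a filling by positions of the word. -/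
noncomputable def toTableau (m n : ℕ) (F : ℕ → ℕ → Finset ℕ) (q : Fin (m + 1) × Fin (m + 1)) :
    Finset (Fin (2 * n)) :=
  Finset.univ.filter fun a => q.1.val ≤ q.2.val ∧ ∃ p ∈ F (q.2 - q.1) q.1, letter m p = a

theorem mem_toTableau {m n : ℕ} {F : ℕ → ℕ → Finset ℕ} {q : Fin (m + 1) × Fin (m + 1)}
    {a : Fin (2 * n)} :
    a ∈ toTableau m n F q ↔
      q.1.val ≤ q.2.val ∧ ∃ p ∈ F (q.2 - q.1) q.1, letter m p = a := by
  simp [toTableau]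

section

variable {m n : ℕ} {T : Fin (m + 1) × Fin (m + 1) → Finset (Fin (2 * n))}

theorem HasEntry.box (hT : IsSSVTPStair (m + 1) n T) {i j a : ℕ} (h : HasEntry T i j a) :
    i ≤ j ∧ j < m := by
  obtain ⟨hi, hj, ha, h⟩ := h
  by_contra hb
  rw [hT.2.1 _ fun hb' => hb ⟨hb'.1, by have := hb'.2; simp only at this; omega⟩] at h
  exact Finset.notMem_empty _ h

theorem isFilling_toFilling (hT : IsSSVTPStair (m + 1) n T) :
    IsFilling (word m) (n * (2 * m - 1)) (Finset.range m) (toFilling m T) := by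
  obtain ⟨hne, -, hrow, hcol, hcol', hrow', hdiag⟩ := id hT
  refine ⟨fun c i => ?_, fun h => (mem_toFilling.1 h).1, fun h => (mem_toFilling.1 h).2.1,
    fun {c i p q} hp hq => ?_, fun {c i p q} hp hq => ?_⟩
  · rw [cnt_range]
    constructor
    · rintro ⟨p, hp⟩
      have := (mem_toFilling.1 hp).2.2.box hT
      omega
    · intro h
      obtain ⟨a, ha⟩ := hne (⟨i, by omega⟩, ⟨i + c, by omega⟩) ⟨by simp, by simp only; omega⟩
      obtain ⟨p, hp, hl, hw⟩ := exists_letter (m := m) (c := c) a.2 (by omega) (by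
        rcases Nat.eq_zero_or_pos c with rfl | hc
        · exact Or.inl (hdiag _ rfl a ha)
        · exact Or.inr hc)
      refine ⟨p, mem_toFilling.2 ⟨hp, hw, ?_⟩⟩
      rw [hl]
      exact ⟨_, _, a.2, ha⟩
  · obtain ⟨hp, hwp, hi, hj, ha, hep⟩ := mem_toFilling.1 hp
    obtain ⟨hq, hwq, hi', hj', ha', heq⟩ := mem_toFilling.1 hq
    rw [lt_iff_letter hp hq (by omega)]
    have hle : letter m p ≤ letter m q :=
      hrow (⟨i, hi⟩, ⟨i + c, hj⟩) (⟨i, hi'⟩, ⟨i + (c + 1), hj'⟩) rfl rfl _ hep _ heq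
    rcases hle.lt_or_eq with h | h
    · exact Or.inl h
    · refine Or.inr ⟨h, ?_⟩
      by_contra ho
      refine hrow' (⟨i, hi⟩, ⟨i + c, hj⟩) (⟨i, hi'⟩, ⟨i + (c + 1), hj'⟩) rfl (fun h => ?_) _ hep
        (by simp only; omega) ?_
      · simp only [Fin.mk.injEq] at h; omega
      · simpa only [h] using heq
  · obtain ⟨hp, hwp, hi, hj, ha, hep⟩ := mem_toFilling.1 hp
    obtain ⟨hq, hwq, hi', hj', ha', heq⟩ := mem_toFilling.1 hq
    have hij : i + 1 + c = i + (c + 1) := by ring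
    simp only [hij] at heq
    rw [lt_iff_letter' hq hp (by omega)]
    have hle : letter m p ≤ letter m q := hcol (⟨i, hi⟩, ⟨i + (c + 1), hj⟩)
      (⟨i + 1, hi'⟩, ⟨i + (c + 1), by omega⟩) rfl rfl _ hep _ heq
    rcases hle.lt_or_eq with h | h
    · exact Or.inl h
    · refine Or.inr ⟨h, ?_⟩
      by_contra ho
      refine hcol' (⟨i, hi⟩, ⟨i + (c + 1), hj⟩) (⟨i + 1, hi'⟩, ⟨i + (c + 1), by omega⟩) rfl
        (fun h => ?_) _ hep (by simp only; omega) ?_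
      · simp only [Fin.mk.injEq] at h; omega
      · simpa only [h] using heq

theorem toTableau_toFilling (hT : IsSSVTPStair (m + 1) n T) :
    toTableau m n (toFilling m T) = T := by
  funext ⟨i, j⟩
  ext a
  rw [mem_toTableau]
  constructor
  · rintro ⟨hij, p, hp, hl⟩
    have := (mem_toFilling.1 hp).2.2
    simp only at hij
    rwa [Nat.add_sub_cancel' hij, hl, hasEntry_val] at this
  · intro ha
    obtain ⟨hij, hj⟩ := (hasEntry_val.2 ha).box hT
    obtain ⟨p, hp, hl, hw⟩ := exists_letter (m := m) (c := j - i) a.2 (by omega) (by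
        rcases Nat.eq_zero_or_pos (j.val - i.val) with hc | hc
        · exact Or.inl (hT.2.2.2.2.2.2 (i, j) (Fin.ext (by simp only; omega)) a ha)
        · exact Or.inr hc)
    refine ⟨hij, p, mem_toFilling.2 ⟨hp, hw, ?_⟩, hl⟩
    rw [hl, Nat.add_sub_cancel' hij]
    exact hasEntry_val.2 ha

variable {F : ℕ → ℕ → Finset ℕ}

theorem IsFilling.letter_row
    (hF : IsFilling (word m) (n * (2 * m - 1)) (Finset.range m) F) (c i d : ℕ) {p q : ℕ}
    (hp : p ∈ F c i) (hq : q ∈ F (c + d + 1) i) :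
    letter m p < letter m q ∨ (letter m p = letter m q ∧ letter m p % 2 = 1) := by
  induction d generalizing q with
  | zero =>
    exact (lt_iff_letter (hF.lt hp) (hF.lt hq)
      (by rw [hF.content hp, hF.content hq])).1 (hF.row hp hq)
  | succ d ih =>
    have h1 := (hF.nonempty_iff _ _).1 ⟨q, hq⟩
    rw [cnt_range] at h1
    obtain ⟨r, hr⟩ := (hF.nonempty_iff (c + d + 1) i).2 (by rw [cnt_range]; omega)
    have h2 := ih hr
    have h3 := (lt_iff_letter (hF.lt hr) (hF.lt hq)
      (by rw [hF.content hr, hF.content hq]; rfl)).1 (hF.row hr hq)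
    omega

theorem IsFilling.letter_col
    (hF : IsFilling (word m) (n * (2 * m - 1)) (Finset.range m) F) (c i d : ℕ) {p q : ℕ}
    (hp : p ∈ F (c + d + 1) i) (hq : q ∈ F c (i + d + 1)) :
    letter m p < letter m q ∨ (letter m p = letter m q ∧ letter m p % 2 = 0) := by
  induction d generalizing c q with
  | zero =>
    exact (lt_iff_letter' (hF.lt hq) (hF.lt hp)
      (by rw [hF.content hp, hF.content hq])).1 (hF.col hp hq)
  | succ d ih =>
    have h1 := (hF.nonempty_iff _ _).1 ⟨p, hp⟩
    rw [cnt_range] at h1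
    obtain ⟨r, hr⟩ := (hF.nonempty_iff (c + 1) (i + d + 1)).2 (by rw [cnt_range]; omega)
    have h2 := ih (c + 1) (by rwa [show c + 1 + d + 1 = c + (d + 1) + 1 by ring]) hr
    have h3 := (lt_iff_letter' (hF.lt hq) (hF.lt hr)
      (by rw [hF.content hr, hF.content hq])).1 (hF.col hr hq)
    omega

theorem isSSVTPStair_toTableau
    (hF : IsFilling (word m) (n * (2 * m - 1)) (Finset.range m) F) :
    IsSSVTPStair (m + 1) n (toTableau m n F) := by
  have row : ∀ {p q : Fin (m + 1) × Fin (m + 1)} {a b : Fin (2 * n)}, q.1 = p.1 →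
      p.2.val < q.2.val → a ∈ toTableau m n F p → b ∈ toTableau m n F q →
      a.val < b.val ∨ (a.val = b.val ∧ a.val % 2 = 1) := by
    rintro ⟨i, j⟩ ⟨i', j'⟩ a b h hlt ha hb
    obtain ⟨hij, x, hx, hxa⟩ := mem_toTableau.1 ha
    obtain ⟨hij', y, hy, hyb⟩ := mem_toTableau.1 hb
    simp only at h hlt hij hij' hx hy
    subst h
    rw [← hxa, ← hyb]
    refine hF.letter_row (j - i') i' (j' - j - 1) hx ?_
    rwa [show j.val - i' + (j' - j - 1) + 1 = j' - i' by omega]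
  have col : ∀ {p q : Fin (m + 1) × Fin (m + 1)} {a b : Fin (2 * n)}, q.2 = p.2 →
      p.1.val < q.1.val → a ∈ toTableau m n F p → b ∈ toTableau m n F q →
      a.val < b.val ∨ (a.val = b.val ∧ a.val % 2 = 0) := by
    rintro ⟨i, j⟩ ⟨i', j'⟩ a b h hlt ha hb
    obtain ⟨hij, x, hx, hxa⟩ := mem_toTableau.1 ha
    obtain ⟨hij', y, hy, hyb⟩ := mem_toTableau.1 hb
    simp only at h hlt hij hij' hx hy
    subst h
    rw [← hxa, ← hyb]
    refine hF.letter_col (j' - i') i (i' - i - 1) ?_ ?_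
    · rwa [show j'.val - i' + (i' - i - 1) + 1 = j' - i by omega]
    · rwa [show i.val + (i' - i - 1) + 1 = i' by omega]
  refine ⟨fun q hq => ?_, fun q hq => ?_, fun p q h h' a ha b hb => ?_,
    fun p q h h' a ha b hb => ?_, fun p q h h' a ha ho ha' => ?_,
    fun p q h h' a ha ho ha' => ?_, fun q hq a ha => ?_⟩
  · have := hq.1
    have := hq.2
    obtain ⟨p, hp⟩ := (hF.nonempty_iff (q.2 - q.1) q.1).2 (by rw [cnt_range]; omega)
    exact ⟨⟨letter m p, letter_lt (hF.lt hp)⟩, mem_toTableau.2 ⟨hq.1, p, hp, rfl⟩⟩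
  · refine Finset.eq_empty_of_forall_notMem fun a ha => hq ?_
    obtain ⟨h, p, hp, -⟩ := mem_toTableau.1 ha
    have := (hF.nonempty_iff _ _).1 ⟨p, hp⟩
    rw [cnt_range] at this
    exact ⟨h, by omega⟩
  · have := row h (by omega) ha hb
    exact Fin.le_def.2 (by omega)
  · have := col h' (by omega) ha hb
    exact Fin.le_def.2 (by omega)
  · rcases lt_trichotomy p.1.val q.1.val with hlt | he | hlt
    · have := col h.symm hlt ha ha'
      omega
    · exact h' (Fin.ext he)
    · have := col h hlt ha' ha
      omega
  · rcases lt_trichotomy p.2.val q.2.val with hlt | he | hlt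
    · have := row h.symm hlt ha ha'
      omega
    · exact h' (Fin.ext he)
    · have := row h hlt ha' ha
      omega
  · obtain ⟨-, p, hp, hl⟩ := mem_toTableau.1 ha
    rw [← hl]
    refine letter_odd (hF.lt hp) ?_
    rw [hF.content hp, hq, Nat.sub_self]

theorem toFilling_toTableau
    (hF : IsFilling (word m) (n * (2 * m - 1)) (Finset.range m) F) :
    toFilling m (toTableau m n F) = F := by
  funext c i
  ext p
  rw [mem_toFilling]
  constructor
  · rintro ⟨hp, hw, hi, hj, ha, h⟩
    obtain ⟨-, q, hq, hl⟩ := mem_toTableau.1 h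
    simp only [Nat.add_sub_cancel_left] at hq hl
    rwa [letter_injOn hp (hF.lt hq) (by rw [hw, hF.content hq]) hl.symm]
  · intro hp
    have h := (hF.nonempty_iff _ _).1 ⟨p, hp⟩
    rw [cnt_range] at h
    refine ⟨hF.lt hp, hF.content hp, by omega, by omega, letter_lt (hF.lt hp), ?_⟩
    refine mem_toTableau.2 ⟨by simp, p, ?_, rfl⟩
    simpa using hp

theorem card_toTableau
    (hF : IsFilling (word m) (n * (2 * m - 1)) (Finset.range m) F)
    (q : Fin (m + 1) × Fin (m + 1)) :
    (toTableau m n F q).card =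
      if q.1.val ≤ q.2.val then (F (q.2 - q.1) q.1).card else 0 := by
  split_ifs with hq
  · symm
    refine Finset.card_bij (fun p hp => ⟨letter m p, letter_lt (hF.lt hp)⟩)
      (fun p hp => mem_toTableau.2 ⟨hq, p, hp, rfl⟩) (fun p hp p' hp' h => ?_) fun a ha => ?_
    · exact letter_injOn (hF.lt hp) (hF.lt hp') (by rw [hF.content hp, hF.content hp'])
        (Fin.mk.inj h)
    · obtain ⟨-, p, hp, hl⟩ := mem_toTableau.1 ha
      exact ⟨p, hp, Fin.ext hl⟩
  · rw [Finset.card_eq_zero]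
    exact Finset.eq_empty_of_forall_notMem fun a ha => hq (mem_toTableau.1 ha).1

theorem sum_card_toTableau
    (hF : IsFilling (word m) (n * (2 * m - 1)) (Finset.range m) F) :
    ∑ q, (toTableau m n F q).card = excess (m + 1) F + (m + 1) * m / 2 := by
  have hzero : ∀ {c i}, m ≤ i + c → (F c i).card = 0 := fun {c i} h => by
    rw [Finset.card_eq_zero, ← Finset.not_nonempty_iff_eq_empty, hF.nonempty_iff, cnt_range]
    omega
  have hrow : ∀ i < m + 1, ∑ j ∈ Finset.range (m + 1),
      (if i ≤ j then (F (j - i) i).card else 0) = ∑ c ∈ Finset.range (m + 1), (F c i).card := by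
    intro i hi
    obtain ⟨l, hl⟩ := Nat.exists_eq_add_of_lt hi
    rw [show m + 1 = i + (l + 1) by omega, Finset.sum_range_add,
      Finset.sum_eq_zero fun j hj => if_neg (by rw [Finset.mem_range] at hj; omega), zero_add]
    simp only [Nat.le_add_right, if_true, Nat.add_sub_cancel_left]
    refine Finset.sum_subset (fun c => by simp only [Finset.mem_range]; omega) fun c _ hc => ?_
    exact hzero (by rw [Finset.mem_range] at hc; omega)
  have hboxes : ∑ c ∈ Finset.range (m + 1), ∑ i ∈ Finset.range (m + 1),
      (if i < m - c then 1 else 0) = (m + 1) * m / 2 := by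
    have : ∀ c, ∑ i ∈ Finset.range (m + 1), (if i < m - c then 1 else 0) = m - c := fun c => by
      rw [← Finset.card_filter,
        show ((Finset.range (m + 1)).filter fun i => i < m - c) = Finset.range (m - c) by
          ext i; simp only [Finset.mem_filter, Finset.mem_range]; omega, Finset.card_range]
    rw [Finset.sum_congr rfl fun c _ => this c]
    have h := Finset.sum_range_reflect (fun c => c) (m + 1)
    simp only [Nat.add_sub_cancel] at h
    rw [h, Finset.sum_range_id, Nat.add_sub_cancel]
  rw [Finset.sum_congr rfl fun q _ => card_toTableau hF q, Fintype.sum_prod_type,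
    ← hboxes, excess, Finset.sum_product, ← Finset.sum_add_distrib]
  simp only [← Finset.sum_add_distrib]
  have h1 := Fin.sum_univ_eq_sum_range (fun i => ∑ j : Fin (m + 1),
    (if i ≤ j.val then (F (j.val - i) i).card else 0)) (m + 1)
  rw [h1, Finset.sum_comm (s := Finset.range (m + 1)) (t := Finset.range (m + 1))]
  refine Finset.sum_congr rfl fun i hi => ?_
  rw [Fin.sum_univ_eq_sum_range (fun j => if i ≤ j then (F (j - i) i).card else 0) (m + 1),
    hrow i (Finset.mem_range.1 hi)]
  refine Finset.sum_congr rfl fun c _ => ?_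
  split_ifs with h
  · have := ((hF.nonempty_iff c i).2 (by rwa [cnt_range])).card_pos
    omega
  · rw [hzero (by omega)]

end

theorem GPspecStair_succ (m n : ℕ) (b : ℚ) :
    GPspecStair (m + 1) n b = stair b m (List.replicate n 1) := by
  classical
  rw [GPspecStair, finsum_eq_sum_of_fintype, stair, ← wordVec_word,
    ← sum_fillings b (word m) (K := m + 1) _ (Finset.range_mono (Nat.le_succ m))]
  refine Finset.sum_bij' (fun T _ => toFilling m T.1)
    (fun F hF => ⟨toTableau m n F, isSSVTPStair_toTableau (mem_fillings.1 hF)⟩)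
    (fun T _ => mem_fillings.2 (isFilling_toFilling T.2)) (fun F _ => Finset.mem_univ _)
    (fun T _ => Subtype.ext (toTableau_toFilling T.2))
    (fun F hF => toFilling_toTableau (mem_fillings.1 hF)) fun T _ => ?_
  have := sum_card_toTableau (isFilling_toFilling T.2)
  rw [toTableau_toFilling T.2] at this
  rw [this, Nat.add_sub_cancel, Nat.add_sub_cancel]

end ShiftedStair

/-- For `1 ≤ k ≤ n` and every `β ∈ ℚ`, the specialized K-theoretic Schur P-functions of
adjacent shifted staircase shapes satisfy
`(2k)! · GP_{δ̃_{k+1}}(1,…,1|β) · F^{(n)}_{δ_k}(-β)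
  = 2^k k! (∏_{j=0}^{k-1} (n-k+1+2j)) · GP_{δ̃_k}(1,…,1|β) · F^{(n)}_{δ_{k+1}}(-β)`,
where the scalar ratio equals `(2^{2k}(k!)²/(2k)!) · P_k^{(α,β')}(-1)` with
`α = (n-k-1)/2`, `β' = (-n-k-1)/2`. -/
theorem ktheoretic_schurP_staircase_recurrence (k n : ℕ) (hk : 1 ≤ k) (hkn : k ≤ n)
    (b : ℚ) :
    ((Nat.factorial (2 * k) : ℚ) * GPspecStair (k + 1) n b * holmanF n (fun i => k - i) (-b)
        = 2 ^ k * (Nat.factorial k : ℚ) *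
            (∏ j ∈ Finset.range k, ((n : ℚ) - k + 1 + 2 * j)) *
            GPspecStair k n b * holmanF n (fun i => k + 1 - i) (-b)) ∧
      (2 ^ k * (Nat.factorial k : ℚ) *
            (∏ j ∈ Finset.range k, ((n : ℚ) - k + 1 + 2 * j)) / (Nat.factorial (2 * k) : ℚ)
        = 2 ^ (2 * k) * (Nat.factorial k : ℚ) ^ 2 / (Nat.factorial (2 * k) : ℚ) *
            jacobiP k (((n : ℚ) - k - 1) / 2) ((-(n : ℚ) - k - 1) / 2) (-1)) := by
  obtain ⟨m, rfl⟩ := Nat.exists_eq_add_of_le' hk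
  constructor
  · rw [ShiftedStair.GPspecStair_succ, ShiftedStair.GPspecStair_succ,
      ShiftedStair.stair_recurrence b (Nat.lt_of_succ_le hkn)]
    push_cast
    ring
  · rw [← ShiftedStair.jacobiP_neg_one]
    ring
end

section
/- Let k ≥ 1 and n ≥ k−1 be integers. Then the number |SSVT_P(δ̃_k, n)| of shifted set-valued semistandard tableaux of shifted staircase shape δ̃_k = (k−1, k−2, …, 1) with entries in the alphabet {1′, 1, …, n′, n} is divisible by 3^{C(k−1, 2)}, where C(k−1, 2) = (k−1)(k−2)/2 is the number of strictly off-diagonal boxes of the shifted staircase. -/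
/-- The diagonal-height function `h` has a removable corner on diagonal `c`. -/
def HasCorner (h : ℕ → ℕ) (c : ℕ) : Prop :=
  h c = h (c + 1) + 1 ∧ (c = 0 ∨ h (c - 1) = h c)

instance (h : ℕ → ℕ) (c : ℕ) : Decidable (HasCorner h c) := by
  unfold HasCorner; infer_instance

/-- Remove the last box on diagonal `c`. -/
def removeBox (h : ℕ → ℕ) (c : ℕ) : ℕ → ℕ := Function.update h c (h c - 1)

/-- The idempotent operator adding a box on diagonal `c`. -/
def boxOp (R : Type*) [CommRing R] (c : ℕ) : Module.End R ((ℕ → ℕ) → R) where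
  toFun v h := if HasCorner h c then v h + v (removeBox h c) else 0
  map_add' v w := by
    ext h; dsimp; split_ifs <;> ring
  map_smul' r v := by
    ext h; dsimp; split_ifs <;> ring

section
variable {R : Type*} [CommRing R]

theorem boxOp_apply (c : ℕ) (v : (ℕ → ℕ) → R) (h : ℕ → ℕ) :
    boxOp R c v h = if HasCorner h c then v h + v (removeBox h c) else 0 := rfl

theorem boxOp_mul_self (c : ℕ) : boxOp R c * boxOp R c = boxOp R c := by
  ext v h
  simp only [Module.End.mul_apply, boxOp_apply]
  have : HasCorner h c → ¬ HasCorner (removeBox h c) c := by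
    simp only [HasCorner, removeBox, Function.update_apply]
    grind
  grind

theorem boxOp_comm {c d : ℕ} (hcd : c + 2 ≤ d) : Commute (boxOp R c) (boxOp R d) := by
  ext v h
  simp only [Module.End.mul_apply, boxOp_apply]
  have h1 : HasCorner (removeBox h c) d ↔ HasCorner h d := by
    simp only [HasCorner, removeBox, Function.update_apply]
    grind
  have h2 : HasCorner (removeBox h d) c ↔ HasCorner h c := by
    simp only [HasCorner, removeBox, Function.update_apply]
    grind
  have h3 : removeBox (removeBox h d) c = removeBox (removeBox h c) d := by
    ext x
    simp only [removeBox, Function.update_apply]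
    grind
  simp only [h1, h2, h3]
  split_ifs <;> ring

theorem boxOp_braid_up (c : ℕ) : boxOp R (c + 1) * (boxOp R c * boxOp R (c + 1)) = 0 := by
  ext v h
  simp only [Module.End.mul_apply, boxOp_apply]
  have h1 : HasCorner h (c + 1) → ¬ HasCorner h c := by
    simp only [HasCorner]
    grind
  have h2 : HasCorner h (c + 1) → ¬ HasCorner (removeBox h (c + 1)) (c + 1) := by
    simp only [HasCorner, removeBox, Function.update_apply]
    grind
  have h3 : HasCorner h (c + 1) → HasCorner (removeBox h (c + 1)) c →
      ¬ HasCorner (removeBox (removeBox h (c + 1)) c) (c + 1) := by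
    simp only [HasCorner, removeBox, Function.update_apply]
    grind
  simp only [LinearMap.zero_apply, Pi.zero_apply]
  grind

theorem boxOp_braid_down {c : ℕ} (hc : c ≠ 0) :
    boxOp R c * (boxOp R (c + 1) * boxOp R c) = 0 := by
  ext v h
  simp only [Module.End.mul_apply, boxOp_apply]
  have h1 : HasCorner h c → ¬ HasCorner h (c + 1) := by
    simp only [HasCorner]
    grind
  have h2 : HasCorner h c → ¬ HasCorner (removeBox h c) c := by
    simp only [HasCorner, removeBox, Function.update_apply]
    grind
  have h3 : HasCorner h c → HasCorner (removeBox h c) (c + 1) →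
      ¬ HasCorner (removeBox (removeBox h c) (c + 1)) c := by
    simp only [HasCorner, removeBox, Function.update_apply]
    grind
  simp only [LinearMap.zero_apply, Pi.zero_apply]
  grind

end

section YangBaxter
variable {R E : Type*} [CommRing R] [Ring E] [Algebra R E]

/-- The linear factor `(x - 1) + 2u`. -/
def linFactor (u : E) (x : R) : E := (x - 1) • (1 : E) + (2 : R) • u

theorem linFactor_mul {u : E} (hu : u * u = u) (x y : R) :
    linFactor u x * linFactor u y = ((x - 1) * (y - 1)) • (1 : E) + (2 * (x + y)) • u := by
  simp only [linFactor, mul_add, add_mul, smul_mul_assoc, mul_smul_comm, mul_one, one_mul, hu]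
  module

theorem linFactor_comm {u : E} (x y : R) :
    Commute (linFactor u x) (linFactor u y) := by
  simp only [Commute, SemiconjBy, linFactor, mul_add, add_mul, smul_mul_assoc, mul_smul_comm,
    mul_one, one_mul]
  module

theorem linFactor_mul_neg {u : E} (hu : u * u = u) (x : R) :
    linFactor u x * linFactor u (-x) = (1 - x ^ 2) • (1 : E) := by
  rw [linFactor_mul hu]
  module

theorem linFactor_yangBaxter {u w : E} (hu : u * u = u) (hw : w * w = w)
    (huw : u * (w * u) = 0) (hwu : w * (u * w) = 0) (x y : R) :
    linFactor u x * (linFactor w x * linFactor w y) * linFactor u y =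
      linFactor w y * (linFactor u x * linFactor u y) * linFactor w x := by
  rw [linFactor_mul hu, linFactor_mul hw]
  simp only [linFactor, mul_add, add_mul, smul_mul_assoc, mul_smul_comm, mul_one, one_mul, hu, hw,
    mul_assoc, huw, hwu]
  module

theorem linFactor_reflection {u w : E} (hu : u * u = u) (hw : w * w = w)
    (hwu : w * (u * w) = 0) (x y : R) :
    linFactor w x * linFactor w (-y) * linFactor u x * (linFactor w x * linFactor w y) *
        linFactor u y =
      linFactor u y * (linFactor w x * linFactor w y) * linFactor u x *
        (linFactor w x * linFactor w (-y)) := by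
  rw [linFactor_mul hw, linFactor_mul hw]
  simp only [linFactor, mul_add, add_mul, smul_mul_assoc, mul_smul_comm, mul_one, one_mul, hu, hw,
    mul_assoc, hwu, smul_zero, mul_zero, add_zero]
  module

theorem linFactor_yangBaxter_neg {u w : E} (hu : u * u = u) (hw : w * w = w)
    (huw : u * (w * u) = 0) (hwu : w * (u * w) = 0) (x y : R) :
    linFactor w x * linFactor w (-y) * linFactor u x * linFactor w y =
      linFactor u y * linFactor w x * (linFactor u x * linFactor u (-y)) := by
  rw [linFactor_mul hu, linFactor_mul hw]
  simp only [linFactor, mul_add, add_mul, smul_mul_assoc, mul_smul_comm, mul_one, one_mul, hu, hw,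
    mul_assoc, huw, hwu]
  module

/-- The relations of the operators `boxOp` used for the Yang-Baxter calculus. -/
structure BoxRelations (u : ℕ → E) : Prop where
  idem : ∀ c, u c * u c = u c
  comm : ∀ c d, c + 2 ≤ d → Commute (u c) (u d)
  up : ∀ c, u (c + 1) * (u c * u (c + 1)) = 0
  down : ∀ c, c ≠ 0 → u c * (u (c + 1) * u c) = 0

/-- The palindromic product `(u_m) ⋯ (u_1) (u_0) (u_1) ⋯ (u_m)` of linear factors. -/
def palindrome (u : ℕ → E) (x : R) : ℕ → E
  | 0 => linFactor (u 0) x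
  | m + 1 => linFactor (u (m + 1)) x * palindrome u x m * linFactor (u (m + 1)) x

namespace BoxRelations
variable {u : ℕ → E}

theorem palindrome_comm_linFactor (H : BoxRelations u) (x y : R) {m d : ℕ} (hd : m + 2 ≤ d) :
    Commute (palindrome u x m) (linFactor (u d) y) := by
  have key (c : ℕ) (hc : c + 2 ≤ d) : Commute (linFactor (u c) x) (linFactor (u d) y) := by
    have := H.comm c d hc
    unfold linFactor
    exact (((Commute.one_left _).smul_left _).add_left
      ((((Commute.one_right _).smul_right _).add_right (this.smul_right _)).smul_left _))
  induction m with
  | zero => exact key 0 hd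
  | succ m ih =>
    exact ((key _ hd).mul_left (ih (by omega))).mul_left (key _ hd)

theorem palindrome_mul_neg (H : BoxRelations u) (x : R) (m : ℕ) :
    palindrome u x m * palindrome u (-x) m = (1 - x ^ 2) ^ (2 * m + 1) • (1 : E) := by
  induction m with
  | zero => simpa [palindrome] using linFactor_mul_neg (H.idem 0) x
  | succ m ih =>
    have h := linFactor_mul_neg (H.idem (m + 1)) x
    calc palindrome u x (m + 1) * palindrome u (-x) (m + 1)
        = linFactor (u (m + 1)) x * palindrome u x m *
            (linFactor (u (m + 1)) x * linFactor (u (m + 1)) (-x)) *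
            palindrome u (-x) m * linFactor (u (m + 1)) (-x) := by
          simp only [palindrome, mul_assoc]
      _ = (1 - x ^ 2) • (linFactor (u (m + 1)) x * (palindrome u x m *
            palindrome u (-x) m) * linFactor (u (m + 1)) (-x)) := by
          rw [h]
          simp only [mul_smul_comm, smul_mul_assoc, mul_one, mul_assoc]
      _ = _ := by
          rw [ih]
          simp only [mul_smul_comm, smul_mul_assoc, mul_one, h, smul_smul]
          congr 1
          ring

theorem palindrome_reflection (H : BoxRelations u) (x y : R) (m : ℕ) :
    linFactor (u (m + 1)) x * linFactor (u (m + 1)) (-y) * palindrome u x m *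
        (linFactor (u (m + 1)) x * linFactor (u (m + 1)) y) * palindrome u y m =
      palindrome u y m * (linFactor (u (m + 1)) x * linFactor (u (m + 1)) y) *
        palindrome u x m * (linFactor (u (m + 1)) x * linFactor (u (m + 1)) (-y)) := by
  induction m with
  | zero => exact linFactor_reflection (H.idem 0) (H.idem 1) (H.up 0) x y
  | succ m ih =>
    have hA := H.idem (m + 1)
    have hB := H.idem (m + 2)
    have hAB := H.down (m + 1) (by omega)
    have hBA := H.up (m + 1)
    have y1 := linFactor_yangBaxter hA hB hAB hBA x y
    have y2 := linFactor_yangBaxter hA hB hAB hBA y x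
    have y3 := linFactor_yangBaxter_neg hA hB hAB hBA x y
    have y4 := linFactor_yangBaxter_neg hB hA hBA hAB x y
    have cxy := (H.palindrome_comm_linFactor x y (le_refl (m + 2))).eq
    have cyx := (H.palindrome_comm_linFactor y x (le_refl (m + 2))).eq
    have cA := (linFactor_comm (u := u (m + 1)) x y).eq
    have cB := (linFactor_comm (u := u (m + 2)) x y).eq
    simp only [palindrome]
    generalize palindrome u x m = Cx at *
    generalize palindrome u y m = Cy at *
    simp only [Nat.add_assoc, Nat.reduceAdd] at *
    generalize linFactor (u (m + 1)) x = Ax at *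
    generalize linFactor (u (m + 1)) y = Ay at *
    generalize linFactor (u (m + 1)) (-y) = An at *
    generalize linFactor (u (m + 2)) x = Bx at *
    generalize linFactor (u (m + 2)) y = By at *
    generalize linFactor (u (m + 2)) (-y) = Bn at *
    have sub {l r : E} (h : l = r) (p q : E) : p * (l * q) = p * (r * q) := by rw [h]
    calc Bx * Bn * (Ax * Cx * Ax) * (Bx * By) * (Ay * Cy * Ay)
        = Bx * Bn * Ax * Cx * (Ax * (Bx * By) * Ay * (Cy * Ay)) := by simp only [mul_assoc]
      _ = Bx * Bn * Ax * Cx * (By * (Ax * Ay) * Bx * (Cy * Ay)) := sub y1 _ _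
      _ = Bx * Bn * Ax * (Cx * By * ((Ax * Ay) * Bx * (Cy * Ay))) := by simp only [mul_assoc]
      _ = Bx * Bn * Ax * (By * Cx * ((Ax * Ay) * Bx * (Cy * Ay))) := sub cxy _ _
      _ = Bx * Bn * Ax * By * Cx * Ax * Ay * (Bx * Cy * Ay) := by simp only [mul_assoc]
      _ = Bx * Bn * Ax * By * Cx * Ax * Ay * (Cy * Bx * Ay) := sub cyx.symm _ _
      _ = 1 * (Bx * Bn * Ax * By * (Cx * Ax * Ay * Cy * Bx * Ay)) := by
          simp only [mul_assoc, one_mul]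
      _ = 1 * (Ay * Bx * (Ax * An) * (Cx * Ax * Ay * Cy * Bx * Ay)) := sub y3 _ _
      _ = Ay * Bx * (Ax * An * Cx * (Ax * Ay) * Cy * (Bx * Ay)) := by
          simp only [mul_assoc, one_mul]
      _ = Ay * Bx * (Cy * (Ax * Ay) * Cx * (Ax * An) * (Bx * Ay)) := sub ih _ _
      _ = Ay * Bx * Cy * Ax * Ay * Cx * (Ax * An * Bx * Ay * 1) := by
          simp only [mul_assoc, mul_one]
      _ = Ay * Bx * Cy * Ax * Ay * Cx * (By * Ax * (Bx * Bn) * 1) := sub y4 _ _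
      _ = Ay * (Bx * Cy * (Ax * Ay * Cx * By * Ax * Bx * Bn)) := by
          simp only [mul_assoc, mul_one]
      _ = Ay * (Cy * Bx * (Ax * Ay * Cx * By * Ax * Bx * Bn)) := sub cyx.symm _ _
      _ = Ay * Cy * Bx * Ax * Ay * (Cx * By * (Ax * Bx * Bn)) := by simp only [mul_assoc]
      _ = Ay * Cy * Bx * Ax * Ay * (By * Cx * (Ax * Bx * Bn)) := sub cxy _ _
      _ = Ay * Cy * Bx * (Ax * Ay * (By * (Cx * (Ax * Bx * Bn)))) := by simp only [mul_assoc]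
      _ = Ay * Cy * Bx * (Ay * Ax * (By * (Cx * (Ax * Bx * Bn)))) := sub cA _ _
      _ = Ay * Cy * (Bx * (Ay * Ax) * By * (Cx * (Ax * Bx * Bn))) := by simp only [mul_assoc]
      _ = Ay * Cy * (Ay * (By * Bx) * Ax * (Cx * (Ax * Bx * Bn))) := sub y2.symm _ _
      _ = Ay * Cy * Ay * (By * Bx * (Ax * (Cx * (Ax * Bx * Bn)))) := by simp only [mul_assoc]
      _ = Ay * Cy * Ay * (Bx * By * (Ax * (Cx * (Ax * Bx * Bn)))) := sub cB.symm _ _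
      _ = _ := by simp only [mul_assoc]

theorem palindrome_comm (H : BoxRelations u) {y : R} (hy : IsSMulRegular E (1 - y ^ 2))
    (x : R) (m : ℕ) : Commute (palindrome u x m) (palindrome u y m) := by
  cases m with
  | zero => exact linFactor_comm x y
  | succ m =>
    have hr := H.palindrome_reflection x y m
    have hn := linFactor_mul_neg (H.idem (m + 1)) y
    have cA := (linFactor_comm (u := u (m + 1)) x y).eq
    have cN := (linFactor_comm (u := u (m + 1)) y (-y)).eq
    apply hy
    simp only [palindrome]
    generalize palindrome u x m = Cx at *
    generalize palindrome u y m = Cy at *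
    generalize linFactor (u (m + 1)) x = Ax at *
    generalize linFactor (u (m + 1)) y = Ay at *
    generalize linFactor (u (m + 1)) (-y) = An at *
    have sub {l r : E} (h : l = r) (p q : E) : p * (l * q) = p * (r * q) := by rw [h]
    calc (1 - y ^ 2) • (Ax * Cx * Ax * (Ay * Cy * Ay))
        = Ax * (((1 - y ^ 2) • (1 : E)) * (Cx * Ax * (Ay * Cy * Ay))) := by
          simp only [mul_assoc, one_mul, smul_mul_assoc, mul_smul_comm]
      _ = Ax * (Ay * An * (Cx * Ax * (Ay * Cy * Ay))) := sub hn.symm _ _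
      _ = 1 * (Ax * Ay * (An * Cx * Ax * (Ay * Cy * Ay))) := by simp only [mul_assoc, one_mul]
      _ = 1 * (Ay * Ax * (An * Cx * Ax * (Ay * Cy * Ay))) := sub cA _ _
      _ = Ay * (Ax * An * Cx * (Ax * Ay) * Cy * Ay) := by simp only [mul_assoc, one_mul]
      _ = Ay * (Cy * (Ax * Ay) * Cx * (Ax * An) * Ay) := sub hr _ _
      _ = Ay * Cy * (Ax * Ay * (Cx * Ax * An * Ay)) := by simp only [mul_assoc]
      _ = Ay * Cy * (Ay * Ax * (Cx * Ax * An * Ay)) := sub cA _ _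
      _ = Ay * Cy * Ay * Ax * Cx * Ax * (An * Ay * 1) := by simp only [mul_assoc, mul_one]
      _ = Ay * Cy * Ay * Ax * Cx * Ax * (((1 - y ^ 2) • (1 : E)) * 1) :=
          sub (cN.symm.trans hn) _ _
      _ = _ := by simp only [mul_assoc, mul_one, mul_smul_comm]

end BoxRelations

end YangBaxter

theorem boxRelations_boxOp (R : Type*) [CommRing R] : BoxRelations (boxOp R) where
  idem := boxOp_mul_self
  comm _ _ := boxOp_comm
  up := boxOp_braid_up
  down _ := boxOp_braid_down

/-- The indicator of the empty shape. -/
noncomputable def emptyShape (R : Type*) [CommRing R] : (ℕ → ℕ) → R := Set.indicator {0} 1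

/-- The diagonal heights of the shifted staircase with `m` rows. -/
def stairHeight (m : ℕ) : ℕ → ℕ := fun c => m - c

/-- The staircase coefficient of a product of palindromes applied to the empty shape. -/
noncomputable def stairCoeff {R : Type*} [CommRing R] (m : ℕ) (xs : List R) : R :=
  (xs.map fun x => palindrome (boxOp R) x m).prod (emptyShape R) (stairHeight (m + 1))

section StairCoeff
variable {R S : Type*} [CommRing R] [CommRing S]

theorem linFactor_boxOp_apply (c : ℕ) (x : R) (v : (ℕ → ℕ) → R) (h : ℕ → ℕ) :
    linFactor (boxOp R c) x v h = (x - 1) * v h + 2 * boxOp R c v h := by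
  simp [linFactor]

theorem map_linFactor_boxOp (φ : R →+* S) (c : ℕ) (x : R) (v : (ℕ → ℕ) → R) :
    φ ∘ (linFactor (boxOp R c) x v) = linFactor (boxOp S c) (φ x) (φ ∘ v) := by
  ext h
  simp only [Function.comp_apply, linFactor_boxOp_apply, boxOp_apply]
  split_ifs <;> simp [map_ofNat]

theorem map_palindrome_boxOp (φ : R →+* S) (m : ℕ) (x : R) (v : (ℕ → ℕ) → R) :
    φ ∘ (palindrome (boxOp R) x m v) = palindrome (boxOp S) (φ x) m (φ ∘ v) := by
  induction m generalizing v with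
  | zero => exact map_linFactor_boxOp φ 0 x v
  | succ m ih => simp only [palindrome, Module.End.mul_apply, map_linFactor_boxOp, ih]

theorem map_stairCoeff (φ : R →+* S) (m : ℕ) (xs : List R) :
    φ (stairCoeff m xs) = stairCoeff m (xs.map φ) := by
  have h0 : φ ∘ emptyShape R = emptyShape S := by
    ext h
    by_cases hh : h = 0 <;> simp [emptyShape, hh]
  have key : φ ∘ (xs.map fun x => palindrome (boxOp R) x m).prod (emptyShape R) =
      ((xs.map φ).map fun x => palindrome (boxOp S) x m).prod (emptyShape S) := by
    induction xs with
    | nil => simpa using h0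
    | cons x xs ih =>
      simp only [List.map_cons, List.prod_cons, Module.End.mul_apply, map_palindrome_boxOp, ih]
  exact congrFun key _

theorem linFactor_boxOp_apply_eq_zero {c s t : ℕ} (hst : if c = 0 then s + 1 ≤ t else s ≤ t)
    (x : R) {v : (ℕ → ℕ) → R} (hv : ∀ h : ℕ → ℕ, s < h 0 → v h = 0) (h : ℕ → ℕ) (hh : t < h 0) :
    linFactor (boxOp R c) x v h = 0 := by
  have h1 : s < h 0 := by split_ifs at hst <;> omega
  have h2 : s < removeBox h c 0 := by
    simp only [removeBox, Function.update_apply]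
    split_ifs at hst ⊢ <;> first | omega | (subst c; omega)
  simp [linFactor_boxOp_apply, boxOp_apply, hv h h1, hv _ h2]

theorem palindrome_boxOp_apply_eq_zero (m s : ℕ) (x : R) {v : (ℕ → ℕ) → R}
    (hv : ∀ h : ℕ → ℕ, s < h 0 → v h = 0) (h : ℕ → ℕ) (hh : s + 1 < h 0) :
    palindrome (boxOp R) x m v h = 0 := by
  induction m generalizing v h with
  | zero => exact linFactor_boxOp_apply_eq_zero (c := 0) (by simp) x hv h hh
  | succ m ih =>
    simp only [palindrome, Module.End.mul_apply]
    refine linFactor_boxOp_apply_eq_zero (c := m + 1) (s := s + 1) (by simp) x ?_ h hh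
    intro h hh
    refine ih ?_ h hh
    exact linFactor_boxOp_apply_eq_zero (c := m + 1) (s := s) (by simp) x hv

theorem stairCoeff_eq_zero {m : ℕ} {xs : List R} (hxs : xs.length ≤ m) : stairCoeff m xs = 0 := by
  have key (ys : List R) (h : ℕ → ℕ) (hh : ys.length < h 0) :
      (ys.map fun x => palindrome (boxOp R) x m).prod (emptyShape R) h = 0 := by
    induction ys generalizing h with
    | nil =>
      have : h ≠ 0 := by rintro rfl; simp at hh
      simp [emptyShape, this]
    | cons y ys ih =>
      simp only [List.map_cons, List.prod_cons, Module.End.mul_apply]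
      exact palindrome_boxOp_apply_eq_zero m ys.length y ih h (by simpa using hh)
  exact key xs _ (by simp [stairHeight]; omega)

theorem isSMulRegular_end {x : R} (hx : IsSMulRegular R x) :
    IsSMulRegular (Module.End R ((ℕ → ℕ) → R)) x := by
  intro e f hef
  ext v h
  exact hx (congrFun (LinearMap.congr_fun hef v) h)

theorem stairCoeff_perm {m : ℕ} {xs ys : List R} (hp : xs.Perm ys)
    (hreg : ∀ x ∈ xs, IsSMulRegular R (1 - x ^ 2)) : stairCoeff m xs = stairCoeff m ys := by
  unfold stairCoeff
  rw [(hp.map _).prod_eq']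
  rw [List.pairwise_map]
  refine List.Pairwise.imp_of_mem (R := fun _ _ => True) ?_ (List.pairwise_of_forall (by simp))
  intro x y _ hy _
  exact (boxRelations_boxOp R).palindrome_comm (isSMulRegular_end (hreg y hy)) x m

theorem stairCoeff_cancel (m : ℕ) (x : R) (xs : List R) :
    stairCoeff m (x :: -x :: xs) = (1 - x ^ 2) ^ (2 * m + 1) * stairCoeff m xs := by
  simp only [stairCoeff, List.map_cons, List.prod_cons]
  rw [← mul_assoc, (boxRelations_boxOp R).palindrome_mul_neg]
  simp

end StairCoeff

section Vanishing
open MvPolynomial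

variable {σ : Type*}

/-- All terms of degree less than `M` vanish. -/
def VanishesBelow (M : ℕ) (p : MvPolynomial σ ℤ) : Prop :=
  ∀ d < M, homogeneousComponent d p = 0

theorem VanishesBelow.coeff_eq_zero {M : ℕ} {p : MvPolynomial σ ℤ} (hp : VanishesBelow M p)
    (s : σ →₀ ℕ) (hs : s.degree < M) : coeff s p = 0 := by
  have := congrArg (coeff s) (hp _ hs)
  rwa [coeff_homogeneousComponent, if_pos rfl, coeff_zero] at this

theorem VanishesBelow.mul_left {M : ℕ} {p : MvPolynomial σ ℤ} (hp : VanishesBelow M p)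
    (f : MvPolynomial σ ℤ) : VanishesBelow M (f * p) := by
  classical
  intro d hd
  ext s
  rw [coeff_homogeneousComponent, coeff_zero]
  split_ifs with hs
  · rw [coeff_mul]
    refine Finset.sum_eq_zero fun a ha => ?_
    rw [Finset.HasAntidiagonal.mem_antidiagonal] at ha
    have : a.1.degree + a.2.degree = s.degree := by rw [← ha, map_add]
    rw [hp.coeff_eq_zero a.2 (by omega), mul_zero]
  · rfl

theorem homogeneousComponent_aeval {τ : Type*} {g : σ → MvPolynomial τ ℤ}
    (hg : ∀ i, (g i).IsHomogeneous 1) (p : MvPolynomial σ ℤ) (d : ℕ) :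
    homogeneousComponent d (aeval g p) = aeval g (homogeneousComponent d p) := by
  have hh (e : ℕ) : (aeval g (homogeneousComponent e p)).IsHomogeneous e := by
    simpa using (homogeneousComponent_isHomogeneous e p).aeval g hg
  conv_lhs => rw [← sum_homogeneousComponent p, map_sum, map_sum]
  rw [Finset.sum_congr rfl fun e _ => homogeneousComponent_of_mem (hh e)]
  rw [Finset.sum_ite_eq]
  split_ifs with hd
  · rfl
  · rw [homogeneousComponent_eq_zero, map_zero]
    simpa [Nat.lt_succ_iff] using hd

theorem VanishesBelow.aeval {τ : Type*} {M : ℕ} {p : MvPolynomial σ ℤ} (hp : VanishesBelow M p)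
    {g : σ → MvPolynomial τ ℤ} (hg : ∀ i, (g i).IsHomogeneous 1) :
    VanishesBelow M (aeval g p) := fun d hd => by
  rw [homogeneousComponent_aeval hg, hp d hd, map_zero]

theorem VanishesBelow.pow_dvd_aeval {M : ℕ} {p : MvPolynomial σ ℤ} (hp : VanishesBelow M p)
    (a : ℤ) : a ^ M ∣ MvPolynomial.aeval (fun _ : σ => a) p := by
  rw [aeval_def, eval₂_eq]
  refine Finset.dvd_sum fun s _ => ?_
  by_cases hs : s.degree < M
  · rw [hp.coeff_eq_zero s hs]; simp
  · rw [Finset.prod_pow_eq_pow_sum]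
    exact Dvd.dvd.mul_left (pow_dvd_pow a (not_lt.1 hs)) _

theorem X_add_X_dvd [DecidableEq σ] {i j : σ} (hij : i ≠ j) {q : MvPolynomial σ ℤ}
    (hq : aeval (fun k => if k = j then -X i else X k : σ → MvPolynomial σ ℤ) q = 0) :
    X i + X j ∣ q := by
  rw [← Ideal.mem_span_singleton, ← Ideal.Quotient.eq_zero_iff_mem]
  set I : Ideal (MvPolynomial σ ℤ) := Ideal.span {X i + X j}
  have h : (Ideal.Quotient.mkₐ ℤ I).comp
      (aeval (fun k => if k = j then -X i else X k : σ → MvPolynomial σ ℤ)) =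
      Ideal.Quotient.mkₐ ℤ I := by
    ext k
    simp only [AlgHom.comp_apply, aeval_X, Ideal.Quotient.mkₐ_eq_mk]
    split_ifs with hk
    · subst hk
      rw [Ideal.Quotient.eq, ← neg_mem_iff]
      exact Ideal.mem_span_singleton.2 ⟨1, by ring⟩
    · rfl
  have := AlgHom.congr_fun h q
  rw [AlgHom.comp_apply, hq, map_zero] at this
  exact this.symm

theorem irreducible_X_add_X {i j : σ} (hij : i ≠ j) :
    Irreducible (X i + X j : MvPolynomial σ ℤ) := by
  classical
  have hhom : (X i + X j : MvPolynomial σ ℤ).IsHomogeneous 1 :=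
    (isHomogeneous_X _ i).add (isHomogeneous_X _ j)
  have hc : coeff (Finsupp.single i 1) (X i + X j : MvPolynomial σ ℤ) = 1 := by
    simp [coeff_X, Finsupp.single_left_inj, hij.symm]
  refine irreducible_of_totalDegree_eq_one (hhom.totalDegree fun h => ?_) fun x hx => ?_
  · rw [h] at hc; simp at hc
  · exact isUnit_of_dvd_one (hc ▸ hx (Finsupp.single i 1))

theorem not_X_add_X_dvd [DecidableEq σ] {i j k l : σ} (hkl : k ≠ l) (hki : k ≠ i) (hkj : k ≠ j) :
    ¬ (X i + X j : MvPolynomial σ ℤ) ∣ X k + X l := by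
  intro h
  have := map_dvd (aeval (fun x => if x = k then 1 else 0 : σ → ℤ)) h
  simp [hki.symm, hkj.symm, hkl.symm] at this

theorem isHomogeneous_eq_zero_of_vanish {N d : ℕ} (hd : d < N * (N - 1) / 2)
    {q : MvPolynomial ℕ ℤ} (hq : q.IsHomogeneous d)
    (hdvd : ∀ i j, i < j → j < N → X i + X j ∣ q) : q = 0 := by
  by_contra hq0
  let s : Finset (Σ _ : ℕ, ℕ) := (Finset.range N).sigma fun j => Finset.range j
  let g : (Σ _ : ℕ, ℕ) → MvPolynomial ℕ ℤ := fun a => X a.2 + X a.1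
  have hs {a} : a ∈ s ↔ a.1 < N ∧ a.2 < a.1 := by simp [s]
  have hcard : s.card = N * (N - 1) / 2 := by
    simp [s, Finset.card_sigma, Finset.sum_range_id]
  have hprod : ∏ a ∈ s, g a ∣ q := by
    refine Finset.prod_dvd_of_isRelPrime ?_ fun a ha => hdvd _ _ (hs.1 ha).2 (hs.1 ha).1
    rintro ⟨j, i⟩ ha ⟨l, k⟩ hb hab
    have h1 := (hs.1 ha).2
    have h2 := (hs.1 hb).2
    dsimp only at h1 h2
    refine (irreducible_X_add_X h1.ne).isRelPrime_iff_not_dvd.2 ?_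
    by_cases hk : k = i ∨ k = j
    · have hl : l ≠ i ∧ l ≠ j := by
        simp only [ne_eq, Sigma.mk.injEq, heq_eq_eq] at hab
        omega
      dsimp only [g]
      rw [add_comm (X k)]
      exact not_X_add_X_dvd h2.ne' hl.1 hl.2
    · push Not at hk
      exact not_X_add_X_dvd h2.ne hk.1 hk.2
  obtain ⟨r, rfl⟩ := hprod
  have hg0 := left_ne_zero_of_mul hq0
  have hr0 := right_ne_zero_of_mul hq0
  have hgh : (∏ a ∈ s, g a).IsHomogeneous s.card := by
    simpa using IsHomogeneous.prod s g (fun _ => 1)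
      fun a _ => (isHomogeneous_X _ _).add (isHomogeneous_X _ _)
  have := totalDegree_mul_of_isDomain hg0 hr0
  rw [hq.totalDegree hq0, hgh.totalDegree hg0] at this
  omega

theorem isSMulRegular_one_sub_sq {x : MvPolynomial σ ℤ} (hx : x.IsHomogeneous 1) :
    IsSMulRegular (MvPolynomial σ ℤ) (1 - x ^ 2) := by
  have hx0 : constantCoeff x = 0 := hx.coeff_eq_zero (by simp)
  have : 1 - x ^ 2 ≠ 0 := fun h => by
    have := congrArg constantCoeff h
    simp [hx0] at this
  intro a b hab
  exact mul_left_cancel₀ this hab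

theorem vanishesBelow_stairCoeff (m : ℕ) (xs : List (MvPolynomial ℕ ℤ))
    (hxs : ∀ x ∈ xs, x.IsHomogeneous 1) :
    VanishesBelow ((m + 1) * m / 2) (stairCoeff m xs) := by
  induction hN : xs.length using Nat.strong_induction_on generalizing xs with
  | _ N ih =>
  by_cases hm : N ≤ m
  · rw [stairCoeff_eq_zero (hN.trans_le hm)]
    exact fun d _ => map_zero _
  let vars : List (MvPolynomial ℕ ℤ) := (List.range N).map X
  have hvars : VanishesBelow ((m + 1) * m / 2) (stairCoeff m vars) := by
    intro d hd
    refine isHomogeneous_eq_zero_of_vanish (N := N) (hd.trans_le (Nat.div_le_div_right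
      (Nat.mul_le_mul (by omega) (by omega)))) (homogeneousComponent_isHomogeneous d _) ?_
    intro i j hij hj
    refine X_add_X_dvd hij.ne ?_
    set g : ℕ → MvPolynomial ℕ ℤ := fun k => if k = j then -X i else X k with hg
    have hgh (k : ℕ) : (g k).IsHomogeneous 1 := by
      dsimp only [g]
      split_ifs
      · exact (isHomogeneous_X _ i).neg
      · exact isHomogeneous_X _ k
    rw [← homogeneousComponent_aeval hgh]
    have hp : (List.range N).Perm (i :: j :: ((List.range N).erase i).erase j) := by
      have h1 : (List.range N).Perm (i :: (List.range N).erase i) :=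
        List.perm_cons_erase (List.mem_range.2 (by omega))
      refine h1.trans (List.Perm.cons _ (List.perm_cons_erase ?_))
      rw [List.mem_erase_of_ne hij.ne']
      exact List.mem_range.2 hj
    have hlen := hp.length_eq
    generalize ((List.range N).erase i).erase j = rest at hp hlen
    have e1 : aeval g (stairCoeff m vars) = stairCoeff m ((List.range N).map g) := by
      have := map_stairCoeff (aeval g : MvPolynomial ℕ ℤ →ₐ[ℤ] _).toRingHom m vars
      refine this.trans ?_
      simp [vars, Function.comp_def]
    have e2 : stairCoeff m ((List.range N).map g) =
        stairCoeff m (X i :: -X i :: rest.map g) := by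
      rw [stairCoeff_perm (hp.map g)]
      · simp [hg, hij.ne]
      · intro x hx
        obtain ⟨k, _, rfl⟩ := List.mem_map.1 hx
        exact isSMulRegular_one_sub_sq (hgh k)
    rw [e1, e2, stairCoeff_cancel]
    refine VanishesBelow.mul_left (ih rest.length ?_ _ ?_ (by simp)) _ d hd
    · simp at hlen; omega
    · intro x hx
      obtain ⟨k, _, rfl⟩ := List.mem_map.1 hx
      exact hgh k
  have hgh (k : ℕ) : (xs.getD k 0).IsHomogeneous 1 := by
    by_cases hk : k < xs.length
    · rw [List.getD_eq_getElem _ _ hk]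
      exact hxs _ (List.getElem_mem hk)
    · rw [List.getD_eq_default _ _ (not_lt.1 hk)]
      exact isHomogeneous_zero _ _ _
  have := hvars.aeval hgh
  convert this
  have := map_stairCoeff (aeval fun k => xs.getD k 0 : MvPolynomial ℕ ℤ →ₐ[ℤ] _).toRingHom m vars
  refine Eq.trans ?_ this.symm
  congr 1
  refine List.ext_getElem (by simp [vars, hN]) fun k h1 h2 => ?_
  simp [vars, List.getElem?_eq_getElem h1]

theorem three_pow_dvd_stairCoeff (m n : ℕ) :
    (3 : ℤ) ^ ((m + 1) * m / 2) ∣ stairCoeff m (List.replicate n (3 : ℤ)) := by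
  have h := (vanishesBelow_stairCoeff m (List.replicate n (X 0)) fun x hx => by
    rw [List.eq_of_mem_replicate hx]; exact isHomogeneous_X _ 0).pow_dvd_aeval 3
  have e := map_stairCoeff (aeval fun _ => (3 : ℤ) : MvPolynomial ℕ ℤ →ₐ[ℤ] ℤ).toRingHom m
    (List.replicate n (X 0))
  have e' : stairCoeff m (List.replicate n (3 : ℤ)) =
      aeval (fun _ => (3 : ℤ)) (stairCoeff m (List.replicate n (X 0 : MvPolynomial ℕ ℤ))) := by
    refine Eq.trans ?_ e.symm
    simp
  rwa [e']

end Vanishing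

section Tableaux
variable {k L : ℕ}

/-- Shifted set-valued tableaux whose diagonal lengths are given by `h` and in which the letter `a`
may occur on diagonal `c` only if `D a c`. -/
def tableaux (k L : ℕ) (D : ℕ → ℕ → Prop) (h : ℕ → ℕ) :
    Set (Fin k × Fin k → Finset (Fin L)) :=
  {T | (∀ p, (T p).Nonempty ↔ p.1.val ≤ p.2.val ∧ p.1.val < h (p.2.val - p.1.val)) ∧
    (∀ p q : Fin k × Fin k, q.1 = p.1 → (q.2 : ℕ) = (p.2 : ℕ) + 1 →
      ∀ a ∈ T p, ∀ b ∈ T q, a ≤ b) ∧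
    (∀ p q : Fin k × Fin k, (q.1 : ℕ) = (p.1 : ℕ) + 1 → q.2 = p.2 →
      ∀ a ∈ T p, ∀ b ∈ T q, a ≤ b) ∧
    (∀ p q : Fin k × Fin k, p.2 = q.2 → p.1 ≠ q.1 → ∀ a ∈ T p, a.val % 2 = 1 → a ∉ T q) ∧
    (∀ p q : Fin k × Fin k, p.1 = q.1 → p.2 ≠ q.2 → ∀ a ∈ T p, a.val % 2 = 0 → a ∉ T q) ∧
    ∀ p, ∀ a ∈ T p, D a (p.2.val - p.1.val)}

/-- The diagonal lengths of a shifted shape inside the staircase with `k - 1` rows. -/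
def IsShiftedShape (k : ℕ) (h : ℕ → ℕ) : Prop :=
  ∀ c, h (c + 1) ≤ h c ∧ h c ≤ h (c + 1) + 1 ∧ h c ≤ k - 1 - c

theorem IsShiftedShape.removeBox {h : ℕ → ℕ} (hh : IsShiftedShape k h) {c : ℕ}
    (hc : HasCorner h c) : IsShiftedShape k (removeBox h c) := by
  intro d
  have h1 := hh d
  have h2 := hh c
  simp only [_root_.removeBox, HasCorner, Function.update_apply] at *
  obtain ⟨h3, h4⟩ := hc
  by_cases e : d = c
  · subst e
    simp only [if_true, Nat.succ_ne_self, if_false]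
    omega
  · by_cases e' : d + 1 = c
    · subst e'
      simp only [Nat.add_sub_cancel, e, if_true, if_false] at *
      omega
    · simpa [e, e'] using h1

theorem IsShiftedShape.le_add {h : ℕ → ℕ} (hh : IsShiftedShape k h) (c d : ℕ) :
    h c ≤ h (c + d) + d ∧ h (c + d) ≤ h c := by
  induction d with
  | zero => simp
  | succ d ih =>
    have := hh (c + d)
    rw [show c + (d + 1) = c + d + 1 from rfl]
    omega

/-- In the reading order (letters increasing, diagonals increasing for unprimed and decreasing for
primed letters), all occurrences allowed by `D` precede `a` on diagonal `c`. -/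
def Precedes (D : ℕ → ℕ → Prop) (a c : ℕ) : Prop :=
  ∀ b d, D b d → b < a ∨ b = a ∧ (a % 2 = 1 ∧ d < c ∨ a % 2 = 0 ∧ c < d)

/-- Additionally allow the letter `a` on diagonal `c`. -/
def allow (D : ℕ → ℕ → Prop) (a c : ℕ) : ℕ → ℕ → Prop := fun b d => D b d ∨ b = a ∧ d = c

variable {D : ℕ → ℕ → Prop} {h : ℕ → ℕ} {a : Fin L} {c : ℕ}

theorem corner_of_mem (hh : IsShiftedShape k h) (hD : Precedes D a c)
    {T : Fin k × Fin k → Finset (Fin L)} (hT : T ∈ tableaux k L (allow D a c) h)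
    {p : Fin k × Fin k} (hp : p.2.val - p.1.val = c) (ha : a ∈ T p) :
    HasCorner h c ∧ p.1.val + 1 = h c ∧ p.2.val = p.1.val + c := by
  obtain ⟨hne, hrow, hcol, hU, hR, hA⟩ := hT
  obtain ⟨hle, hlt⟩ := (hne p).1 ⟨a, ha⟩
  rw [hp] at hlt
  have hc := hh c
  have hright : ¬ p.1.val < h (c + 1) := by
    intro hlt'
    have hc' := hh (c + 1)
    let q : Fin k × Fin k := (p.1, ⟨p.2.val + 1, by omega⟩)
    have hq : q.2.val - q.1.val = c + 1 := by simp only [q]; omega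
    obtain ⟨x, hx⟩ := (hne q).2 (by rw [hq]; exact ⟨by simp only [q]; omega, hlt'⟩)
    have hax : a.val ≤ x.val := hrow p q rfl rfl a ha x hx
    have hxD := hA q x hx
    rw [hq] at hxD
    obtain hxD | hxD := hxD
    · obtain h1 | ⟨h1, h2⟩ := hD _ _ hxD
      · omega
      · obtain rfl : x = a := Fin.ext h1
        refine hR p q rfl (fun e => ?_) x ha (by omega) hx
        have := congrArg Fin.val e
        simp [q] at this
    · omega
  have hbelow : c = 0 ∨ ¬ p.1.val + 1 < h (c - 1) := by
    by_contra! hcon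
    obtain ⟨hc0, hlt'⟩ := hcon
    have hc' := hh (c - 1)
    let q : Fin k × Fin k := (⟨p.1.val + 1, by omega⟩, p.2)
    have hq : q.2.val - q.1.val = c - 1 := by simp only [q]; omega
    obtain ⟨x, hx⟩ := (hne q).2 (by rw [hq]; exact ⟨by simp only [q]; omega, hlt'⟩)
    have hax : a.val ≤ x.val := hcol p q rfl rfl a ha x hx
    have hxD := hA q x hx
    rw [hq] at hxD
    obtain hxD | hxD := hxD
    · obtain h1 | ⟨h1, h2⟩ := hD _ _ hxD
      · omega
      · obtain rfl : x = a := Fin.ext h1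
        refine hU p q rfl (fun e => ?_) x ha (by omega) hx
        have := congrArg Fin.val e
        simp [q] at this
    · omega
  refine ⟨⟨by omega, ?_⟩, by omega, by omega⟩
  rcases hbelow with h0 | h0
  · exact Or.inl h0
  · by_cases hc0 : c = 0
    · exact Or.inl hc0
    · have := hh (c - 1)
      rw [Nat.sub_add_cancel (by omega)] at this
      omega

theorem tableaux_mono {D' : ℕ → ℕ → Prop} (hDD : ∀ b d, D b d → D' b d) :
    tableaux k L D h ⊆ tableaux k L D' h :=
  fun _ ⟨hne, hrow, hcol, hU, hR, hA⟩ =>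
    ⟨hne, hrow, hcol, hU, hR, fun p a ha => hDD _ _ (hA p a ha)⟩

theorem mem_tableaux_of_forall_notMem {T : Fin k × Fin k → Finset (Fin L)}
    (hT : T ∈ tableaux k L (allow D a c) h)
    (hn : ∀ p : Fin k × Fin k, p.2.val - p.1.val = c → a ∉ T p) : T ∈ tableaux k L D h := by
  obtain ⟨hne, hrow, hcol, hU, hR, hA⟩ := hT
  refine ⟨hne, hrow, hcol, hU, hR, fun p b hb => (hA p b hb).resolve_right ?_⟩
  rintro ⟨h1, h2⟩
  obtain rfl : b = a := Fin.ext h1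
  exact hn p h2 hb

theorem insert_mem_tableaux (hh : IsShiftedShape k h) (hD : Precedes D a c) (hc : HasCorner h c)
    {h' : ℕ → ℕ} (hh' : ∀ i d, ¬ (i + 1 = h c ∧ d = c) → (i < h' d ↔ i < h d))
    {T : Fin k × Fin k → Finset (Fin L)} (hT : T ∈ tableaux k L D h')
    {b : Fin k × Fin k} (hb1 : b.1.val + 1 = h c) (hb2 : b.2.val = b.1.val + c) :
    Function.update T b (insert a (T b)) ∈ tableaux k L (allow D a c) h := by
  obtain ⟨hne, hrow, hcol, hU, hR, hA⟩ := hT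
  have hshape (p : Fin k × Fin k) (hp : p ≠ b) :
      (T p).Nonempty ↔ p.1.val ≤ p.2.val ∧ p.1.val < h (p.2.val - p.1.val) := by
    rw [hne p]
    refine and_congr_right fun hle => hh' _ _ fun ⟨h1, h2⟩ => hp ?_
    exact Prod.ext (Fin.ext (by omega)) (Fin.ext (by omega))
  have hle (p : Fin k × Fin k) (x : Fin L) (hx : x ∈ T p) : x ≤ a := by
    rw [Fin.le_def]
    have := hD _ _ (hA p x hx)
    omega
  have hcolumn (q : Fin k × Fin k) (hq2 : q.2 = b.2) (hq1 : q.1 ≠ b.1) (ha : a.val % 2 = 1) :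
      a ∉ T q := by
    intro haq
    have h1 := hD _ _ (hA q a haq)
    have h2 := (hshape q (fun e => hq1 (by rw [e]))).1 ⟨a, haq⟩
    have h3 := congrArg Fin.val hq2
    have h4 := hh.le_add (q.2.val - q.1.val) (c - 1 - (q.2.val - q.1.val))
    rw [show q.2.val - q.1.val + (c - 1 - (q.2.val - q.1.val)) = c - 1 by omega] at h4
    have := hc.2
    omega
  have hrows (q : Fin k × Fin k) (hq1 : q.1 = b.1) (hq2 : q.2 ≠ b.2) (ha : a.val % 2 = 0) :
      a ∉ T q := by
    intro haq
    have h1 := hD _ _ (hA q a haq)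
    have h2 := (hshape q (fun e => hq2 (by rw [e]))).1 ⟨a, haq⟩
    have h3 := congrArg Fin.val hq1
    have h4 := hh.le_add (c + 1) (q.2.val - q.1.val - (c + 1))
    rw [show c + 1 + (q.2.val - q.1.val - (c + 1)) = q.2.val - q.1.val by omega] at h4
    have := hc.1
    omega
  have hmem (p : Fin k × Fin k) (x : Fin L) :
      x ∈ Function.update T b (insert a (T b)) p ↔ x ∈ T p ∨ x = a ∧ p = b := by
    by_cases hp : p = b
    · subst hp; simp [or_comm]
    · simp [hp]
  refine ⟨fun p => ?_, fun p q h1 h2 x hx y hy => ?_, fun p q h1 h2 x hx y hy => ?_,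
    fun p q h1 h2 x hx hodd hy => ?_, fun p q h1 h2 x hx heven hy => ?_, fun p x hx => ?_⟩
  · by_cases hp : p = b
    · subst hp
      have e : p.2.val - p.1.val = c := by omega
      simp only [Function.update_self, Finset.insert_nonempty, true_iff, e]
      omega
    · rw [Function.update_of_ne hp, hshape p hp]
  · rw [hmem] at hx hy
    have hqb : p = b → q ∉ {q | (T q).Nonempty} := by
      rintro rfl hq
      have h3 := congrArg Fin.val h1
      have h4 := ((hshape q (by rintro rfl; omega)).1 hq).2
      rw [show q.2.val - q.1.val = c + 1 by omega] at h4
      have := hc.1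
      omega
    rcases hy with hy | ⟨rfl, rfl⟩
    · rcases hx with hx | ⟨rfl, rfl⟩
      · exact hrow p q h1 h2 x hx y hy
      · exact absurd ⟨y, hy⟩ (hqb rfl)
    · rcases hx with hx | ⟨rfl, rfl⟩
      · exact hle p x hx
      · exact le_rfl
  · rw [hmem] at hx hy
    have hqb : p = b → q ∉ {q | (T q).Nonempty} := by
      rintro rfl hq
      have h3 := congrArg Fin.val h2
      have h4 := (hshape q (by rintro rfl; omega)).1 hq
      rw [show q.2.val - q.1.val = c - 1 by omega] at h4
      have := hc.2
      omega
    rcases hy with hy | ⟨rfl, rfl⟩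
    · rcases hx with hx | ⟨rfl, rfl⟩
      · exact hcol p q h1 h2 x hx y hy
      · exact absurd ⟨y, hy⟩ (hqb rfl)
    · rcases hx with hx | ⟨rfl, rfl⟩
      · exact hle p x hx
      · exact le_rfl
  · rw [hmem] at hx hy
    rcases hx with hx | ⟨rfl, rfl⟩
    · rcases hy with hy | ⟨rfl, rfl⟩
      · exact hU p q h1 h2 x hx hodd hy
      · exact hcolumn p h1 h2 hodd hx
    · rcases hy with hy | ⟨-, rfl⟩
      · exact hcolumn q h1.symm h2.symm hodd hy
      · exact h2 rfl
  · rw [hmem] at hx hy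
    rcases hx with hx | ⟨rfl, rfl⟩
    · rcases hy with hy | ⟨rfl, rfl⟩
      · exact hR p q h1 h2 x hx heven hy
      · exact hrows p h1 h2 heven hx
    · rcases hy with hy | ⟨-, rfl⟩
      · exact hrows q h1.symm h2.symm heven hy
      · exact h2 rfl
  · rw [hmem] at hx
    rcases hx with hx | ⟨rfl, rfl⟩
    · exact Or.inl (hA p x hx)
    · exact Or.inr ⟨rfl, by omega⟩

theorem erase_mem_tableaux (hh : IsShiftedShape k h) (hD : Precedes D a c)
    {T : Fin k × Fin k → Finset (Fin L)} (hT : T ∈ tableaux k L (allow D a c) h)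
    {b : Fin k × Fin k} (hb : b.2.val - b.1.val = c) (ha : a ∈ T b) :
    Function.update T b ((T b).erase a) ∈
      tableaux k L D h ∪ tableaux k L D (removeBox h c) := by
  obtain ⟨-, hb1, hb2⟩ := corner_of_mem hh hD hT hb ha
  have huniq (p : Fin k × Fin k) (hp : p.2.val - p.1.val = c) (hap : a ∈ T p) : p = b := by
    obtain ⟨-, hp1, hp2⟩ := corner_of_mem hh hD hT hp hap
    exact Prod.ext (Fin.ext (by omega)) (Fin.ext (by omega))
  obtain ⟨hne, hrow, hcol, hU, hR, hA⟩ := hT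
  have hmem (p : Fin k × Fin k) (x : Fin L) :
      x ∈ Function.update T b ((T b).erase a) p ↔ x ∈ T p ∧ ¬ (x = a ∧ p = b) := by
    by_cases hp : p = b
    · subst hp; simp [and_comm]
    · simp [hp]
  have hsub (p : Fin k × Fin k) (x : Fin L)
      (hx : x ∈ Function.update T b ((T b).erase a) p) : x ∈ T p := ((hmem p x).1 hx).1
  have key (h' : ℕ → ℕ) (hs : ∀ p, (Function.update T b ((T b).erase a) p).Nonempty ↔
      p.1.val ≤ p.2.val ∧ p.1.val < h' (p.2.val - p.1.val)) :
      Function.update T b ((T b).erase a) ∈ tableaux k L D h' := by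
    refine ⟨hs, fun p q h1 h2 x hx y hy => hrow p q h1 h2 x (hsub p x hx) y (hsub q y hy),
      fun p q h1 h2 x hx y hy => hcol p q h1 h2 x (hsub p x hx) y (hsub q y hy),
      fun p q h1 h2 x hx hodd hy => hU p q h1 h2 x (hsub p x hx) hodd (hsub q x hy),
      fun p q h1 h2 x hx heven hy => hR p q h1 h2 x (hsub p x hx) heven (hsub q x hy),
      fun p x hx => ?_⟩
    refine (hA p x (hsub p x hx)).resolve_right fun ⟨h1, h2⟩ => ?_
    obtain rfl : x = a := Fin.ext h1
    exact ((hmem p x).1 hx).2 ⟨rfl, huniq p h2 (hsub p x hx)⟩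
  by_cases hemp : ((T b).erase a).Nonempty
  · refine Or.inl (key h fun p => ?_)
    rw [← hne p]
    by_cases hp : p = b
    · subst hp
      simp only [Function.update_self, hemp, true_iff]
      exact ⟨a, ha⟩
    · rw [Function.update_of_ne hp]
  · refine Or.inr (key _ fun p => ?_)
    by_cases hp : p = b
    · subst hp
      simp only [Function.update_self, hemp, false_iff, removeBox, hb]
      omega
    · rw [Function.update_of_ne hp, hne p]
      refine and_congr_right fun hle => ?_
      simp only [removeBox, Function.update_apply]
      split_ifs with e
      · rw [e]
        have : p.1.val ≠ b.1.val := fun e' =>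
          hp (Prod.ext (Fin.ext e') (Fin.ext (by omega)))
        omega
      · rfl

theorem ncard_tableaux_allow (hh : IsShiftedShape k h) (hD : Precedes D a c) :
    (tableaux k L (allow D a c) h).ncard = (tableaux k L D h).ncard +
      if HasCorner h c then (tableaux k L D h).ncard + (tableaux k L D (removeBox h c)).ncard
      else 0 := by
  have hmono : tableaux k L D h ⊆ tableaux k L (allow D a c) h :=
    tableaux_mono fun _ _ => Or.inl
  have hDac : ¬ D a c := fun hac => by have := hD _ _ hac; omega
  split_ifs with hc
  · have hc1 := hc.1
    have hhc := hh c
    let b : Fin k × Fin k := (⟨h c - 1, by omega⟩, ⟨h c - 1 + c, by omega⟩)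
    have hb1 : b.1.val + 1 = h c := by simp only [b]; omega
    have hb2 : b.2.val = b.1.val + c := rfl
    have hb : b.2.val - b.1.val = c := by omega
    let ins (T : Fin k × Fin k → Finset (Fin L)) := Function.update T b (insert a (T b))
    have hnot {h' : ℕ → ℕ} {T} (hT : T ∈ tableaux k L D h') : a ∉ T b := fun ha =>
      hDac (hb ▸ hT.2.2.2.2.2 b a ha)
    have hsplit : tableaux k L (allow D a c) h = tableaux k L D h ∪
        ins '' (tableaux k L D h ∪ tableaux k L D (removeBox h c)) := by
      refine Set.Subset.antisymm (fun T hT => ?_) (Set.union_subset hmono ?_)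
      · by_cases ha : a ∈ T b
        · refine Or.inr ⟨_, erase_mem_tableaux hh hD hT hb ha, ?_⟩
          simp [ins, Finset.insert_erase ha]
        · refine Or.inl (mem_tableaux_of_forall_notMem hT fun p hp hap => ha ?_)
          obtain ⟨-, hp1, hp2⟩ := corner_of_mem hh hD hT hp hap
          obtain rfl : p = b := Prod.ext (Fin.ext (by omega)) (Fin.ext (by omega))
          exact hap
      · rintro _ ⟨T, hT | hT, rfl⟩
        · exact insert_mem_tableaux hh hD hc (fun _ _ _ => Iff.rfl) hT hb1 hb2
        · refine insert_mem_tableaux hh hD hc (fun i d hid => ?_) hT hb1 hb2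
          simp only [removeBox, Function.update_apply]
          split_ifs with e
          · subst e; omega
          · rfl
    have hinj : Set.InjOn ins (tableaux k L D h ∪ tableaux k L D (removeBox h c)) := by
      have hback {T} (hT : T ∈ tableaux k L D h ∪ tableaux k L D (removeBox h c)) :
          Function.update (ins T) b ((ins T b).erase a) = T := by
        have : a ∉ T b := hT.elim hnot hnot
        simp [ins, Finset.erase_insert this]
      intro T hT T' hT' e
      rw [← hback hT, ← hback hT', e]
    have hdisj : Disjoint (tableaux k L D h) (tableaux k L D (removeBox h c)) := by
      rw [Set.disjoint_left]
      intro T hT hT'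
      have h1 := (hT.1 b).2 ⟨by omega, by rw [hb]; omega⟩
      have h2 := ((hT'.1 b).1 h1).2
      rw [hb] at h2
      simp only [removeBox, Function.update_self] at h2
      omega
    have hdisj' : Disjoint (tableaux k L D h)
        (ins '' (tableaux k L D h ∪ tableaux k L D (removeBox h c))) := by
      rw [Set.disjoint_left]
      rintro _ hT ⟨T, -, rfl⟩
      exact hnot hT (by simp [ins])
    rw [hsplit, Set.ncard_union_eq hdisj', hinj.ncard_image,
      Set.ncard_union_eq hdisj]
  · rw [add_zero, Set.Subset.antisymm (fun T hT => ?_) hmono]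
    exact mem_tableaux_of_forall_notMem hT fun p hp hap => hc (corner_of_mem hh hD hT hp hap).1

/-- On shapes inside the staircase, `w` counts tableaux up to the factor `2 ^ e`. -/
def CountsTableaux (k L : ℕ) (D : ℕ → ℕ → Prop) (e : ℕ) (w : (ℕ → ℕ) → ℤ) : Prop :=
  ∀ h, IsShiftedShape k h → w h = 2 ^ e * (tableaux k L D h).ncard

theorem CountsTableaux.linFactor {e : ℕ} {w : (ℕ → ℕ) → ℤ} (hw : CountsTableaux k L D e w)
    (a : Fin L) (hD : Precedes D a c) :
    CountsTableaux k L (allow D a c) (e + 1) (linFactor (boxOp ℤ c) (3 : ℤ) w) := by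
  intro h hh
  rw [linFactor_boxOp_apply, boxOp_apply, ncard_tableaux_allow hh hD, hw h hh]
  split_ifs with hc
  · rw [hw _ (hh.removeBox hc)]
    push_cast
    ring
  · push_cast
    ring

theorem CountsTableaux.congr {D' : ℕ → ℕ → Prop} {e e' : ℕ} {w : (ℕ → ℕ) → ℤ}
    (hw : CountsTableaux k L D e w) (hDD : ∀ b d, D b d ↔ D' b d) (he : e = e') :
    CountsTableaux k L D' e' w := by
  obtain rfl : D = D' := by ext b d; exact hDD b d
  exact he ▸ hw

theorem CountsTableaux.palindrome {e s j : ℕ} (hs : 2 * s + 1 < L) {w : (ℕ → ℕ) → ℤ}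
    (hw : CountsTableaux k L D e w) (hD : ∀ b d, D b d → b < 2 * s ∨ b = 2 * s ∧ j < d) :
    CountsTableaux k L
      (fun b d => D b d ∨ (b = 2 * s ∧ d ≠ 0 ∧ d ≤ j) ∨ (b = 2 * s + 1 ∧ d ≤ j))
      (e + (2 * j + 1)) (palindrome (boxOp ℤ) (3 : ℤ) j w) := by
  induction j generalizing D e w with
  | zero =>
    refine (hw.linFactor (c := 0) ⟨2 * s + 1, hs⟩ fun b d hbd => ?_).congr (fun b d => ?_) rfl
    · have := hD b d hbd
      dsimp only
      omega
    · refine or_congr_right ?_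
      dsimp only
      omega
  | succ j ih =>
    have h1 := hw.linFactor (c := j + 1) ⟨2 * s, by omega⟩ fun b d hbd => by
      have := hD b d hbd
      dsimp only
      omega
    have h2 := ih h1 fun b d hbd => by
      rcases hbd with hbd | hbd
      · have := hD b d hbd
        omega
      · dsimp only at hbd
        omega
    have h3 := h2.linFactor (c := j + 1) ⟨2 * s + 1, hs⟩ fun b d hbd => by
      rcases hbd with (hbd | hbd) | hbd
      · have := hD b d hbd
        dsimp only
        omega
      · dsimp only at hbd ⊢
        omega
      · dsimp only
        omega
    refine h3.congr (fun b d => ?_) (by ring)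
    simp only [allow]
    by_cases hbd : D b d
    · simp [hbd]
    · simp only [hbd, false_or]
      omega

theorem countsTableaux_emptyShape :
    CountsTableaux k L (fun _ _ => False) 0 (emptyShape ℤ) := by
  intro h hh
  by_cases h0 : h = 0
  · subst h0
    have : tableaux k L (fun _ _ => False) 0 = {fun _ => ∅} := by
      ext T
      rw [Set.mem_singleton_iff]
      constructor
      · intro hT
        funext p
        rw [← Finset.not_nonempty_iff_eq_empty, hT.1 p]
        simp
      · rintro rfl
        simp [tableaux]
    simp [this, emptyShape]
  · have : tableaux k L (fun _ _ => False) h = ∅ := by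
      refine Set.eq_empty_of_forall_notMem fun T hT => h0 ?_
      funext c
      by_contra hc
      have hc' : 0 < h c := Nat.pos_of_ne_zero hc
      have := hh c
      obtain ⟨x, hx⟩ := (hT.1 (⟨0, by omega⟩, ⟨c, by omega⟩)).2 ⟨Nat.zero_le _, hc'⟩
      exact hT.2.2.2.2.2 _ x hx
    simp [this, emptyShape, h0]

theorem countsTableaux_replicate (m N : ℕ) (hN : 2 * N ≤ L) :
    CountsTableaux k L (fun b d => b < 2 * N ∧ d ≤ m ∧ (b % 2 = 0 → d ≠ 0))
      (N * (2 * m + 1))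
      (((List.replicate N (3 : ℤ)).map fun x => palindrome (boxOp ℤ) x m).prod
        (emptyShape ℤ)) := by
  induction N with
  | zero => exact countsTableaux_emptyShape.congr (by simp) (by simp)
  | succ N ih =>
    have := (ih (by omega)).palindrome (s := N) (j := m) (by omega) fun b d hbd => Or.inl hbd.1
    simp only [List.replicate_succ, List.map_cons, List.prod_cons, Module.End.mul_apply]
    exact this.congr (fun b d => by omega) (by ring)

theorem setOf_isSSVTPStair (m n : ℕ) :
    {T | IsSSVTPStair (m + 2) n T} = tableaux (m + 2) (2 * n)
      (fun b d => b < 2 * n ∧ d ≤ m ∧ (b % 2 = 0 → d ≠ 0)) (stairHeight (m + 1)) := by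
  have hbox (p : Fin (m + 2) × Fin (m + 2)) : ShiftedStairBox (m + 2) p ↔
      p.1.val ≤ p.2.val ∧ p.1.val < stairHeight (m + 1) (p.2.val - p.1.val) := by
    simp only [ShiftedStairBox, stairHeight]
    omega
  ext T
  constructor
  · rintro ⟨h1, h2, h3, h4, h5, h6, h7⟩
    have hne (p) : (T p).Nonempty ↔ ShiftedStairBox (m + 2) p :=
      ⟨fun hp => by_contra fun hb => by simp [h2 p hb] at hp, h1 p⟩
    refine ⟨fun p => (hne p).trans (hbox p), h3, h4, h5, h6, fun p a ha => ⟨a.2, ?_, fun he h0 => ?_⟩⟩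
    · have := (hne p).1 ⟨a, ha⟩
      simp only [ShiftedStairBox] at this
      omega
    · have hp := ((hne p).1 ⟨a, ha⟩).1
      have := h7 p (Fin.ext (by omega)) a ha
      omega
  · rintro ⟨h1, h3, h4, h5, h6, h7⟩
    have hne (p) : (T p).Nonempty ↔ ShiftedStairBox (m + 2) p := (h1 p).trans (hbox p).symm
    refine ⟨fun p => (hne p).2, fun p hp => ?_, h3, h4, h5, h6, fun p hp a ha => ?_⟩
    · rwa [← Finset.not_nonempty_iff_eq_empty, hne p]
    · have := (h7 p a ha).2.2
      rw [hp] at this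
      omega

end Tableaux

/-- For `k ≥ 1` and `n ≥ k - 1`, the number of shifted set-valued semistandard tableaux of
shifted staircase shape `δ̃_k` with entries in `{1', 1, …, n', n}` is divisible by
`3^{(k-1)(k-2)/2}`. -/
theorem ssvtP_staircase_card_three_power (k n : ℕ) (hk : 1 ≤ k) (hn : k - 1 ≤ n) :
    3 ^ ((k - 1) * (k - 2) / 2) ∣
      Nat.card {T : Fin k × Fin k → Finset (Fin (2 * n)) // IsSSVTPStair k n T} := by
  obtain rfl | ⟨m, rfl⟩ : k = 1 ∨ ∃ m, k = m + 2 :=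
    (Nat.lt_or_ge k 2).imp (by omega) fun h => ⟨k - 2, by omega⟩
  · simp
  have hshape : IsShiftedShape (m + 2) (stairHeight (m + 1)) := by
    intro c
    simp only [stairHeight]
    omega
  have hcard := countsTableaux_replicate (k := m + 2) m n le_rfl _ hshape
  rw [← setOf_isSSVTPStair] at hcard
  have hdvd := three_pow_dvd_stairCoeff m n
  rw [stairCoeff, hcard] at hdvd
  have hcop : IsCoprime ((3 : ℤ) ^ ((m + 1) * m / 2)) (2 ^ (n * (2 * m + 1))) :=
    IsCoprime.pow ⟨1, -1, by norm_num⟩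
  have := hcop.dvd_of_dvd_mul_left hdvd
  exact_mod_cast this
end
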